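/- Let (X,f) be asymptotically entropy expansive and suppose (X,f,φ) has the Climenhaga–Thompson structure. Then the set SP(φ) := {P_μ(φ) : μ ∈ ergodic invariant measures} is dense in [P*(φ), P(φ)], where P*(φ) := liminf_n sup_x (1/n)Σ_{k=0}^{n-1}φ(f^k x). In particular, taking φ = 0, the set of metric entropies of ergodic measures is dense in [0, h(f)]. -/

import Mathlib

open Filter Topology

/-- Birkhoff sum `Φ(x,n) = Σ_{k=0}^{n-1} φ(f^k x)`. -/
noncomputable def birk {X : Type*} (f : X → X) (φ : X → ℝ) (x : X) (n : ℕ) : ℝ :=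
  ∑ k ∈ Finset.range n, φ (f^[k] x)

/-- The variation of a potential at scale ε. -/
noncomputable def varphi {X : Type*} [MetricSpace X] (φ : X → ℝ) (ε : ℝ) : ℝ :=
  sSup {v | ∃ x y : X, dist x y ≤ ε ∧ v = |φ x - φ y|}

/-- `E` is an `(n,δ)`-separated set. -/
def IsSep {X : Type*} [MetricSpace X] (f : X → X) (n : ℕ) (δ : ℝ) (E : Finset X) : Prop :=
  ∀ x ∈ E, ∀ y ∈ E, x ≠ y → ∃ k < n, δ < dist (f^[k] x) (f^[k] y)

/-- `Φ(x,n,ε) = sup { Φ(y,n) : y ∈ closed Bowen ball B_n(x,ε) }`; for `ε = 0` this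
equals `Φ(x,n)`. -/
noncomputable def phiSup {X : Type*} [MetricSpace X] (f : X → X) (φ : X → ℝ)
    (x : X) (n : ℕ) (ε : ℝ) : ℝ :=
  sSup {s | ∃ y : X, (∀ k < n, dist (f^[k] x) (f^[k] y) ≤ ε) ∧ s = birk f φ y n}

/-- Partition function `Θ(C,φ,n,δ,ε)` over `(n,δ)`-separated subsets of the section
`C^(n)`. -/
noncomputable def Theta {X : Type*} [MetricSpace X] (f : X → X) (φ : X → ℝ)
    (C : Set (X × ℕ)) (n : ℕ) (δ ε : ℝ) : ℝ :=
  sSup {s | ∃ E : Finset X, (∀ x ∈ E, (x, n) ∈ C) ∧ IsSep f n δ E ∧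
    s = ∑ x ∈ E, Real.exp (phiSup f φ x n ε)}

/-- The pressure `P(C,φ,δ,ε) = limsup_n (1/n) ln Θ(C,φ,n,δ,ε)`. -/
noncomputable def Pres {X : Type*} [MetricSpace X] (f : X → X) (φ : X → ℝ)
    (C : Set (X × ℕ)) (δ ε : ℝ) : ℝ :=
  Filter.limsup (fun n : ℕ => Real.log (Theta f φ C n δ ε) / n) Filter.atTop

/-- The topological pressure `P(φ) = lim_{δ→0} P(X×ℕ, φ, δ) = sup_{δ>0} P(X×ℕ, φ, δ)`. -/
noncomputable def PresTop {X : Type*} [MetricSpace X] (f : X → X) (φ : X → ℝ) : ℝ :=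
  ⨆ δ : {d : ℝ // 0 < d}, Pres f φ Set.univ (δ : ℝ) 0

/-- Maximal cardinality (as a real number) of `(n,ε)`-separated subsets of `K`. -/
noncomputable def sepCount {X : Type*} [MetricSpace X] (f : X → X) (K : Set X)
    (n : ℕ) (ε : ℝ) : ℝ :=
  sSup {c | ∃ E : Finset X, ↑E ⊆ K ∧ IsSep f n ε E ∧ c = (E.card : ℝ)}

/-- Topological entropy of `f` on the set `K`, via separated sets. -/
noncomputable def entSet {X : Type*} [MetricSpace X] (f : X → X) (K : Set X) : ℝ :=
  ⨆ ε : {e : ℝ // 0 < e},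
    Filter.limsup (fun n : ℕ => Real.log (sepCount f K n ε) / n) Filter.atTop

/-- The infinite Bowen ball `Γ_ε(x)`. -/
def infBall {X : Type*} [MetricSpace X] (f : X → X) (ε : ℝ) (x : X) : Set X :=
  {y | ∀ n : ℕ, dist (f^[n] x) (f^[n] y) < ε}

/-- Tail entropy `h*(f,ε) = sup_x h(Γ_ε(x), f)`. -/
noncomputable def tailEnt {X : Type*} [MetricSpace X] (f : X → X) (ε : ℝ) : ℝ :=
  ⨆ x : X, entSet f (infBall f ε x)
open MeasureTheory in
/-- Minimal number (as a real) of `(n,ε)`-Bowen balls needed to cover a set of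
`μ`-measure greater than `1/2` (Katok's definition of metric entropy). -/
noncomputable def katokCount {X : Type*} [MetricSpace X] [MeasurableSpace X]
    (f : X → X) (μ : Measure X) (n : ℕ) (ε : ℝ) : ℝ :=
  sInf {c | ∃ F : Finset X,
    (1 / 2 : ENNReal) < μ (⋃ x ∈ F, {y | ∀ k < n, dist (f^[k] x) (f^[k] y) < ε}) ∧
    c = (F.card : ℝ)}

open MeasureTheory in
/-- Metric (Kolmogorov–Sinai) entropy of `μ`, via Katok's formula. -/
noncomputable def metEnt {X : Type*} [MetricSpace X] [MeasurableSpace X]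
    (f : X → X) (μ : Measure X) : ℝ :=
  ⨆ ε : {e : ℝ // 0 < e},
    Filter.limsup (fun n : ℕ => Real.log (katokCount f μ n ε) / n) Filter.atTop

open MeasureTheory in
/-- The pressure of the measure `μ`: `P_μ(φ) = h_μ(f) + ∫ φ dμ`. -/
noncomputable def Pmu {X : Type*} [MetricSpace X] [MeasurableSpace X]
    (f : X → X) (φ : X → ℝ) (μ : Measure X) : ℝ :=
  metEnt f μ + ∫ x, φ x ∂μ
/-- Pressure of `φ` on a subset `Y ⊆ X` at scale `δ` (i.e. `P(Y×ℕ, φ, δ)`). -/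
noncomputable def PresOn {X : Type*} [MetricSpace X] (f : X → X) (φ : X → ℝ)
    (Y : Set X) (δ : ℝ) : ℝ :=
  Pres f φ (Y ×ˢ (Set.univ : Set ℕ)) δ 0

/-- `C ⊆ X × ℕ` satisfies `GO(δ, N₀, τ)`: every sequence of orbit segments from `C` of
lengths at least `N₀` can be δ-traced with gaps in `{0,…,τ-1}`. -/
def GOat {X : Type*} [MetricSpace X] (f : X → X) (C : Set (X × ℕ)) (δ : ℝ)
    (N₀ τ : ℕ) : Prop :=
  ∀ (x : ℕ → X) (m : ℕ → ℕ), (∀ k, (x k, m k) ∈ C) → (∀ k, N₀ ≤ m k) →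
    ∃ (r : ℕ → ℕ) (z : X), (∀ k, r k < τ) ∧
      ∀ k, ∀ j < m k,
        dist (f^[(∑ i ∈ Finset.range k, (m i + r i)) + j] z) (f^[j] (x k)) ≤ δ

/-- `C` satisfies `GO(δ)`: `GO(δ,N₀,τ)` for some `N₀` and some `τ ≥ 1`. -/
def GOdelta {X : Type*} [MetricSpace X] (f : X → X) (C : Set (X × ℕ)) (δ : ℝ) : Prop :=
  ∃ N₀ τ : ℕ, 0 < τ ∧ GOat f C δ N₀ τ

/-- `C` satisfies the gluing orbit property: `GO(δ)` for every `δ > 0`. -/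
def GluingOrbit {X : Type*} [MetricSpace X] (f : X → X) (C : Set (X × ℕ)) : Prop :=
  ∀ δ : ℝ, 0 < δ → GOdelta f C δ

/-- The set `NE(ε)` of points whose infinite `ε`-Bowen ball is nontrivial. -/
def NEset {X : Type*} [MetricSpace X] (f : X → X) (ε : ℝ) : Set X :=
  {x | ∃ y, y ≠ x ∧ ∀ n : ℕ, dist (f^[n] x) (f^[n] y) < ε}

open MeasureTheory in
/-- The pressure of obstructions to expansivity at scale `ε`:
`P⊥_exp(φ,ε) = sup{P_μ(φ) : μ ergodic, μ(NE(ε)) > 0}`. -/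
noncomputable def Pexp {X : Type*} [MetricSpace X] [MeasurableSpace X]
    (f : X → X) (φ : X → ℝ) (ε : ℝ) : ℝ :=
  sSup {v | ∃ μ : Measure X, IsProbabilityMeasure μ ∧ Ergodic f μ ∧
    0 < μ (NEset f ε) ∧ v = Pmu f φ μ}

/-- `P*(φ) = liminf_n sup_x (1/n) Σ_{k<n} φ(f^k x)`. -/
noncomputable def Pstar {X : Type*} [MetricSpace X] (f : X → X) (φ : X → ℝ) : ℝ :=
  Filter.liminf (fun n : ℕ => sSup {v | ∃ x : X, v = birk f φ x n / n}) Filter.atTop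

/-- The pressure of `φ` on a collection `C ⊆ X × ℕ`: `P(C,φ) = lim_{δ→0} P(C,φ,δ)`. -/
noncomputable def PresFull {X : Type*} [MetricSpace X] (f : X → X) (φ : X → ℝ)
    (C : Set (X × ℕ)) : ℝ :=
  ⨆ δ : {d : ℝ // 0 < d}, Pres f φ C (δ : ℝ) 0

/-- `P⊥_exp(φ) = lim_{ε→0} P⊥_exp(φ,ε) = inf_{ε>0} P⊥_exp(φ,ε)`. -/
noncomputable def PexpFull {X : Type*} [MetricSpace X] [MeasurableSpace X]
    (f : X → X) (φ : X → ℝ) : ℝ :=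
  ⨅ ε : {e : ℝ // 0 < e}, Pexp f φ (ε : ℝ)

section BowenCover

variable {X : Type*} [MetricSpace X] {f : X → X}

/-- `A` is covered by at most `c` sets whose diameter in the `n`-th Bowen metric is below `ε`. -/
def BCov (f : X → X) (A : Set X) (n : ℕ) (ε c : ℝ) : Prop :=
  ∃ P : Finset (Set X), (∀ y ∈ A, ∃ s ∈ P, y ∈ s) ∧
    (∀ s ∈ P, ∀ y ∈ s, ∀ z ∈ s, ∀ k < n, dist (f^[k] y) (f^[k] z) < ε) ∧ (P.card : ℝ) ≤ c

/-- The closed Bowen ball. -/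
def bowenBall (f : X → X) (n : ℕ) (δ : ℝ) (x : X) : Set X :=
  {y | ∀ k < n, dist (f^[k] x) (f^[k] y) ≤ δ}

theorem BCov.mono {A B : Set X} {n m : ℕ} {ε ε' c c' : ℝ} (h : BCov f A n ε c) (hAB : B ⊆ A)
    (hn : m ≤ n) (hε : ε ≤ ε') (hc : c ≤ c') : BCov f B m ε' c' := by
  obtain ⟨P, h1, h2, h3⟩ := h
  exact ⟨P, fun y hy => h1 y (hAB hy),
    fun s hs y hy z hz k hk => (h2 s hs y hy z hz k (hk.trans_le hn)).trans_le hε, h3.trans hc⟩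

theorem BCov.mono_bound {A : Set X} {n : ℕ} {ε c c' : ℝ} (h : BCov f A n ε c) (hc : c ≤ c') :
    BCov f A n ε c' := h.mono subset_rfl le_rfl le_rfl hc

theorem BCov.mono_set {A B : Set X} {n : ℕ} {ε c : ℝ} (h : BCov f A n ε c) (hAB : B ⊆ A) :
    BCov f B n ε c := h.mono hAB le_rfl le_rfl le_rfl

theorem bcov_empty (n : ℕ) (ε : ℝ) {c : ℝ} (hc : 0 ≤ c) : BCov f ∅ n ε c :=
  ⟨∅, by simp, by simp, by simpa using hc⟩

open Classical in
theorem BCov.union {A B : Set X} {n : ℕ} {ε c c' : ℝ} (hA : BCov f A n ε c)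
    (hB : BCov f B n ε c') : BCov f (A ∪ B) n ε (c + c') := by
  obtain ⟨P, h1, h2, h3⟩ := hA
  obtain ⟨Q, g1, g2, g3⟩ := hB
  refine ⟨P ∪ Q, ?_, ?_, ?_⟩
  · rintro y (hy | hy)
    · obtain ⟨s, hs, hys⟩ := h1 y hy
      exact ⟨s, Finset.mem_union_left _ hs, hys⟩
    · obtain ⟨s, hs, hys⟩ := g1 y hy
      exact ⟨s, Finset.mem_union_right _ hs, hys⟩
  · intro s hs
    rcases Finset.mem_union.1 hs with hs | hs
    · exact h2 s hs
    · exact g2 s hs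
  · have : ((P ∪ Q).card : ℝ) ≤ P.card + Q.card := by exact_mod_cast Finset.card_union_le P Q
    linarith

theorem bcov_biUnion {ι : Type*} (J : Finset ι) {A : ι → Set X} {n : ℕ} {ε : ℝ} {c : ι → ℝ}
    (h : ∀ j ∈ J, BCov f (A j) n ε (c j)) : BCov f (⋃ j ∈ J, A j) n ε (∑ j ∈ J, c j) := by
  classical
  induction J using Finset.induction_on with
  | empty => simpa using bcov_empty n ε le_rfl
  | insert a s ha ih =>
    rw [Finset.sum_insert ha, Finset.set_biUnion_insert]
    exact (h a (by simp)).union (ih fun j hj => h j (by simp [hj]))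

open Classical in
theorem BCov.mul {A B : Set X} {n m : ℕ} {ε c c' : ℝ} (hA : BCov f A n ε c)
    (hB : BCov f B m ε c') (hAB : ∀ y ∈ A, f^[n] y ∈ B) : BCov f A (n + m) ε (c * c') := by
  obtain ⟨P, h1, h2, h3⟩ := hA
  obtain ⟨Q, g1, g2, g3⟩ := hB
  refine ⟨Finset.image₂ (fun s t => s ∩ f^[n] ⁻¹' t) P Q, ?_, ?_, ?_⟩
  · intro y hy
    obtain ⟨s, hs, hys⟩ := h1 y hy
    obtain ⟨t, ht, hyt⟩ := g1 _ (hAB y hy)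
    exact ⟨_, Finset.mem_image₂_of_mem hs ht, hys, hyt⟩
  · intro s hs
    obtain ⟨s', hs', t, ht, rfl⟩ := Finset.mem_image₂.1 hs
    rintro y ⟨hy, hy'⟩ z ⟨hz, hz'⟩ k hk
    by_cases hkn : k < n
    · exact h2 s' hs' y hy z hz k hkn
    · have := g2 t ht _ hy' _ hz' (k - n) (by omega)
      rwa [← Function.iterate_add_apply, ← Function.iterate_add_apply,
        Nat.sub_add_cancel (by omega)] at this
  · have h4 : ((Finset.image₂ (fun s t => s ∩ f^[n] ⁻¹' t) P Q).card : ℝ) ≤ P.card * Q.card := by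
      exact_mod_cast Finset.card_image₂_le _ P Q
    exact h4.trans (mul_le_mul h3 g3 (Nat.cast_nonneg _) ((Nat.cast_nonneg _).trans h3))

theorem BCov.refine {A B : Set X} {n : ℕ} {δ ε c c' : ℝ} (hA : BCov f A n δ c) (hBA : B ⊆ A)
    (hc' : 0 ≤ c') (h : ∀ x ∈ B, BCov f (bowenBall f n δ x) n ε c') : BCov f B n ε (c * c') := by
  classical
  obtain ⟨P, h1, h2, h3⟩ := hA
  have h4 : ∀ s ∈ P, BCov f (s ∩ B) n ε c' := by
    intro s hs
    rcases (s ∩ B).eq_empty_or_nonempty with h0 | ⟨x, hx⟩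
    · rw [h0]
      exact bcov_empty n ε hc'
    · exact (h x hx.2).mono_set fun y hy k hk => (h2 s hs x hx.1 y hy.1 k hk).le
  have h5 := bcov_biUnion P h4
  rw [Finset.sum_const, nsmul_eq_mul] at h5
  refine (h5.mono_set ?_).mono_bound (mul_le_mul_of_nonneg_right h3 hc')
  intro y hy
  obtain ⟨s, hs, hys⟩ := h1 y (hBA hy)
  exact Set.mem_biUnion hs ⟨hys, hy⟩

open Classical in
theorem BCov.image {A : Set X} {n t : ℕ} {ε c : ℝ} (hA : BCov f A (t + n) ε c) :
    BCov f (f^[t] '' A) n ε c := by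
  obtain ⟨P, h1, h2, h3⟩ := hA
  refine ⟨P.image (fun s => f^[t] '' s), ?_, ?_, ?_⟩
  · rintro _ ⟨y, hy, rfl⟩
    obtain ⟨s, hs, hys⟩ := h1 y hy
    exact ⟨_, Finset.mem_image_of_mem _ hs, y, hys, rfl⟩
  · intro s hs
    obtain ⟨s', hs', rfl⟩ := Finset.mem_image.1 hs
    rintro _ ⟨y, hy, rfl⟩ _ ⟨z, hz, rfl⟩ k hk
    have := h2 s' hs' y hy z hz (k + t) (by omega)
    rwa [Function.iterate_add_apply, Function.iterate_add_apply] at this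
  · exact le_trans (by exact_mod_cast Finset.card_image_le) h3

open Classical in
theorem BCov.closure (hf : Continuous f) {A : Set X} {n : ℕ} {ε ε' c : ℝ} (hA : BCov f A n ε c)
    (hε : ε < ε') : BCov f (closure A) n ε' c := by
  obtain ⟨P, h1, h2, h3⟩ := hA
  refine ⟨P.image (fun s => _root_.closure s), ?_, ?_, ?_⟩
  · have hsub : _root_.closure A ⊆ ⋃ s ∈ P, _root_.closure s := by
      rw [← P.closure_biUnion]
      refine closure_mono fun y hy => ?_
      obtain ⟨s, hs, hys⟩ := h1 y hy
      exact Set.mem_biUnion hs hys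
    intro y hy
    obtain ⟨s, hs, hys⟩ := Set.mem_iUnion₂.1 (hsub hy)
    exact ⟨_, Finset.mem_image_of_mem _ hs, hys⟩
  · intro s hs
    obtain ⟨s', hs', rfl⟩ := Finset.mem_image.1 hs
    intro y hy z hz k hk
    have hcl : IsClosed {q : X × X | dist (f^[k] q.1) (f^[k] q.2) ≤ ε} :=
      isClosed_le (((hf.iterate k).comp continuous_fst).dist
        ((hf.iterate k).comp continuous_snd)) continuous_const
    have : (y, z) ∈ _root_.closure (s' ×ˢ s') := by
      rw [closure_prod_eq]; exact ⟨hy, hz⟩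
    have h5 : (y, z) ∈ {q : X × X | dist (f^[k] q.1) (f^[k] q.2) ≤ ε} :=
      closure_minimal (fun q hq => (h2 s' hs' q.1 hq.1 q.2 hq.2 k hk).le) hcl this
    exact lt_of_le_of_lt h5 hε
  · exact le_trans (by exact_mod_cast Finset.card_image_le) h3

theorem BCov.card_le {A : Set X} {n : ℕ} {ε c : ℝ} (hA : BCov f A n ε c) {E : Finset X}
    (hE : ∀ x ∈ E, x ∈ A) (hs : IsSep f n ε E) : (E.card : ℝ) ≤ c := by
  obtain ⟨P, h1, h2, h3⟩ := hA
  choose! g hg hg' using h1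
  refine le_trans ?_ h3
  norm_cast
  refine Finset.card_le_card_of_injOn g (fun x hx => hg x (hE x hx)) ?_
  intro x hx y hy hxy
  by_contra hne
  obtain ⟨k, hk, hd⟩ := hs x hx y hy hne
  have := h2 _ (hg x (hE x hx)) x (hg' x (hE x hx)) y (hxy ▸ hg' y (hE y hy)) k hk
  linarith

theorem IsSep.mono_scale {n : ℕ} {ε δ : ℝ} {E : Finset X} (h : IsSep f n ε E) (hδ : δ ≤ ε) :
    IsSep f n δ E := fun x hx y hy hne =>
  let ⟨k, hk, hd⟩ := h x hx y hy hne
  ⟨k, hk, hδ.trans_lt hd⟩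

theorem IsSep.subset {n : ℕ} {ε : ℝ} {E E' : Finset X} (h : IsSep f n ε E) (hE : E' ⊆ E) :
    IsSep f n ε E' := fun x hx y hy hne => h x (hE hx) y (hE hy) hne

theorem exists_bcov_one [CompactSpace X] {ε : ℝ} (hε : 0 < ε) :
    ∃ C : ℝ, 1 ≤ C ∧ BCov f (Set.univ : Set X) 1 ε C := by
  classical
  obtain ⟨t, -, htf, hcov⟩ := (isCompact_univ (X := X)).finite_cover_balls (half_pos hε)
  refine ⟨max 1 ((htf.toFinset.image fun x => Metric.ball x (ε / 2)).card : ℝ), le_max_left _ _,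
    htf.toFinset.image fun x => Metric.ball x (ε / 2), ?_, ?_, le_max_right _ _⟩
  · intro y _
    obtain ⟨x, hx, hy⟩ := Set.mem_iUnion₂.1 (hcov (Set.mem_univ y))
    exact ⟨_, Finset.mem_image_of_mem _ (htf.mem_toFinset.2 hx), hy⟩
  · intro s hs
    obtain ⟨x, -, rfl⟩ := Finset.mem_image.1 hs
    intro y hy z hz k hk
    obtain rfl : k = 0 := by omega
    rw [Metric.mem_ball] at hy hz
    have := dist_triangle_right y z x
    simp only [Function.iterate_zero, id]
    linarith

theorem BCov.pow {C ε : ℝ} (h : BCov f (Set.univ : Set X) 1 ε C) (n : ℕ) :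
    BCov f (Set.univ : Set X) n ε (C ^ n) := by
  induction n with
  | zero => exact ⟨{Set.univ}, by simp, by simp, by simp⟩
  | succ n ih =>
    rw [pow_succ]
    exact ih.mul h fun _ _ => Set.mem_univ _

/-- A maximal separated set whose cardinality is bounded produces a Bowen cover. -/
theorem exists_maximal_sep {A : Set X} {n : ℕ} {δ c : ℝ} (hδ : 0 ≤ δ)
    (hc : ∀ E : Finset X, (∀ x ∈ E, x ∈ A) → IsSep f n δ E → (E.card : ℝ) ≤ c) :
    ∃ E : Finset X, (∀ x ∈ E, x ∈ A) ∧ IsSep f n δ E ∧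
      ∀ y ∈ A, ∃ x ∈ E, y ∈ bowenBall f n δ x := by
  classical
  have hbdd : ∃ N : ℕ, ∀ E : Finset X, (∀ x ∈ E, x ∈ A) → IsSep f n δ E → E.card ≤ N :=
    ⟨⌊c⌋₊, fun E h1 h2 => Nat.le_floor (hc E h1 h2)⟩
  obtain ⟨N, hN⟩ := hbdd
  let S : Set ℕ := {k | ∃ E : Finset X, (∀ x ∈ E, x ∈ A) ∧ IsSep f n δ E ∧ E.card = k}
  have hS : S.Nonempty := ⟨0, ∅, by simp, by simp [IsSep], rfl⟩
  have hSb : BddAbove S := ⟨N, by rintro _ ⟨E, h1, h2, rfl⟩; exact hN E h1 h2⟩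
  obtain ⟨E, h1, h2, h3⟩ := Nat.sSup_mem hS hSb
  refine ⟨E, h1, h2, fun y hy => ?_⟩
  by_contra hcon
  push Not at hcon
  have hyE : y ∉ E := by
    intro hyE
    exact hcon y hyE fun k _ => by simpa using hδ
  have hsep : IsSep f n δ (insert y E) := by
    have key : ∀ x ∈ E, ∃ k < n, δ < dist (f^[k] x) (f^[k] y) := by
      intro x hx
      have := hcon x hx
      simpa [bowenBall] using this
    intro u hu v hv huv
    rcases Finset.mem_insert.1 hu with hu' | hu' <;> rcases Finset.mem_insert.1 hv with hv' | hv'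
    · exact absurd (hu'.trans hv'.symm) huv
    · obtain ⟨k, hk, hd⟩ := key v hv'
      exact ⟨k, hk, by rwa [dist_comm, hu']⟩
    · rw [hv']; exact key u hu'
    · exact h2 u hu' v hv' huv
  have h5 : (insert y E).card ∈ S :=
    ⟨insert y E, by
      intro x hx
      rcases Finset.mem_insert.1 hx with rfl | hx
      · exact hy
      · exact h1 x hx, hsep, rfl⟩
  have h6 := le_csSup hSb h5
  rw [Finset.card_insert_of_notMem hyE, h3] at h6
  omega

theorem bcov_of_spanning {A : Set X} {n : ℕ} {δ ε : ℝ} {E : Finset X} (hε : 2 * δ < ε)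
    (h : ∀ y ∈ A, ∃ x ∈ E, y ∈ bowenBall f n δ x) : BCov f A n ε E.card := by
  classical
  refine ⟨E.image fun x => bowenBall f n δ x, ?_, ?_, by exact_mod_cast Finset.card_image_le⟩
  · intro y hy
    obtain ⟨x, hx, hxy⟩ := h y hy
    exact ⟨_, Finset.mem_image_of_mem _ hx, hxy⟩
  · intro s hs
    obtain ⟨x, -, rfl⟩ := Finset.mem_image.1 hs
    intro y hy z hz k hk
    have h1 := hy k hk
    have h2 := hz k hk
    have := dist_triangle_left (f^[k] y) (f^[k] z) (f^[k] x)
    linarith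

end BowenCover

section Parse

variable {X : Type*} [MetricSpace X] {f : X → X}

/-- The number of times below `N` at which the orbit of `y` lies outside `V`. -/
noncomputable def badCount {X : Type*} (f : X → X) (V : Set X) (y : X) (N : ℕ) : ℕ :=
  ∑ t ∈ Finset.range N, Vᶜ.indicator (fun _ => 1) (f^[t] y)

theorem badCount_add {X : Type*} (f : X → X) (V : Set X) (y : X) (n m : ℕ) :
    badCount f V y (n + m) = badCount f V y n + badCount f V (f^[n] y) m := by
  unfold badCount
  rw [Finset.sum_range_add]
  congr 1
  refine Finset.sum_congr rfl fun t _ => ?_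
  rw [← Function.iterate_add_apply, add_comm t n]

theorem badCount_one_of_notMem {X : Type*} (f : X → X) {V : Set X} {y : X} (hy : y ∉ V) :
    badCount f V y 1 = 1 := by
  simp [badCount, hy]

theorem badCount_anti {X : Type*} (f : X → X) {V V' : Set X} (h : V ⊆ V') (y : X) (n : ℕ) :
    badCount f V' y n ≤ badCount f V y n := by
  refine Finset.sum_le_sum fun t _ => ?_
  exact Set.indicator_le_indicator_of_subset (Set.compl_subset_compl.2 h) (fun _ => Nat.zero_le _) _

theorem badCount_univ {X : Type*} (f : X → X) (y : X) (n : ℕ) :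
    badCount f Set.univ y n = 0 := by
  simp [badCount]

/-- If finitely many tiles, each with exponential covering growth, cover `V`, then orbits which
visit the complement of `V` rarely have controlled covering growth. -/
theorem bcov_badCount_le {ι : Type*} (J : Finset ι) {R : ι → Set X} {ℓ : ι → ℕ} {V : Set X}
    {h η ε C K : ℝ} (hℓ : ∀ j ∈ J, 1 ≤ ℓ j)
    (hR : ∀ j ∈ J, BCov f (R j) (ℓ j) ε (Real.exp (h * ℓ j)))
    (hη : ∑ j ∈ J, Real.exp (-(η * ℓ j)) ≤ 1 / 2) (hV : V ⊆ ⋃ j ∈ J, R j)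
    (hC : BCov f (Set.univ : Set X) 1 ε C) (hC1 : 1 ≤ C) (hK : 2 * C ≤ K * Real.exp (h + η))
    (hK1 : 1 ≤ K) :
    ∃ A : ℝ, 0 < A ∧ ∀ N b : ℕ,
      BCov f {y | badCount f V y N ≤ b} N ε (A * K ^ b * Real.exp ((h + η) * N)) := by
  set M := J.sup ℓ with hM
  have hC0 : 0 < C := by linarith
  have hK0 : 0 < K := by linarith
  refine ⟨C ^ M * Real.exp (|h + η| * M), by positivity, ?_⟩
  set A := C ^ M * Real.exp (|h + η| * M) with hA
  have hA0 : 0 < A := by positivity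
  intro N
  induction N using Nat.strong_induction_on with
  | _ N ih =>
  intro b
  by_cases hNM : N ≤ M
  · refine ((hC.pow N).mono_set (Set.subset_univ _)).mono_bound ?_
    have h1 : C ^ N ≤ C ^ M := pow_le_pow_right₀ hC1 hNM
    have h2 : 1 ≤ Real.exp (|h + η| * M) * Real.exp ((h + η) * N) := by
      rw [← Real.exp_add]
      apply Real.one_le_exp
      have h3 : |h + η| * N ≤ |h + η| * M :=
        mul_le_mul_of_nonneg_left (by exact_mod_cast hNM) (abs_nonneg _)
      have h4 : -(|h + η|) * N ≤ (h + η) * N :=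
        mul_le_mul_of_nonneg_right (neg_abs_le _) (Nat.cast_nonneg _)
      linarith
    have h3 : 1 ≤ K ^ b := one_le_pow₀ hK1
    calc C ^ N ≤ C ^ M * 1 * 1 := by linarith
      _ ≤ C ^ M * K ^ b * (Real.exp (|h + η| * M) * Real.exp ((h + η) * N)) := by gcongr
      _ = _ := by rw [hA]; ring
  · rw [not_le] at hNM
    have hl : ∀ j ∈ J, ℓ j ≤ M := fun j hj => Finset.le_sup hj
    have h1 : ∀ j ∈ J, BCov f {y | y ∈ R j ∧ badCount f V y N ≤ b} N ε
        (A * K ^ b * Real.exp ((h + η) * N) * Real.exp (-(η * ℓ j))) := by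
      intro j hj
      have hj' := hl j hj
      have hB := ih (N - ℓ j) (by have := hℓ j hj; omega) b
      have hm := BCov.mul ((hR j hj).mono_set (B := {y | y ∈ R j ∧ badCount f V y N ≤ b})
        fun y hy => hy.1) hB (by
          rintro y ⟨-, hy⟩
          have : N = ℓ j + (N - ℓ j) := by omega
          rw [this, badCount_add] at hy
          exact (Nat.le_add_left _ _).trans hy)
      rw [show ℓ j + (N - ℓ j) = N by omega] at hm
      refine hm.mono_bound (le_of_eq ?_)
      rw [Nat.cast_sub (by omega)]
      rw [mul_left_comm, mul_assoc (A * K ^ b), ← Real.exp_add, ← Real.exp_add]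
      congr 2
      ring
    have h2 : BCov f {y | y ∉ V ∧ badCount f V y N ≤ b} N ε
        (A * K ^ b * Real.exp ((h + η) * N) * (1 / 2)) := by
      have hN : N = 1 + (N - 1) := by omega
      rcases b with _ | b
      · have : {y | y ∉ V ∧ badCount f V y N ≤ 0} = ∅ := by
          ext y
          simp only [Set.mem_ofPred_eq, Set.mem_empty_iff_false, iff_false, not_and]
          intro hy
          rw [hN, badCount_add, badCount_one_of_notMem f hy]
          omega
        rw [this]
        exact bcov_empty _ _ (by positivity)
      · have hB := ih (N - 1) (by omega) b
        have hm := BCov.mul (hC.mono_set (Set.subset_univ {y | y ∉ V ∧ badCount f V y N ≤ b + 1}))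
          hB (by
            rintro y ⟨hy, hy'⟩
            rw [hN, badCount_add, badCount_one_of_notMem f hy] at hy'
            simp only [Set.mem_ofPred_eq]
            omega)
        rw [← hN] at hm
        refine hm.mono_bound ?_
        have hE : Real.exp ((h + η) * N) = Real.exp (h + η) * Real.exp ((h + η) * (N - 1 : ℕ)) := by
          rw [← Real.exp_add, Nat.cast_sub (by omega)]
          congr 1
          push_cast
          ring
        rw [hE, pow_succ]
        have : 0 ≤ A * K ^ b * Real.exp ((h + η) * (N - 1 : ℕ)) := by positivity
        nlinarith
    have h3 := (bcov_biUnion J h1).union h2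
    refine (h3.mono_set ?_).mono_bound ?_
    · intro y hy
      by_cases hyV : y ∈ V
      · left
        obtain ⟨j, hj, hyj⟩ := Set.mem_iUnion₂.1 (hV hyV)
        exact Set.mem_biUnion hj ⟨hyj, hy⟩
      · exact Or.inr ⟨hyV, hy⟩
    · rw [← Finset.mul_sum]
      have : 0 ≤ A * K ^ b * Real.exp ((h + η) * N) := by positivity
      nlinarith

/-- Relative version: covering a Bowen ball at a smaller scale, along an orbit which visits the
complement of `V` rarely. -/
theorem bcov_bowenBall_le {V : Set X} {h δ ε C : ℝ} {M : ℕ} (hh : 0 ≤ h)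
    (hV : ∀ u ∈ V, ∃ m, 1 ≤ m ∧ m ≤ M ∧ BCov f (bowenBall f M δ u) m ε (Real.exp (h * m)))
    (hC : BCov f (Set.univ : Set X) 1 ε C) (hC1 : 1 ≤ C) (n : ℕ) (x : X) :
    BCov f (bowenBall f n δ x) n ε (C ^ M * C ^ badCount f V x n * Real.exp (h * n)) := by
  have hC0 : 0 < C := by linarith
  induction n using Nat.strong_induction_on generalizing x with
  | _ n ih =>
  by_cases hn : n < M ∨ n = 0
  · refine ((hC.pow n).mono_set (Set.subset_univ _)).mono_bound ?_
    have h1 : C ^ n ≤ C ^ M := pow_le_pow_right₀ hC1 (by omega)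
    have h2 : 1 ≤ C ^ badCount f V x n := one_le_pow₀ hC1
    have h3 : 1 ≤ Real.exp (h * n) := Real.one_le_exp (by positivity)
    calc C ^ n ≤ C ^ M * 1 * 1 := by linarith
      _ ≤ _ := by gcongr
  · push Not at hn
    have hmap : ∀ m ≤ n, ∀ y ∈ bowenBall f n δ x, f^[m] y ∈ bowenBall f (n - m) δ (f^[m] x) := by
      intro m hm y hy k hk
      rw [← Function.iterate_add_apply, ← Function.iterate_add_apply]
      exact hy _ (by omega)
    by_cases hx : x ∈ V
    · obtain ⟨m, hm1, hm2, hm⟩ := hV x hx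
      have hm' := BCov.mul (hm.mono_set (B := bowenBall f n δ x)
        fun y hy k hk => hy k (hk.trans_le hn.1)) (ih (n - m) (by omega) (f^[m] x))
        (hmap m (by omega))
      rw [show m + (n - m) = n by omega] at hm'
      refine hm'.mono_bound ?_
      have hb : badCount f V (f^[m] x) (n - m) ≤ badCount f V x n := by
        have : n = m + (n - m) := by omega
        conv_rhs => rw [this, badCount_add]
        omega
      have h1 : C ^ badCount f V (f^[m] x) (n - m) ≤ C ^ badCount f V x n :=
        pow_le_pow_right₀ hC1 hb
      have h2 : Real.exp (h * n) = Real.exp (h * m) * Real.exp (h * (n - m : ℕ)) := by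
        rw [← Real.exp_add, Nat.cast_sub (by omega)]
        congr 1
        ring
      rw [h2]
      calc _ = C ^ M * C ^ badCount f V (f^[m] x) (n - m) *
            (Real.exp (h * m) * Real.exp (h * (n - m : ℕ))) := by ring
        _ ≤ _ := by gcongr
    · have hm' := BCov.mul (hC.mono_set (Set.subset_univ (bowenBall f n δ x)))
        (ih (n - 1) (by omega) (f^[1] x)) (hmap 1 (by omega))
      rw [show 1 + (n - 1) = n by omega] at hm'
      refine hm'.mono_bound ?_
      have hb : badCount f V x n = badCount f V (f^[1] x) (n - 1) + 1 := by
        have : n = 1 + (n - 1) := by omega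
        conv_lhs => rw [this, badCount_add, badCount_one_of_notMem f hx]
        omega
      have h2 : Real.exp (h * (n - 1 : ℕ)) ≤ Real.exp (h * n) := by
        apply Real.exp_le_exp.2
        exact mul_le_mul_of_nonneg_left (by exact_mod_cast Nat.sub_le _ _) hh
      rw [hb, pow_succ]
      calc _ = C ^ M * (C ^ badCount f V (f^[1] x) (n - 1) * C) * Real.exp (h * (n - 1 : ℕ)) := by
            ring
        _ ≤ _ := by gcongr

end Parse

section InvariantMeasures

set_option linter.unusedSectionVars false

open MeasureTheory

variable {X : Type*} [MetricSpace X] [CompactSpace X] [MeasurableSpace X] [BorelSpace X]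
  {f : X → X}

/-- The invariant probability measures of `f` which are carried by `Y`. -/
def invMeas {X : Type*} [MeasurableSpace X] (f : X → X) (Y : Set X) :
    Set (ProbabilityMeasure X) :=
  {μ | MeasurePreserving f (μ : Measure X) μ ∧ (μ : Measure X) Yᶜ = 0}

theorem isClosed_invMeas (hf : Continuous f) {Y : Set X} (hY : IsClosed Y) :
    IsClosed (invMeas f Y) := by
  have h1 : IsClosed {μ : ProbabilityMeasure X | μ.map hf.measurable.aemeasurable = μ} :=
    isClosed_eq (ProbabilityMeasure.continuous_map hf) continuous_id
  have h2 : IsClosed {μ : ProbabilityMeasure X | (μ : Measure X) Yᶜ = 0} := by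
    refine IsSeqClosed.isClosed fun u μ hu hlim => ?_
    have h3 := ProbabilityMeasure.le_liminf_measure_open_of_tendsto hlim hY.isOpen_compl
    have h4 : ∀ n, (u n : Measure X) Yᶜ = 0 := hu
    simpa [h4] using h3
  have h3 : invMeas f Y = {μ : ProbabilityMeasure X | μ.map hf.measurable.aemeasurable = μ} ∩
      {μ : ProbabilityMeasure X | (μ : Measure X) Yᶜ = 0} := by
    ext μ
    refine and_congr_left fun _ => ⟨fun h => ?_, fun h => ⟨hf.measurable, ?_⟩⟩
    · exact Subtype.ext h.map_eq
    · exact congrArg (fun ν : ProbabilityMeasure X => (ν : Measure X)) h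
  rw [h3]
  exact h1.inter h2

/-- Normalised restriction of a probability measure to a set of positive measure. -/
noncomputable def condProb (μ : ProbabilityMeasure X) (A : Set X) (hA : (μ : Measure X) A ≠ 0) :
    ProbabilityMeasure X :=
  ⟨ProbabilityTheory.cond μ A, ProbabilityTheory.cond_isProbabilityMeasure hA⟩

theorem condProb_mem_invMeas {Y : Set X} {μ : ProbabilityMeasure X} (hμ : μ ∈ invMeas f Y)
    {A : Set X} (hA : MeasurableSet A) (hfA : f ⁻¹' A = A) (h0 : (μ : Measure X) A ≠ 0) :
    condProb μ A h0 ∈ invMeas f Y := by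
  refine ⟨?_, ?_⟩
  · have h1 := hμ.1.restrict_preimage hA
    rw [hfA] at h1
    exact h1.smul_measure _
  · change ((μ : Measure X) A)⁻¹ • ((μ : Measure X).restrict A) Yᶜ = 0
    rw [Measure.absolutelyContinuous_of_le Measure.restrict_le_self hμ.2, smul_zero]

/-- A closed nonempty family of invariant measures, stable under conditioning on invariant sets. -/
structure IsInvFace (f : X → X) (Y : Set X) (S : Set (ProbabilityMeasure X)) : Prop where
  subset : S ⊆ invMeas f Y
  closed : IsClosed S
  nonempty : S.Nonempty
  cond : ∀ μ ∈ S, ∀ A : Set X, MeasurableSet A → f ⁻¹' A = A →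
    ∀ h0 : (μ : Measure X) A ≠ 0, (μ : Measure X) Aᶜ ≠ 0 → condProb μ A h0 ∈ S

theorem lintegral_condProb (μ : ProbabilityMeasure X) {A : Set X} (h0 : (μ : Measure X) A ≠ 0)
    (F : X → ENNReal) : (μ : Measure X) A * ∫⁻ x, F x ∂(condProb μ A h0 : Measure X) =
      ∫⁻ x in A, F x ∂(μ : Measure X) := by
  have h : (condProb μ A h0 : Measure X) = ((μ : Measure X) A)⁻¹ • ((μ : Measure X).restrict A) :=
    rfl
  rw [h, lintegral_smul_measure, smul_eq_mul, ← mul_assoc,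
    ENNReal.mul_inv_cancel h0 (measure_ne_top _ _), one_mul]

theorem integral_condProb (μ : ProbabilityMeasure X) {A : Set X} (h0 : (μ : Measure X) A ≠ 0)
    (ψ : X → ℝ) : (μ : Measure X).real A * ∫ x, ψ x ∂(condProb μ A h0 : Measure X) =
      ∫ x in A, ψ x ∂(μ : Measure X) := by
  have h : (condProb μ A h0 : Measure X) = ((μ : Measure X) A)⁻¹ • ((μ : Measure X).restrict A) :=
    rfl
  have h1 : (μ : Measure X).real A ≠ 0 := by
    rw [measureReal_def]
    exact (ENNReal.toReal_pos h0 (measure_ne_top _ _)).ne'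
  rw [h, integral_smul_measure, smul_eq_mul, ← mul_assoc, ENNReal.toReal_inv, ← measureReal_def,
    mul_inv_cancel₀ h1, one_mul]

theorem IsInvFace.exists_maximal {Y : Set X} {S : Set (ProbabilityMeasure X)}
    (hS : IsInvFace f Y S) (ψ : C(X, ℝ)) :
    ∃ S' ⊆ S, IsInvFace f Y S' ∧ ∃ c : ℝ, ∀ μ ∈ S', ∫ x, ψ x ∂(μ : Measure X) = c := by
  have hcont := ProbabilityMeasure.continuous_integral_continuousMap ψ
  obtain ⟨μ₀, hμ₀, hmax⟩ := hS.closed.isCompact.exists_isMaxOn hS.nonempty hcont.continuousOn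
  set m := ∫ x, ψ x ∂(μ₀ : Measure X) with hm
  refine ⟨S ∩ {μ | ∫ x, ψ x ∂(μ : Measure X) = m}, Set.inter_subset_left, ⟨?_, ?_, ?_, ?_⟩, m,
    fun μ hμ => hμ.2⟩
  · exact Set.inter_subset_left.trans hS.subset
  · exact hS.closed.inter (isClosed_eq hcont continuous_const)
  · exact ⟨μ₀, hμ₀, rfl⟩
  · rintro μ ⟨hμ, hμm⟩ A hA hfA h0 h0'
    have h1 := hS.cond μ hμ A hA hfA h0 h0'
    have h2 := hS.cond μ hμ Aᶜ hA.compl (by rw [Set.preimage_compl, hfA]) h0'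
      (by rwa [compl_compl])
    refine ⟨h1, ?_⟩
    have h3 : ∫ x, ψ x ∂(condProb μ A h0 : Measure X) ≤ m := hmax h1
    have h4 : ∫ x, ψ x ∂(condProb μ Aᶜ h0' : Measure X) ≤ m := hmax h2
    have h5 := integral_condProb μ h0 ψ
    have h6 := integral_condProb μ h0' ψ
    have hintegral : Integrable ψ (μ : Measure X) :=
      ψ.continuous.integrable_of_hasCompactSupport (HasCompactSupport.of_compactSpace _)
    have h7 := integral_add_compl hA hintegral
    have h8 : (μ : Measure X).real A + (μ : Measure X).real Aᶜ = 1 :=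
      probReal_add_probReal_compl hA
    have h9 : 0 < (μ : Measure X).real A := ENNReal.toReal_pos h0 (measure_ne_top _ _)
    have h10 : 0 < (μ : Measure X).real Aᶜ := ENNReal.toReal_pos h0' (measure_ne_top _ _)
    simp only [Set.mem_ofPred_eq] at hμm ⊢
    refine le_antisymm h3 ?_
    have e1 : (μ : Measure X).real A * ∫ x, ψ x ∂(condProb μ A h0 : Measure X) +
      (μ : Measure X).real Aᶜ * ∫ x, ψ x ∂(condProb μ Aᶜ h0' : Measure X) = m := by
      rw [h5, h6, h7, hμm]
    by_contra hlt
    push Not at hlt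
    have e2 := mul_lt_mul_of_pos_left hlt h9
    have e3 := mul_le_mul_of_nonneg_left h4 h10.le
    have e4 : (μ : Measure X).real A * m + (μ : Measure X).real Aᶜ * m = m := by
      rw [← add_mul, h8, one_mul]
    linarith

theorem integral_eq_of_denseSeq {μ ν : Measure X} [IsProbabilityMeasure μ]
    [IsProbabilityMeasure ν] [Nonempty X]
    (h : ∀ n, ∫ x, TopologicalSpace.denseSeq C(X, ℝ) n x ∂μ =
      ∫ x, TopologicalSpace.denseSeq C(X, ℝ) n x ∂ν) : μ = ν := by
  have hc : ∀ μ : ProbabilityMeasure X,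
      Continuous fun ψ : C(X, ℝ) => ∫ x, ψ x ∂(μ : Measure X) := by
    intro μ
    refine LipschitzWith.continuous (K := 1) (LipschitzWith.of_dist_le_mul fun ψ χ => ?_)
    have hintegral : ∀ ψ : C(X, ℝ), Integrable ψ (μ : Measure X) := fun ψ =>
      ψ.continuous.integrable_of_hasCompactSupport (HasCompactSupport.of_compactSpace _)
    rw [dist_eq_norm, ← integral_sub (hintegral ψ) (hintegral χ)]
    have := norm_integral_le_of_norm_le_const (μ := (μ : Measure X)) (f := fun x => ψ x - χ x)
      (C := dist ψ χ) (Eventually.of_forall fun x => by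
        rw [← dist_eq_norm]; exact ContinuousMap.dist_apply_le_dist x)
    simpa using this
  have h1 := (hc ⟨μ, inferInstance⟩).ext_on (TopologicalSpace.denseRange_denseSeq C(X, ℝ))
    (hc ⟨ν, inferInstance⟩) (by rintro _ ⟨n, rfl⟩; exact h n)
  refine ext_of_forall_integral_eq_of_IsFiniteMeasure fun ψ => ?_
  exact congrFun h1 ψ.toContinuousMap

/-- Every face of invariant measures contains an ergodic measure. -/
theorem IsInvFace.exists_ergodic {Y : Set X} {S : Set (ProbabilityMeasure X)}
    (hS : IsInvFace f Y S) : ∃ μ ∈ S, Ergodic f (μ : Measure X) := by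
  obtain ⟨ν₀, hν₀⟩ := hS.nonempty
  have hX : Nonempty X := by
    by_contra hX
    rw [not_nonempty_iff] at hX
    have h1 : (ν₀ : Measure X) Set.univ = 1 := measure_univ
    rw [Set.univ_eq_empty_iff.2 hX, measure_empty] at h1
    exact zero_ne_one h1
  let T : ℕ → {S // IsInvFace f Y S} := fun n => Nat.rec ⟨S, hS⟩
    (fun n p => ⟨(p.2.exists_maximal (TopologicalSpace.denseSeq C(X, ℝ) n)).choose,
      (p.2.exists_maximal (TopologicalSpace.denseSeq C(X, ℝ) n)).choose_spec.2.1⟩) n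
  have hT : ∀ n, (T (n + 1)).1 ⊆ (T n).1 := fun n =>
    ((T n).2.exists_maximal (TopologicalSpace.denseSeq C(X, ℝ) n)).choose_spec.1
  have hT' : ∀ n, ∃ c : ℝ, ∀ μ ∈ (T (n + 1)).1,
      ∫ x, TopologicalSpace.denseSeq C(X, ℝ) n x ∂(μ : Measure X) = c := fun n =>
    ((T n).2.exists_maximal (TopologicalSpace.denseSeq C(X, ℝ) n)).choose_spec.2.2
  obtain ⟨μ, hμ⟩ := IsCompact.nonempty_iInter_of_sequence_nonempty_isCompact_isClosed
    (fun n => (T n).1) hT (fun n => (T n).2.nonempty) (T 0).2.closed.isCompact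
    (fun n => (T n).2.closed)
  rw [Set.mem_iInter] at hμ
  refine ⟨μ, hμ 0, { (hS.subset (hμ 0)).1 with aeconst_set := ?_ }⟩
  intro A hA hfA
  rw [eventuallyConst_set]
  by_contra hcon
  rw [not_or] at hcon
  have h0 : (μ : Measure X) A ≠ 0 := fun h => hcon.2 (by
    rw [ae_iff]; simpa using h)
  have h0' : (μ : Measure X) Aᶜ ≠ 0 := fun h => hcon.1 (by
    rw [ae_iff]; exact h)
  have h1 := fun n => (T n).2.cond μ (hμ n) A hA hfA h0 h0'
  have h2 := fun n => (T n).2.cond μ (hμ n) Aᶜ hA.compl (by rw [Set.preimage_compl, hfA]) h0'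
    (by rwa [compl_compl])
  have h3 : (condProb μ A h0 : Measure X) = (condProb μ Aᶜ h0' : Measure X) := by
    refine integral_eq_of_denseSeq fun n => ?_
    obtain ⟨c, hc⟩ := hT' n
    rw [hc _ (h1 (n + 1)), hc _ (h2 (n + 1))]
  have h4 : (condProb μ A h0 : Measure X) A = 1 := by
    change ProbabilityTheory.cond (μ : Measure X) A A = 1
    exact ProbabilityTheory.cond_apply_self h0 (measure_ne_top _ _)
  have h5 : (condProb μ Aᶜ h0' : Measure X) A = 0 := by
    change ProbabilityTheory.cond (μ : Measure X) Aᶜ A = 0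
    rw [ProbabilityTheory.cond_apply hA.compl]
    simp
  rw [h3, h5] at h4
  exact zero_ne_one h4

/-- A lower semicontinuous integral functional is not larger at some ergodic measure. -/
theorem exists_ergodic_lintegral_le (hf : Continuous f) {Y : Set X} (hY : IsClosed Y)
    (F : ℕ → C(X, NNReal)) (hF : Monotone F) {ν : ProbabilityMeasure X} (hν : ν ∈ invMeas f Y) :
    ∃ μ ∈ invMeas f Y, Ergodic f (μ : Measure X) ∧
      ∫⁻ x, ⨆ k, (F k x : ENNReal) ∂(μ : Measure X) ≤
        ∫⁻ x, ⨆ k, (F k x : ENNReal) ∂(ν : Measure X) := by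
  set L : ProbabilityMeasure X → ENNReal := fun μ => ∫⁻ x, ⨆ k, (F k x : ENNReal) ∂(μ : Measure X)
    with hL
  have hmeas : Measurable fun x => ⨆ k, (F k x : ENNReal) :=
    Measurable.iSup fun k => ((F k).continuous.measurable).coe_nnreal_ennreal
  have hL' : L = fun μ : ProbabilityMeasure X => ⨆ k, ∫⁻ x, (F k x : ENNReal) ∂(μ : Measure X) := by
    funext μ
    exact lintegral_iSup (fun k => ((F k).continuous.measurable).coe_nnreal_ennreal)
      fun i j hij x => by simpa using hF hij x
  have hlsc : LowerSemicontinuous L := by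
    rw [hL']
    exact lowerSemicontinuous_iSup fun k =>
      (ProbabilityMeasure.continuous_lintegral_continuousMap (F k)).lowerSemicontinuous
  have hclosed := isClosed_invMeas hf hY
  obtain ⟨μ₀, hμ₀, hmin⟩ := (hlsc.lowerSemicontinuousOn (invMeas f Y)).exists_isMinOn ⟨ν, hν⟩
    hclosed.isCompact
  have hface : IsInvFace f Y (invMeas f Y ∩ {μ | L μ ≤ L μ₀}) := by
    refine ⟨Set.inter_subset_left, hclosed.inter (hlsc.isClosed_preimage _),
      ⟨μ₀, hμ₀, le_refl (L μ₀)⟩, ?_⟩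
    rintro μ ⟨hμ, hμm⟩ A hA hfA h0 h0'
    have h1 := condProb_mem_invMeas hμ hA hfA h0
    have h2 := condProb_mem_invMeas hμ hA.compl (by rw [Set.preimage_compl, hfA]) h0'
    refine ⟨h1, ?_⟩
    rw [Set.mem_ofPred_eq] at hμm ⊢
    by_cases htop : L μ₀ = ⊤
    · rw [htop]; exact le_top
    have h3 : L μ₀ ≤ L (condProb μ Aᶜ h0') := hmin h2
    have h4 : (μ : Measure X) A * L (condProb μ A h0) +
        (μ : Measure X) Aᶜ * L (condProb μ Aᶜ h0') = L μ := by
      simp only [hL, lintegral_condProb]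
      exact lintegral_add_compl _ hA
    have h5 : (μ : Measure X) A * L μ₀ + (μ : Measure X) Aᶜ * L μ₀ = L μ₀ := by
      rw [← add_mul, prob_add_prob_compl hA, one_mul]
    have h6 : (μ : Measure X) A * L (condProb μ A h0) + (μ : Measure X) Aᶜ * L μ₀ ≤
        (μ : Measure X) A * L μ₀ + (μ : Measure X) Aᶜ * L μ₀ := by
      rw [h5]
      refine le_trans ?_ hμm
      rw [← h4]
      gcongr
    have h7 := (ENNReal.add_le_add_iff_right
      (ENNReal.mul_ne_top (measure_ne_top _ _) htop)).1 h6
    exact (ENNReal.mul_le_mul_iff_right h0 (measure_ne_top _ _)).1 h7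
  obtain ⟨μ, hμ, herg⟩ := hface.exists_ergodic
  exact ⟨μ, hμ.1, herg, hμ.2.trans (hmin hν)⟩

end InvariantMeasures

section Empirical

set_option linter.unusedSectionVars false

open MeasureTheory

variable {X : Type*} [MetricSpace X] [CompactSpace X] [MeasurableSpace X] [BorelSpace X]
  {f : X → X}

/-- The empirical measure of the first `n + 1` points of the orbit of `y`. -/
noncomputable def empirical (f : X → X) (y : X) (n : ℕ) : ProbabilityMeasure X :=
  ⟨((n + 1 : ℕ) : ENNReal)⁻¹ • ∑ t ∈ Finset.range (n + 1), Measure.dirac (f^[t] y), ⟨by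
    simp only [Measure.smul_apply, Measure.finsetSum_apply, measure_univ, Finset.sum_const,
      Finset.card_range, smul_eq_mul, nsmul_eq_mul, mul_one]
    exact ENNReal.inv_mul_cancel (by simp) (ENNReal.natCast_ne_top _)⟩⟩

theorem coe_empirical (f : X → X) (y : X) (n : ℕ) : (empirical f y n : Measure X) =
    ((n + 1 : ℕ) : ENNReal)⁻¹ • ∑ t ∈ Finset.range (n + 1), Measure.dirac (f^[t] y) := rfl

theorem integral_empirical (f : X → X) (y : X) (n : ℕ) (ψ : C(X, ℝ)) :
    ∫ x, ψ x ∂(empirical f y n : Measure X) = birk f ψ y (n + 1) / (n + 1 : ℕ) := by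
  rw [coe_empirical, integral_smul_measure, integral_finsetSum_measure]
  · simp only [integral_dirac, birk, ENNReal.toReal_inv, ENNReal.toReal_natCast, smul_eq_mul]
    rw [div_eq_inv_mul]
  · exact fun t _ => ψ.continuous.integrable_of_hasCompactSupport
      (HasCompactSupport.of_compactSpace _)

theorem empirical_compl {V : Set X} (hV : MeasurableSet V) (y : X) (n : ℕ) :
    (empirical f y n : Measure X) Vᶜ = (badCount f V y (n + 1) : ENNReal) / (n + 1 : ℕ) := by
  rw [coe_empirical, Measure.smul_apply, Measure.finsetSum_apply, smul_eq_mul, mul_comm,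
    ← div_eq_mul_inv, badCount]
  congr 1
  push_cast
  refine Finset.sum_congr rfl fun t _ => ?_
  rw [Measure.dirac_apply' _ hV.compl]
  by_cases h : f^[t] y ∈ V <;> simp [h]

theorem abs_integral_comp_sub_empirical (hf : Continuous f) (y : X) (n : ℕ) (ψ : C(X, ℝ)) :
    |∫ x, ψ (f x) ∂(empirical f y n : Measure X) - ∫ x, ψ x ∂(empirical f y n : Measure X)| ≤
      2 * ‖ψ‖ / (n + 1 : ℕ) := by
  have h1 := integral_empirical f y n (ψ.comp ⟨f, hf⟩)
  simp only [ContinuousMap.comp_apply, ContinuousMap.coe_mk] at h1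
  have h2 : birk f (fun x => ψ (f x)) y (n + 1) = birk f ψ y (n + 1) + ψ (f^[n + 1] y) - ψ y := by
    have h3 : birk f (fun x => ψ (f x)) y (n + 1) =
        ∑ k ∈ Finset.range (n + 1), ψ (f^[k + 1] y) :=
      Finset.sum_congr rfl fun k _ => by rw [Function.iterate_succ_apply']
    have h4 := Finset.sum_range_succ' (fun k => ψ (f^[k] y)) (n + 1)
    rw [Finset.sum_range_succ] at h4
    simp only [Function.iterate_zero, id] at h4
    rw [h3, birk]
    linarith
  rw [h1, integral_empirical, ← sub_div, abs_div, abs_of_pos (a := ((n + 1 : ℕ) : ℝ))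
    (by positivity)]
  gcongr
  have h5 : birk f (⇑(ψ.comp ⟨f, hf⟩)) y (n + 1) = birk f (fun x => ψ (f x)) y (n + 1) := rfl
  rw [h5, h2]
  have h6 := ψ.norm_coe_le_norm (f^[n + 1] y)
  have h7 := ψ.norm_coe_le_norm y
  rw [Real.norm_eq_abs] at h6 h7
  rw [abs_le] at *
  constructor <;> linarith

theorem iterate_mem {Y : Set X} (hY : Set.MapsTo f Y Y) {y : X} (hy : y ∈ Y) (n : ℕ) :
    f^[n] y ∈ Y := (hY.iterate n) hy

/-- Limits of empirical measures along longer and longer orbit segments are invariant. -/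
theorem exists_tendsto_empirical (hf : Continuous f) {Y : Set X} (hYc : IsClosed Y)
    (hY : Set.MapsTo f Y Y) (y : ℕ → X) (hy : ∀ k, y k ∈ Y) (n : ℕ → ℕ)
    (hn : Tendsto n atTop atTop) :
    ∃ ν ∈ invMeas f Y, ∃ θ : ℕ → ℕ, StrictMono θ ∧
      Tendsto (fun k => empirical f (y (θ k)) (n (θ k))) atTop (𝓝 ν) := by
  obtain ⟨ν, θ, hθ, hlim⟩ := CompactSpace.tendsto_subseq fun k => empirical f (y k) (n k)
  refine ⟨ν, ⟨⟨hf.measurable, ?_⟩, ?_⟩, θ, hθ, hlim⟩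
  · have : IsProbabilityMeasure ((ν : Measure X).map f) :=
      Measure.isProbabilityMeasure_map hf.measurable.aemeasurable
    refine ext_of_forall_integral_eq_of_IsFiniteMeasure fun ψ' => ?_
    rw [integral_map hf.measurable.aemeasurable
      ψ'.continuous.measurable.aestronglyMeasurable]
    let ψ : C(X, ℝ) := ψ'.toContinuousMap
    change ∫ x, ψ (f x) ∂(ν : Measure X) = ∫ x, ψ x ∂(ν : Measure X)
    have h1 := ((ProbabilityMeasure.continuous_integral_continuousMap
      (ψ.comp ⟨f, hf⟩)).tendsto ν).comp hlim
    have h2 := ((ProbabilityMeasure.continuous_integral_continuousMap ψ).tendsto ν).comp hlim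
    have h3 := h1.sub h2
    have h4 : Tendsto (fun k => 2 * ‖ψ‖ / ((n (θ k) + 1 : ℕ) : ℝ)) atTop (𝓝 0) := by
      refine Tendsto.div_atTop tendsto_const_nhds ?_
      refine tendsto_natCast_atTop_atTop.comp ?_
      exact (tendsto_add_atTop_nat 1).comp (hn.comp hθ.tendsto_atTop)
    have h5 := tendsto_nhds_unique h3 (squeeze_zero_norm (fun k => by
      simpa using abs_integral_comp_sub_empirical hf (y (θ k)) (n (θ k)) ψ) h4)
    simpa using sub_eq_zero.1 h5
  · have h1 := ProbabilityMeasure.le_liminf_measure_open_of_tendsto hlim hYc.isOpen_compl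
    have h2 : ∀ k, ((fun k => empirical f (y k) (n k)) ∘ θ) k = empirical f (y (θ k)) (n (θ k)) :=
      fun k => rfl
    have h3 : ∀ k, (empirical f (y (θ k)) (n (θ k)) : Measure X) Yᶜ = 0 := by
      intro k
      rw [empirical_compl hYc.measurableSet]
      have : badCount f Y (y (θ k)) (n (θ k) + 1) = 0 := by
        refine Finset.sum_eq_zero fun t _ => ?_
        simp [iterate_mem hY (hy _) t]
      simp [this]
    simpa [h2, h3] using h1

/-- If every invariant measure on `Y` gives small mass to the complement of the open set `V`, then
long orbit segments in `Y` visit this complement rarely. -/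
theorem eventually_badCount_le (hf : Continuous f) {Y : Set X} (hYc : IsClosed Y)
    (hY : Set.MapsTo f Y Y) {V : Set X} (hV : IsOpen V) {ρ : ℝ}
    (h : ∀ ν ∈ invMeas f Y, (ν : Measure X) Vᶜ < ENNReal.ofReal ρ) :
    ∃ N₀ : ℕ, ∀ n ≥ N₀, ∀ y ∈ Y, (badCount f V y n : ℝ) ≤ ρ * n := by
  by_contra hcon
  push Not at hcon
  choose n hn y hy hbad using fun k => hcon (k + 1)
  have hn1 : ∀ k, n k - 1 + 1 = n k := fun k => by have := hn k; omega
  obtain ⟨ν, hν, θ, hθ, hlim⟩ := exists_tendsto_empirical hf hYc hY y hy (fun k => n k - 1)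
    (tendsto_atTop_mono (fun k => by have := hn k; simp only [id]; omega) tendsto_id)
  have h1 := ProbabilityMeasure.limsup_measure_closed_le_of_tendsto hlim hV.isClosed_compl
  have h2 : ENNReal.ofReal ρ ≤
      limsup (fun k => (empirical f (y (θ k)) (n (θ k) - 1) : Measure X) Vᶜ) atTop := by
    refine le_limsup_of_le (by isBoundedDefault) fun b hb => ?_
    obtain ⟨k, hk⟩ := hb.exists
    refine le_trans ?_ hk
    rw [empirical_compl hV.measurableSet, hn1]
    have h3 : (0 : ℝ) < n (θ k) := by have := hn (θ k); exact_mod_cast (by omega : 0 < n (θ k))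
    rw [← ENNReal.ofReal_natCast, ← ENNReal.ofReal_natCast, ← ENNReal.ofReal_div_of_pos h3]
    refine ENNReal.ofReal_le_ofReal ?_
    rw [le_div_iff₀ h3]
    exact (hbad _).le
  exact absurd (h2.trans h1) (not_le.2 (h ν hν))

theorem measurable_badCount (hf : Continuous f) {V : Set X} (hV : MeasurableSet V) (n : ℕ) :
    Measurable fun y => (badCount f V y n : ENNReal) := by
  unfold badCount
  push_cast
  refine Finset.measurable_sum _ fun t _ => ?_
  have : Measurable fun y : X => Vᶜ.indicator (fun _ => (1 : ℕ)) y :=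
    measurable_const.indicator hV.compl
  exact (measurable_from_top (f := fun k : ℕ => (k : ENNReal))).comp
    (this.comp (hf.iterate t).measurable)

theorem lintegral_badCount {μ : Measure X} (hμ : MeasurePreserving f μ μ) {V : Set X}
    (hV : MeasurableSet V) (n : ℕ) :
    ∫⁻ y, (badCount f V y n : ENNReal) ∂μ = n * μ Vᶜ := by
  unfold badCount
  push_cast
  have hm : Measurable fun y : X => ((Vᶜ.indicator (fun _ => (1 : ℕ)) y : ℕ) : ENNReal) :=
    (measurable_from_top (f := fun k : ℕ => (k : ENNReal))).comp
      (measurable_const.indicator hV.compl)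
  have h1 : ∫⁻ y, ((Vᶜ.indicator (fun _ => (1 : ℕ)) y : ℕ) : ENNReal) ∂μ = μ Vᶜ := by
    rw [← lintegral_indicator_one hV.compl]
    refine lintegral_congr fun y => ?_
    by_cases h : y ∈ V <;> simp [h]
  have h2 : ∀ t ∈ Finset.range n, Measurable fun y =>
      ((Vᶜ.indicator (fun _ => (1 : ℕ)) (f^[t] y) : ℕ) : ENNReal) :=
    fun t _ => hm.comp (hμ.iterate t).measurable
  rw [lintegral_finsetSum _ h2]
  simp_rw [fun t => (hμ.iterate t).lintegral_comp hm, h1]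
  simp

/-- Markov's inequality for the number of visits to the complement of `V`. -/
theorem measure_badCount_gt_le (hf : Continuous f) {μ : Measure X} (hμ : MeasurePreserving f μ μ)
    {V : Set X} (hV : MeasurableSet V) {n : ℕ} (hn : n ≠ 0) {ρ : ℝ} (hρ : 0 < ρ) :
    μ {y | ¬ (badCount f V y n : ℝ) ≤ ρ * n} ≤ μ Vᶜ / ENNReal.ofReal ρ := by
  have hn' : (0 : ℝ) < n := by positivity
  have h1 := mul_meas_ge_le_lintegral (μ := μ) (measurable_badCount hf hV n)
    (ENNReal.ofReal (ρ * n))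
  rw [lintegral_badCount hμ hV, ENNReal.ofReal_mul hρ.le, ENNReal.ofReal_natCast] at h1
  have h2 : {y | ¬ (badCount f V y n : ℝ) ≤ ρ * n} ⊆
      {y | ENNReal.ofReal ρ * n ≤ (badCount f V y n : ENNReal)} := by
    intro y hy
    have hy' : ρ * n < badCount f V y n := not_le.1 hy
    change ENNReal.ofReal ρ * n ≤ (badCount f V y n : ENNReal)
    rw [← ENNReal.ofReal_natCast, ← ENNReal.ofReal_natCast, ← ENNReal.ofReal_mul hρ.le]
    exact ENNReal.ofReal_le_ofReal hy'.le
  refine (measure_mono h2).trans ?_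
  have hn0 : (n : ENNReal) ≠ 0 := by simpa using hn
  rw [ENNReal.le_div_iff_mul_le (Or.inl (by simpa using hρ)) (Or.inl ENNReal.ofReal_ne_top)]
  refine (ENNReal.mul_le_mul_iff_right hn0 (ENNReal.natCast_ne_top n)).1 ?_
  calc _ = ENNReal.ofReal ρ * n * μ {y | ENNReal.ofReal ρ * n ≤ (badCount f V y n : ENNReal)} := by
        ring
    _ ≤ _ := h1

theorem integral_birk {μ : Measure X} [IsProbabilityMeasure μ]
    (hμ : MeasurePreserving f μ μ) {ψ : X → ℝ} (hψ : Continuous ψ) (n : ℕ) :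
    ∫ y, birk f ψ y n ∂μ = n * ∫ y, ψ y ∂μ := by
  have hintegral : Integrable ψ μ :=
    hψ.integrable_of_hasCompactSupport (HasCompactSupport.of_compactSpace _)
  unfold birk
  have h0 : ∀ t ∈ Finset.range n, Integrable (fun y => ψ (f^[t] y)) μ :=
    fun t _ => (hμ.iterate t).integrable_comp_of_integrable hintegral
  rw [integral_finsetSum _ h0]
  have h1 : ∀ t, ∫ y, ψ (f^[t] y) ∂μ = ∫ y, ψ y ∂μ := by
    intro t
    have h2 := integral_map (μ := μ) (hμ.iterate t).measurable.aemeasurable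
      (f := ψ) hψ.measurable.aestronglyMeasurable
    rw [(hμ.iterate t).map_eq] at h2
    exact h2.symm
  simp [h1]

theorem continuous_birk (hf : Continuous f) {ψ : X → ℝ} (hψ : Continuous ψ) (n : ℕ) :
    Continuous fun y => birk f ψ y n :=
  continuous_finsetSum _ fun t _ => hψ.comp (hf.iterate t)

/-- Bounds on Birkhoff sums at one time bound the integral. -/
theorem integral_le_of_birk_le (hf : Continuous f) {Y : Set X} {μ : ProbabilityMeasure X}
    (hμ : μ ∈ invMeas f Y) {ψ : X → ℝ} (hψ : Continuous ψ) {n : ℕ} (hn : n ≠ 0) {a : ℝ}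
    (h : ∀ y ∈ Y, birk f ψ y n ≤ a * n) : ∫ y, ψ y ∂(μ : Measure X) ≤ a := by
  have hnpos : (0 : ℝ) < n := by positivity
  have h1 := integral_birk hμ.1 hψ n
  have h2 : ∫ y, birk f ψ y n ∂(μ : Measure X) ≤ ∫ _, a * n ∂(μ : Measure X) := by
    refine integral_mono_ae ((continuous_birk hf hψ n).integrable_of_hasCompactSupport
      (HasCompactSupport.of_compactSpace _)) (integrable_const _) ?_
    have h3 : ∀ᵐ y ∂(μ : Measure X), y ∈ Y := by
      rw [ae_iff]; exact hμ.2
    exact h3.mono fun y hy => h y hy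
  rw [h1] at h2
  simp only [integral_const, probReal_univ, one_smul] at h2
  exact le_of_mul_le_mul_right (by linarith) hnpos

/-- The indicator of an open set as an increasing supremum of continuous functions. -/
theorem exists_monotone_iSup_eq_indicator {W : Set X} (hW : IsOpen W) :
    ∃ F : ℕ → C(X, NNReal), Monotone F ∧
      ∀ x, ⨆ k, (F k x : ENNReal) = W.indicator (fun _ => 1) x := by
  refine ⟨fun k => ⟨fun x => min 1 (k * (Metric.infEDist x Wᶜ ⊓ 1).toNNReal), ?_⟩, ?_, ?_⟩
  · have h1 : Continuous fun x => (Metric.infEDist x Wᶜ ⊓ 1).toNNReal := by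
      rw [← continuousOn_univ]
      refine ENNReal.continuousOn_toNNReal.comp
        ((Metric.continuous_infEDist.inf continuous_const).continuousOn) fun x _ => ?_
      exact ne_top_of_le_ne_top ENNReal.one_ne_top inf_le_right
    exact continuous_const.min (continuous_const.mul h1)
  · intro i j hij x
    change min _ _ ≤ min _ _
    gcongr
  · intro x
    by_cases hx : x ∈ W
    · rw [Set.indicator_of_mem hx]
      refine le_antisymm (iSup_le fun k => ?_) ?_
      · exact_mod_cast min_le_left _ _
      · have h0 : 0 < (Metric.infEDist x Wᶜ ⊓ 1).toNNReal := by
          refine ENNReal.toNNReal_pos (ne_of_gt ?_) (ne_top_of_le_ne_top ENNReal.one_ne_top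
            inf_le_right)
          refine lt_min ?_ one_pos
          rw [pos_iff_ne_zero, Ne, ← Metric.mem_iff_infEDist_zero_of_closed hW.isClosed_compl]
          simpa using hx
        obtain ⟨k, hk⟩ := exists_nat_ge (1 / (Metric.infEDist x Wᶜ ⊓ 1).toNNReal)
        refine le_iSup_of_le k ?_
        rw [div_le_iff₀ h0] at hk
        have : min 1 ((k : NNReal) * (Metric.infEDist x Wᶜ ⊓ 1).toNNReal) = 1 := min_eq_left hk
        simp [this]
    · rw [Set.indicator_of_notMem hx]
      have : Metric.infEDist x Wᶜ = 0 := Metric.infEDist_zero_of_mem hx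
      simp [this]

end Empirical

section Frequency

variable {X : Type*} [MetricSpace X] {f : X → X}

/-- Frequency version of `bcov_badCount_le`. -/
theorem bcov_badCount_le_freq {ι : Type*} (J : Finset ι) {R : ι → Set X} {ℓ : ι → ℕ} {V : Set X}
    {h η ε C K ρ κ : ℝ} (hℓ : ∀ j ∈ J, 1 ≤ ℓ j)
    (hR : ∀ j ∈ J, BCov f (R j) (ℓ j) ε (Real.exp (h * ℓ j)))
    (hη : ∑ j ∈ J, Real.exp (-(η * ℓ j)) ≤ 1 / 2) (hV : V ⊆ ⋃ j ∈ J, R j)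
    (hC : BCov f (Set.univ : Set X) 1 ε C) (hC1 : 1 ≤ C) (hK : 2 * C ≤ K * Real.exp (h + η))
    (hK1 : 1 ≤ K) (hκ : 0 < κ) (hρ : 0 ≤ ρ) (hρκ : ρ * Real.log K ≤ κ) :
    ∃ L₀ : ℕ, ∀ L ≥ L₀, BCov f {y | (badCount f V y L : ℝ) ≤ ρ * L} L ε
      (Real.exp ((h + η + 2 * κ) * L)) := by
  obtain ⟨A, hA, hcov⟩ := bcov_badCount_le J hℓ hR hη hV hC hC1 hK hK1
  obtain ⟨L₀, hL₀⟩ := exists_nat_ge (Real.log A / κ)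
  refine ⟨L₀, fun L hL => ?_⟩
  have hLR : (L₀ : ℝ) ≤ L := by exact_mod_cast hL
  refine ((hcov L ⌊ρ * L⌋₊).mono_set fun y hy => Nat.le_floor hy).mono_bound ?_
  have hK0 : 0 < K := by linarith
  have h1 : K ^ ⌊ρ * L⌋₊ ≤ Real.exp (κ * L) := by
    rw [← Real.exp_log (pow_pos hK0 _), Real.log_pow]
    apply Real.exp_le_exp.2
    have h2 : (⌊ρ * L⌋₊ : ℝ) ≤ ρ * L := Nat.floor_le (by positivity)
    calc (⌊ρ * L⌋₊ : ℝ) * Real.log K ≤ ρ * L * Real.log K :=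
          mul_le_mul_of_nonneg_right h2 (Real.log_nonneg hK1)
      _ = (ρ * Real.log K) * L := by ring
      _ ≤ κ * L := by gcongr
  have h2 : A ≤ Real.exp (κ * L) := by
    rw [← Real.exp_log hA]
    apply Real.exp_le_exp.2
    rw [div_le_iff₀ hκ] at hL₀
    nlinarith
  calc A * K ^ ⌊ρ * L⌋₊ * Real.exp ((h + η) * L)
      ≤ Real.exp (κ * L) * Real.exp (κ * L) * Real.exp ((h + η) * L) := by gcongr
    _ = Real.exp ((h + η + 2 * κ) * L) := by
      rw [← Real.exp_add, ← Real.exp_add]; congr 1; ring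

theorem isOpen_badCount_le (hf : Continuous f) {V : Set X} (hV : IsOpen V) (L : ℕ) (c : ℝ) :
    IsOpen {y | (badCount f V y L : ℝ) ≤ c} := by
  rw [isOpen_iff_mem_nhds]
  intro y hy
  have h1 : ∀ t ∈ Finset.range L, ∀ᶠ z in 𝓝 y, f^[t] y ∈ V → f^[t] z ∈ V := by
    intro t _
    by_cases hty : f^[t] y ∈ V
    · exact (((hf.iterate t).continuousAt (x := y)).eventually (hV.mem_nhds hty)).mono
        fun z hz _ => hz
    · exact Eventually.of_forall fun z hz => absurd hz hty
  filter_upwards [(Finset.eventually_all _).2 h1] with z hz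
  refine le_trans ?_ hy
  norm_cast
  refine Finset.sum_le_sum fun t ht => ?_
  by_cases hty : f^[t] y ∈ V
  · simp [hz t ht hty]
  · simp only [Set.mem_compl_iff, hty, not_false_eq_true, Set.indicator_of_mem]
    exact Set.indicator_le_self' (fun _ _ => Nat.zero_le _) _

/-- Orbit segments that rarely leave `V` have exponential covering growth rate at most `θ`. -/
def IsLight (f : X → X) (ρ ε θ : ℝ) (V : Set X) : Prop :=
  ∃ L₀ : ℕ, ∀ L ≥ L₀, BCov f {y | (badCount f V y L : ℝ) ≤ ρ * L} L ε (Real.exp (θ * L))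

theorem IsLight.subset {ρ ε θ : ℝ} {V V' : Set X} (h : IsLight f ρ ε θ V) (hV : V' ⊆ V) :
    IsLight f ρ ε θ V' := by
  obtain ⟨L₀, hL⟩ := h
  refine ⟨L₀, fun L hL' => (hL L hL').mono_set fun y hy => ?_⟩
  have h1 : (badCount f V y L : ℝ) ≤ badCount f V' y L := by
    exact_mod_cast badCount_anti f hV y L
  exact h1.trans hy

theorem exists_sum_exp_le {κ : ℝ} (hκ : 0 < κ) :
    ∃ m₁ : ℕ, ∀ J : Finset ℕ, (∀ m ∈ J, m₁ ≤ m) → ∑ m ∈ J, Real.exp (-(κ * m)) ≤ 1 / 2 := by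
  have hs : Summable fun m : ℕ => Real.exp (-(κ * m)) := by
    have := Real.summable_exp_nat_mul_iff.2 (neg_lt_zero.2 hκ)
    refine this.congr fun m => ?_
    congr 1; ring
  have h1 := hs.vanishing (e := Metric.ball 0 (1 / 2)) (Metric.ball_mem_nhds _ (by norm_num))
  obtain ⟨s, hs'⟩ := h1
  refine ⟨s.sup id + 1, fun J hJ => ?_⟩
  have h2 := hs' J (Finset.disjoint_left.2 fun m hm hms => by
    have h3 : id m ≤ s.sup id := Finset.le_sup hms
    have h4 := hJ m hm
    simp only [id] at h3
    omega)
  rw [Metric.mem_ball, Real.dist_0_eq_abs] at h2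
  exact (le_abs_self _).trans h2.le

theorem bcov_preimage {U : Set X} {ε C c : ℝ} {m : ℕ} (hC : BCov f (Set.univ : Set X) 1 ε C)
    (hU : BCov f U m ε c) (w : ℕ) : BCov f (f^[w] ⁻¹' U) m ε (C ^ w * c) :=
  (((hC.pow w).mono_set (Set.subset_univ _)).mul hU fun _ hy => hy).mono subset_rfl
    (Nat.le_add_left _ _) le_rfl le_rfl

theorem isOpen_openBowen (hf : Continuous f) (n : ℕ) (ε : ℝ) (x : X) :
    IsOpen {y | ∀ k < n, dist (f^[k] x) (f^[k] y) < ε} := by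
  have : {y | ∀ k < n, dist (f^[k] x) (f^[k] y) < ε} =
      ⋂ k ∈ Finset.range n, {y | dist (f^[k] x) (f^[k] y) < ε} := by
    ext y; simp
  rw [this]
  exact isOpen_biInter_finset fun k _ =>
    isOpen_lt (continuous_const.dist (hf.iterate k)) continuous_const

end Frequency

section Katok

set_option linter.unusedSectionVars false

open MeasureTheory

variable {X : Type*} [MetricSpace X] [CompactSpace X] [MeasurableSpace X] [BorelSpace X]
  {f : X → X}

theorem katokCount_le_card {μ : Measure X} {n : ℕ} {ε : ℝ} {F : Finset X}
    (h : (1 / 2 : ENNReal) < μ (⋃ x ∈ F, {y | ∀ k < n, dist (f^[k] x) (f^[k] y) < ε})) :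
    katokCount f μ n ε ≤ F.card :=
  csInf_le ⟨0, by rintro _ ⟨F, -, rfl⟩; positivity⟩ ⟨F, h, rfl⟩

theorem katokCount_le_of_bcov {μ : Measure X} {Y : Set X} {n : ℕ} {ε c : ℝ}
    (h : BCov f Y n ε c) (hY : (1 / 2 : ENNReal) < μ Y) : katokCount f μ n ε ≤ c := by
  classical
  obtain ⟨P, h1, h2, h3⟩ := h
  let Q := P.filter fun s => s.Nonempty
  have hQ : ∀ s : {s // s ∈ Q}, s.1.Nonempty := fun s => (Finset.mem_filter.1 s.2).2
  let F : Finset X := Q.attach.image fun s => (hQ s).some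
  refine (katokCount_le_card (F := F) (hY.trans_le (measure_mono fun y hy => ?_))).trans ?_
  · obtain ⟨s, hs, hys⟩ := h1 y hy
    have hsQ : s ∈ Q := Finset.mem_filter.2 ⟨hs, ⟨y, hys⟩⟩
    refine Set.mem_biUnion (x := (hQ ⟨s, hsQ⟩).some)
      (Finset.mem_image_of_mem _ (Finset.mem_attach _ _)) ?_
    exact fun k hk => h2 s hs _ (hQ ⟨s, hsQ⟩).some_mem _ hys k hk
  · refine le_trans ?_ h3
    norm_cast
    refine Finset.card_image_le.trans ?_
    rw [Finset.card_attach]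
    exact Finset.card_filter_le _ _

theorem exists_katokCount_eq {μ : Measure X} [IsProbabilityMeasure μ] (n : ℕ) {ε : ℝ}
    (hε : 0 < ε) : ∃ F : Finset X,
      (1 / 2 : ENNReal) < μ (⋃ x ∈ F, {y | ∀ k < n, dist (f^[k] x) (f^[k] y) < ε}) ∧
      katokCount f μ n ε = F.card := by
  classical
  set S : Set ℕ := {c | ∃ F : Finset X,
    (1 / 2 : ENNReal) < μ (⋃ x ∈ F, {y | ∀ k < n, dist (f^[k] x) (f^[k] y) < ε}) ∧ c = F.card}
  have hne : S.Nonempty := by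
    obtain ⟨C, hC1, hC⟩ := exists_bcov_one (X := X) (f := f) hε
    obtain ⟨P, h1, h2, h3⟩ := hC.pow n
    let Q := P.filter fun s => s.Nonempty
    have hQ : ∀ s : {s // s ∈ Q}, s.1.Nonempty := fun s => (Finset.mem_filter.1 s.2).2
    refine ⟨_, Q.attach.image fun s => (hQ s).some, ?_, rfl⟩
    have h4 : (1 / 2 : ENNReal) < μ Set.univ := by
      rw [measure_univ]; exact ENNReal.half_lt_self one_ne_zero ENNReal.one_ne_top
    refine h4.trans_le (measure_mono fun y hy => ?_)
    obtain ⟨s, hs, hys⟩ := h1 y hy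
    have hsQ : s ∈ Q := Finset.mem_filter.2 ⟨hs, ⟨y, hys⟩⟩
    refine Set.mem_biUnion (x := (hQ ⟨s, hsQ⟩).some)
      (Finset.mem_image_of_mem _ (Finset.mem_attach _ _)) ?_
    exact fun k hk => h2 s hs _ (hQ ⟨s, hsQ⟩).some_mem _ hys k hk
  obtain ⟨F, hF, hFc⟩ := Nat.sInf_mem hne
  refine ⟨F, hF, le_antisymm (katokCount_le_card hF) ?_⟩
  refine le_csInf ⟨_, F, hF, rfl⟩ ?_
  rintro _ ⟨F', hF', rfl⟩
  rw [← hFc]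
  have h5 : F'.card ∈ S := ⟨F', hF', rfl⟩
  exact_mod_cast Nat.sInf_le h5

theorem one_le_katokCount {μ : Measure X} [IsProbabilityMeasure μ] (n : ℕ) {ε : ℝ}
    (hε : 0 < ε) : 1 ≤ katokCount f μ n ε := by
  obtain ⟨F, hF, h⟩ := exists_katokCount_eq (f := f) (μ := μ) n hε
  rw [h]
  have : F.Nonempty := by
    by_contra hne
    rw [Finset.not_nonempty_iff_eq_empty] at hne
    simp [hne] at hF
  exact_mod_cast this.card_pos

/-- The exponential growth rate of the Katok counts at scale `ε`. -/
noncomputable def katokRate (f : X → X) (μ : Measure X) (ε : ℝ) : ℝ :=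
  limsup (fun n : ℕ => Real.log (katokCount f μ n ε) / n) atTop

theorem metEnt_eq (f : X → X) (μ : Measure X) :
    metEnt f μ = ⨆ ε : {e : ℝ // 0 < e}, katokRate f μ ε := rfl

theorem katok_isBoundedUnder (f : X → X) (μ : Measure X) [IsProbabilityMeasure μ] {ε : ℝ}
    (hε : 0 < ε) : IsBoundedUnder (· ≤ ·) atTop
      (fun n : ℕ => Real.log (katokCount f μ n ε) / n) := by
  obtain ⟨C, hC1, hC⟩ := exists_bcov_one (X := X) (f := f) hε
  refine ⟨Real.log C, eventually_map.2 ?_⟩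
  filter_upwards [eventually_gt_atTop 0] with n hn
  have hn' : (0 : ℝ) < n := by exact_mod_cast hn
  rw [div_le_iff₀ hn', mul_comm, ← Real.log_pow]
  refine Real.log_le_log (by linarith [one_le_katokCount (f := f) (μ := μ) n hε]) ?_
  refine katokCount_le_of_bcov (hC.pow n) ?_
  rw [measure_univ]; exact ENNReal.half_lt_self one_ne_zero ENNReal.one_ne_top

theorem katok_isCoboundedUnder (f : X → X) (μ : Measure X) [IsProbabilityMeasure μ] {ε : ℝ}
    (hε : 0 < ε) : IsCoboundedUnder (· ≤ ·) atTop
      (fun n : ℕ => Real.log (katokCount f μ n ε) / n) := by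
  refine IsBoundedUnder.isCoboundedUnder_le ⟨0, eventually_map.2 (Eventually.of_forall fun n => ?_)⟩
  exact div_nonneg (Real.log_nonneg (one_le_katokCount n hε)) (Nat.cast_nonneg _)

theorem katokRate_le_of_eventually {μ : Measure X} [IsProbabilityMeasure μ] {ε a : ℝ}
    (hε : 0 < ε) (h : ∀ᶠ n : ℕ in atTop, katokCount f μ n ε ≤ Real.exp (a * n)) :
    katokRate f μ ε ≤ a := by
  refine limsup_le_of_le (katok_isCoboundedUnder f μ hε) ?_
  filter_upwards [h, eventually_gt_atTop 0] with n hn hn0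
  have hn' : (0 : ℝ) < n := by exact_mod_cast hn0
  rw [div_le_iff₀ hn', ← Real.log_exp (a * n)]
  exact Real.log_le_log (by linarith [one_le_katokCount (f := f) (μ := μ) n hε]) hn

theorem eventually_katokCount_lt {μ : Measure X} [IsProbabilityMeasure μ] {ε a : ℝ}
    (hε : 0 < ε) (h : katokRate f μ ε < a) :
    ∀ᶠ n : ℕ in atTop, katokCount f μ n ε < Real.exp (a * n) := by
  filter_upwards [eventually_lt_of_limsup_lt h (katok_isBoundedUnder f μ hε),
    eventually_gt_atTop 0] with n hn hn0
  have hn' : (0 : ℝ) < n := by exact_mod_cast hn0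
  rw [div_lt_iff₀ hn'] at hn
  exact (Real.log_lt_iff_lt_exp (by linarith [one_le_katokCount (f := f) (μ := μ) n hε])).1 hn

theorem le_metEnt {μ : Measure X} [IsProbabilityMeasure μ] {B ε : ℝ} (hε : 0 < ε)
    (hB : ∀ e : ℝ, 0 < e → katokRate f μ e ≤ B) : katokRate f μ ε ≤ metEnt f μ := by
  rw [metEnt_eq]
  exact le_ciSup (f := fun e : {e : ℝ // 0 < e} => katokRate f μ e)
    ⟨B, by rintro _ ⟨e, rfl⟩; exact hB e e.2⟩ ⟨ε, hε⟩

theorem metEnt_le {μ : Measure X} {B : ℝ}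
    (hB : ∀ e : ℝ, 0 < e → katokRate f μ e ≤ B) : metEnt f μ ≤ B := by
  rw [metEnt_eq]
  have : Nonempty {e : ℝ // 0 < e} := ⟨⟨1, one_pos⟩⟩
  exact ciSup_le fun e => hB e e.2

end Katok

section Variational

set_option linter.unusedSectionVars false

open MeasureTheory

variable {X : Type*} [MetricSpace X] [CompactSpace X] [MeasurableSpace X] [BorelSpace X]
  {f : X → X}

/-- An ergodic measure with small Katok counts is almost carried by an open set to which
orbit segments of small covering growth are confined. -/
theorem exists_isLight_of_ergodic (hf : Continuous f) {μ : Measure X} [IsProbabilityMeasure μ]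
    (hμ : Ergodic f μ) {h κ ε C K ρ : ℝ} (hκ : 0 < κ) (hε : 0 < ε)
    (hC : BCov f (Set.univ : Set X) 1 ε C) (hC1 : 1 ≤ C) (hK : 2 * C ≤ K * Real.exp h)
    (hK1 : 1 ≤ K) (hρ : 0 ≤ ρ) (hρκ : ρ * Real.log K ≤ κ)
    (hkat : ∀ᶠ m : ℕ in atTop, katokCount f μ m (ε / 2) < Real.exp (h * m))
    {c : ENNReal} (hc : c < 1) :
    ∃ V, IsOpen V ∧ c < μ V ∧ IsLight f ρ ε (h + 4 * κ) V := by
  obtain ⟨m₀, hm₀⟩ := eventually_atTop.1 hkat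
  have hex : ∀ m, ∃ U : Set X, IsOpen U ∧ (m₀ ≤ m → (1 / 2 : ENNReal) < μ U) ∧
      BCov f U m ε (Real.exp (h * m)) := by
    intro m
    by_cases hm : m₀ ≤ m
    · obtain ⟨F, hF, hFc⟩ := exists_katokCount_eq (f := f) (μ := μ) m (half_pos hε)
      refine ⟨_, isOpen_biUnion fun x _ => isOpen_openBowen hf m (ε / 2) x, fun _ => hF, ?_⟩
      refine BCov.mono_bound (c := F.card) ?_ (by rw [← hFc]; exact (hm₀ m hm).le)
      classical
      refine ⟨F.image fun x => {y | ∀ k < m, dist (f^[k] x) (f^[k] y) < ε / 2}, ?_, ?_,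
        by exact_mod_cast Finset.card_image_le⟩
      · intro y hy
        obtain ⟨x, hx, hxy⟩ := Set.mem_iUnion₂.1 hy
        exact ⟨_, Finset.mem_image_of_mem _ hx, hxy⟩
      · intro s hs
        obtain ⟨x, -, rfl⟩ := Finset.mem_image.1 hs
        intro y hy z hz k hk
        have h1 := hy k hk
        have h2 := hz k hk
        have := dist_triangle_left (f^[k] y) (f^[k] z) (f^[k] x)
        linarith
    · exact ⟨∅, isOpen_empty, fun h => absurd h hm, bcov_empty _ _ (Real.exp_pos _).le⟩
  choose U hUo hUμ hUcov using hex
  -- the limsup of the sets `U m` has positive measure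
  set O : ℕ → Set X := fun N => ⋃ m ∈ Set.Ici N, U m with hO
  have hOo : ∀ N, IsOpen (O N) := fun N => isOpen_biUnion fun m _ => hUo m
  have hOanti : Antitone O := fun i j hij =>
    Set.biUnion_subset_biUnion_left fun m (hm : j ≤ m) => hij.trans hm
  set Lim : Set X := ⋂ N, O N with hLim
  have hLimm : MeasurableSet Lim := MeasurableSet.iInter fun N => (hOo N).measurableSet
  have hLimμ : (1 / 2 : ENNReal) ≤ μ Lim := by
    refine ge_of_tendsto (tendsto_measure_iInter_atTop
      (fun N => (hOo N).measurableSet.nullMeasurableSet) hOanti ⟨0, measure_ne_top _ _⟩) ?_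
    filter_upwards with N
    refine (hUμ (max N m₀) (le_max_right _ _)).le.trans (measure_mono ?_)
    exact Set.subset_biUnion_of_mem (u := U) (Set.mem_Ici.2 (le_max_left N m₀))
  set S : Set X := ⋃ w : ℕ, f^[w] ⁻¹' Lim with hS
  have hSm : MeasurableSet S := MeasurableSet.iUnion fun w => (hf.iterate w).measurable hLimm
  have hS1 : μ S = 1 := by
    have h1 : f ⁻¹' S ⊆ S := by
      intro y hy
      obtain ⟨w, hw⟩ := Set.mem_iUnion.1 hy
      refine Set.mem_iUnion.2 ⟨w + 1, ?_⟩
      simpa [Function.iterate_succ_apply] using hw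
    rcases hμ.ae_empty_or_univ_of_preimage_ae_le hSm.nullMeasurableSet
      (Eventually.of_forall h1) with h2 | h2
    · have h3 : μ Lim ≤ μ S := measure_mono fun y hy => Set.mem_iUnion.2 ⟨0, hy⟩
      rw [measure_congr h2, measure_empty] at h3
      exact absurd (hLimμ.trans h3) (by simp)
    · rw [measure_congr h2, measure_univ]
  -- a bounded waiting time captures almost all points
  obtain ⟨T, hT⟩ : ∃ T : ℕ, c < μ (⋃ w ∈ Set.Iic T, f^[w] ⁻¹' Lim) := by
    have h1 : S = ⋃ T : ℕ, ⋃ w ∈ Set.Iic T, f^[w] ⁻¹' Lim := by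
      ext y
      simp only [hS, Set.mem_iUnion]
      exact ⟨fun ⟨w, hw⟩ => ⟨w, w, Set.mem_Iic.2 le_rfl, hw⟩, fun ⟨_, w, _, hw⟩ => ⟨w, hw⟩⟩
    rw [h1, Monotone.measure_iUnion] at hS1
    · rw [← hS1] at hc
      exact lt_iSup_iff.1 hc
    · exact fun i j hij => Set.biUnion_subset_biUnion_left (Set.Iic_subset_Iic.2 hij)
  obtain ⟨m₁, hm₁⟩ := exists_sum_exp_le hκ
  obtain ⟨m₂, hm₂⟩ := exists_nat_ge (Real.log ((T + 1) * C ^ T) / κ)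
  set m₃ := max (max m₁ m₂) 1 with hm₃
  set R : ℕ → Set X := fun m => ⋃ w ∈ Finset.range (T + 1), f^[w] ⁻¹' U m with hR
  have hRo : ∀ m, IsOpen (R m) := fun m =>
    isOpen_biUnion fun w _ => (hUo m).preimage (hf.iterate w)
  have hRcov : ∀ m, m₃ ≤ m → BCov f (R m) m ε (Real.exp ((h + κ) * m)) := by
    intro m hm
    have h1 := bcov_biUnion (f := f) (Finset.range (T + 1)) (A := fun w => f^[w] ⁻¹' U m)
      (c := fun _ => C ^ T * Real.exp (h * m)) (n := m) (ε := ε) (fun w hw => by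
        refine (bcov_preimage hC (hUcov m) w).mono_bound ?_
        have : C ^ w ≤ C ^ T := pow_le_pow_right₀ hC1 (by
          have := Finset.mem_range.1 hw; omega)
        gcongr)
    refine h1.mono_bound ?_
    rw [Finset.sum_const, Finset.card_range, nsmul_eq_mul]
    push_cast
    have h0 : 0 < (T + 1) * C ^ T := by positivity
    have h2 : ((T : ℝ) + 1) * C ^ T ≤ Real.exp (κ * m) := by
      rw [← Real.exp_log h0]
      apply Real.exp_le_exp.2
      rw [div_le_iff₀ hκ] at hm₂
      have : (m₂ : ℝ) ≤ m := by
        exact_mod_cast (le_max_right _ _).trans ((le_max_left _ _).trans hm)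
      nlinarith
    calc ((T : ℝ) + 1) * (C ^ T * Real.exp (h * m)) = ((T : ℝ) + 1) * C ^ T * Real.exp (h * m) := by
          ring
      _ ≤ Real.exp (κ * m) * Real.exp (h * m) := by gcongr
      _ = Real.exp ((h + κ) * m) := by rw [← Real.exp_add]; congr 1; ring
  obtain ⟨m₄, hm₄⟩ : ∃ m₄ : ℕ, c < μ (⋃ m ∈ Finset.Icc m₃ m₄, R m) := by
    have h1 : (⋃ w ∈ Set.Iic T, f^[w] ⁻¹' Lim) ⊆ ⋃ m₄ : ℕ, ⋃ m ∈ Finset.Icc m₃ m₄, R m := by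
      intro y hy
      obtain ⟨w, hw, hy⟩ := Set.mem_iUnion₂.1 hy
      obtain ⟨m, hm, hym⟩ := Set.mem_iUnion₂.1 (Set.mem_iInter.1 hy m₃)
      refine Set.mem_iUnion.2 ⟨m, Set.mem_biUnion (x := m) ?_ ?_⟩
      · exact Finset.mem_Icc.2 ⟨hm, le_rfl⟩
      · exact Set.mem_biUnion (x := w) (Finset.mem_coe.2 (Finset.mem_range.2
          (Nat.lt_succ_of_le hw))) hym
    have h2 := hT.trans_le (measure_mono h1)
    rw [Monotone.measure_iUnion] at h2
    · exact lt_iSup_iff.1 h2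
    · exact fun i j hij => Set.biUnion_subset_biUnion_left fun m hm => by
        simp only [Finset.coe_Icc, Set.mem_Icc] at hm ⊢
        exact ⟨hm.1, hm.2.trans hij⟩
  refine ⟨_, isOpen_biUnion fun m _ => hRo m, hm₄, ?_⟩
  have hpos : ∀ m ∈ Finset.Icc m₃ m₄, m₃ ≤ m := fun m hm => (Finset.mem_Icc.1 hm).1
  have hfin := bcov_badCount_le_freq (f := f) (Finset.Icc m₃ m₄) (R := R) (ℓ := fun m => m)
    (h := h + κ) (η := κ) (ρ := ρ) (κ := κ) (K := K)
    (fun m hm => (le_max_right _ _).trans (hpos m hm))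
    (fun m hm => hRcov m (hpos m hm))
    (hm₁ _ fun m hm => (le_max_left m₁ m₂).trans ((le_max_left _ _).trans (hpos m hm)))
    subset_rfl hC hC1 (hK.trans (by gcongr; linarith)) hK1 hκ hρ hρκ
  obtain ⟨L₀, hL₀⟩ := hfin
  refine ⟨L₀, fun L hL => ?_⟩
  have := hL₀ L hL
  rwa [show h + κ + κ + 2 * κ = h + 4 * κ by ring] at this

theorem exists_open_seq_basis (X : Type*) [MetricSpace X] [CompactSpace X] :
    ∃ b : ℕ → Set X, (∀ i, IsOpen (b i)) ∧
      ∀ V : Set X, IsOpen V → V = ⋃ i ∈ {i | b i ⊆ V}, b i := by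
  obtain ⟨b, hb, hbas⟩ := TopologicalSpace.exists_countable_basis X
  obtain ⟨-, hbas⟩ := hbas
  have hne : (insert ∅ b).Nonempty := ⟨∅, Set.mem_insert _ _⟩
  obtain ⟨e, he⟩ := (hb.insert ∅).exists_eq_range hne
  refine ⟨e, fun i => ?_, fun V hV => ?_⟩
  · have : e i ∈ insert ∅ b := he ▸ Set.mem_range_self i
    rcases this with h | h
    · rw [h]; exact isOpen_empty
    · exact hbas.isOpen h
  · refine Set.Subset.antisymm (fun x hx => ?_) (Set.iUnion₂_subset fun i hi => hi)
    obtain ⟨s, hs, hxs, hsV⟩ := hbas.exists_subset_of_mem_open hx hV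
    obtain ⟨i, rfl⟩ : s ∈ Set.range e := he ▸ Set.mem_insert_of_mem _ hs
    exact Set.mem_biUnion (x := i) hsV hxs

/-- An open set recognising the ergodic measures whose Katok counts at scale `ε / 2` grow at rate
less than `h`, and such that invariant sets all of whose measures charge it have small covering
growth. -/
theorem exists_open_detecting_entropy (hf : Continuous f) (h : ℝ) {ε η : ℝ} (hε : 0 < ε)
    (hη : 0 < η) :
    ∃ (W : Set X) (ρ : ℝ), IsOpen W ∧ 0 < ρ ∧
      (∀ μ : Measure X, IsProbabilityMeasure μ → Ergodic f μ →
        (∀ᶠ m : ℕ in atTop, katokCount f μ m (ε / 2) < Real.exp (h * m)) → μ Wᶜ = 0) ∧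
      ∀ Y : Set X, IsClosed Y → Set.MapsTo f Y Y →
        (∀ ν ∈ invMeas f Y, (ν : Measure X) Wᶜ < ENNReal.ofReal ρ) →
        ∃ N₀ : ℕ, ∀ N ≥ N₀, BCov f Y N ε (Real.exp ((h + η) * N)) := by
  obtain ⟨C, hC1, hC⟩ := exists_bcov_one (X := X) (f := f) hε
  set κ := η / 7 with hκη
  have hκ : 0 < κ := by positivity
  set K := max 1 (2 * C * Real.exp (-h)) with hKdef
  have hK1 : 1 ≤ K := le_max_left _ _
  have hK : 2 * C ≤ K * Real.exp h := by
    calc 2 * C = 2 * C * Real.exp (-h) * Real.exp h := by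
          rw [mul_assoc, ← Real.exp_add]; simp
      _ ≤ K * Real.exp h := by gcongr; exact le_max_right _ _
  set ρ := κ / (Real.log K + 1) with hρdef
  have hlogK : 0 ≤ Real.log K := Real.log_nonneg hK1
  have hρ : 0 < ρ := by positivity
  have hρκ : ρ * Real.log K ≤ κ := by
    rw [hρdef, div_mul_eq_mul_div, div_le_iff₀ (by positivity)]
    nlinarith
  obtain ⟨b, hbo, hb⟩ := exists_open_seq_basis X
  let B : ℕ → Set X := fun i => ⋃ k ∈ (Denumerable.eqv (Finset ℕ)).symm i, b k
  have hBo : ∀ i, IsOpen (B i) := fun i => isOpen_biUnion fun k _ => hbo k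
  -- lengths of the tiles
  have hlen : ∀ i, ∃ ℓ : ℕ, 1 ≤ ℓ ∧ Real.exp (-(κ * ℓ)) ≤ 1 / 2 / 2 ^ (i + 1) ∧
      (IsLight f ρ ε (h + 4 * κ) (B i) →
        BCov f {y | (badCount f (B i) y ℓ : ℝ) ≤ ρ * ℓ} ℓ ε (Real.exp ((h + 4 * κ) * ℓ))) := by
    intro i
    have h1 : ∃ L₀ : ℕ, ∀ L ≥ L₀, IsLight f ρ ε (h + 4 * κ) (B i) →
        BCov f {y | (badCount f (B i) y L : ℝ) ≤ ρ * L} L ε (Real.exp ((h + 4 * κ) * L)) := by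
      by_cases hl : IsLight f ρ ε (h + 4 * κ) (B i)
      · obtain ⟨L₀, hL⟩ := hl
        exact ⟨L₀, fun L hL' _ => hL L hL'⟩
      · exact ⟨0, fun L _ hl' => absurd hl' hl⟩
    obtain ⟨L₀, hL₀⟩ := h1
    have h2 : Tendsto (fun ℓ : ℕ => Real.exp (-(κ * ℓ))) atTop (𝓝 0) := by
      refine Real.tendsto_exp_neg_atTop_nhds_zero.comp ?_
      exact tendsto_natCast_atTop_atTop.const_mul_atTop hκ
    have h3 := h2.eventually (ge_mem_nhds (by positivity : (0 : ℝ) < 1 / 2 / 2 ^ (i + 1)))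
    obtain ⟨ℓ, h4, h5, h6⟩ := (h3.and ((eventually_ge_atTop L₀).and (eventually_ge_atTop 1))).exists
    exact ⟨ℓ, h6, h4, hL₀ ℓ h5⟩
  choose ℓ hℓ1 hℓe hℓcov using hlen
  let R : ℕ → Set X := fun i =>
    {y | IsLight f ρ ε (h + 4 * κ) (B i) ∧ (badCount f (B i) y (ℓ i) : ℝ) ≤ ρ * ℓ i}
  have hRo : ∀ i, IsOpen (R i) := by
    intro i
    by_cases hl : IsLight f ρ ε (h + 4 * κ) (B i)
    · have : R i = {y | (badCount f (B i) y (ℓ i) : ℝ) ≤ ρ * ℓ i} := by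
        ext y; simp [R, hl]
      rw [this]
      exact isOpen_badCount_le hf (hBo i) _ _
    · have : R i = ∅ := by
        ext y; simp [R, hl]
      rw [this]
      exact isOpen_empty
  have hRcov : ∀ i, BCov f (R i) (ℓ i) ε (Real.exp ((h + 4 * κ) * ℓ i)) := by
    intro i
    by_cases hl : IsLight f ρ ε (h + 4 * κ) (B i)
    · exact (hℓcov i hl).mono_set fun y hy => hy.2
    · have : R i = ∅ := by
        ext y; simp [R, hl]
      rw [this]
      exact bcov_empty _ _ (Real.exp_pos _).le
  refine ⟨⋃ i, R i, ρ, isOpen_iUnion hRo, hρ, ?_, ?_⟩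
  · intro μ hμp hμ hkat
    have key : ∀ s : ℝ, 0 < s → μ (⋃ i, R i)ᶜ ≤ ENNReal.ofReal (s / ρ) := by
      intro s hs
      obtain ⟨V, hVo, hVμ, hVl⟩ := exists_isLight_of_ergodic hf hμ hκ hε hC hC1 hK hK1 hρ.le hρκ
        hkat (c := 1 - ENNReal.ofReal s)
        (ENNReal.sub_lt_self ENNReal.one_ne_top one_ne_zero (by simpa using hs))
      obtain ⟨I, hIV, hI⟩ : ∃ I : Finset ℕ, (⋃ k ∈ I, b k) ⊆ V ∧
          1 - ENNReal.ofReal s < μ (⋃ k ∈ I, b k) := by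
        classical
        have h1 : V = ⋃ N : ℕ, ⋃ k ∈ (Finset.range N).filter fun k => b k ⊆ V, b k := by
          conv_lhs => rw [hb V hVo]
          ext y
          simp only [Set.mem_iUnion, Set.mem_ofPred_eq, Finset.mem_filter, Finset.mem_range,
            exists_prop]
          exact ⟨fun ⟨i, h1, h2⟩ => ⟨i + 1, i, ⟨by omega, h1⟩, h2⟩,
            fun ⟨_, i, ⟨_, h1⟩, h2⟩ => ⟨i, h1, h2⟩⟩
        have h2 := hVμ
        rw [h1, Monotone.measure_iUnion] at h2
        · obtain ⟨N, hN⟩ := lt_iSup_iff.1 h2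
          refine ⟨_, ?_, hN⟩
          exact Set.iUnion₂_subset fun k hk => (Finset.mem_filter.1 hk).2
        · intro i j hij
          refine Set.biUnion_subset_biUnion_left fun k hk => ?_
          simp only [Finset.coe_filter, Finset.mem_range, Set.mem_ofPred_eq] at hk ⊢
          exact ⟨by omega, hk.2⟩
      set i := Denumerable.eqv (Finset ℕ) I with hi
      have hBi : B i = ⋃ k ∈ I, b k := by
        simp only [B, hi, Equiv.symm_apply_apply]
      have hlight : IsLight f ρ ε (h + 4 * κ) (B i) := hVl.subset (by rw [hBi]; exact hIV)
      have hcompl : μ (B i)ᶜ ≤ ENNReal.ofReal s := by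
        rw [prob_compl_eq_one_sub (hBo i).measurableSet, hBi]
        rw [tsub_le_iff_left]
        exact tsub_le_iff_right.1 hI.le
      have h3 := measure_badCount_gt_le hf hμ.toMeasurePreserving (hBo i).measurableSet
        (n := ℓ i) (by have := hℓ1 i; omega) hρ
      refine (measure_mono ?_).trans (h3.trans ?_)
      · intro y hy hyi
        exact hy (Set.mem_iUnion.2 ⟨i, hlight, hyi⟩)
      · rw [ENNReal.ofReal_div_of_pos hρ]
        gcongr
    by_contra hne
    have hpos : 0 < μ (⋃ i, R i)ᶜ := pos_iff_ne_zero.2 hne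
    have htop := measure_ne_top μ (⋃ i, R i)ᶜ
    set a := (μ (⋃ i, R i)ᶜ).toReal with ha
    have ha0 : 0 < a := ENNReal.toReal_pos hne htop
    have h4 := key (a / 2 * ρ) (by positivity)
    rw [mul_div_cancel_right₀ _ hρ.ne', ← ENNReal.ofReal_toReal htop,
      ENNReal.ofReal_le_ofReal_iff (by positivity)] at h4
    linarith
  · intro Y hYc hYm hν
    -- finitely many tiles suffice
    obtain ⟨n, hn⟩ : ∃ n : ℕ, ∀ ν ∈ invMeas f Y,
        (ν : Measure X) (⋃ i ∈ Finset.range n, R i)ᶜ < ENNReal.ofReal ρ := by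
      by_contra hcon
      push Not at hcon
      let Q : ℕ → Set (ProbabilityMeasure X) := fun n => invMeas f Y ∩
        {ν | ENNReal.ofReal ρ ≤ (ν : Measure X) (⋃ i ∈ Finset.range n, R i)ᶜ}
      have hQc : ∀ n, IsClosed (Q n) := by
        intro n
        refine (isClosed_invMeas hf hYc).inter (IsSeqClosed.isClosed fun u ν hu hlim => ?_)
        have h1 := ProbabilityMeasure.limsup_measure_closed_le_of_tendsto hlim
          (isOpen_biUnion fun i (_ : i ∈ Finset.range n) => hRo i).isClosed_compl
        refine le_trans ?_ h1
        exact le_limsup_of_le (by isBoundedDefault) fun a ha =>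
          let ⟨k, hk⟩ := ha.exists
          (hu k).trans hk
      obtain ⟨ν, hνQ⟩ := IsCompact.nonempty_iInter_of_sequence_nonempty_isCompact_isClosed Q
        (fun n ν hν => ⟨hν.1, le_trans hν.2 (measure_mono (Set.compl_subset_compl.2
          (Set.biUnion_subset_biUnion_left fun i hi => by
            simp only [Finset.coe_range, Set.mem_Iio] at hi ⊢; omega)))⟩)
        (fun n => (hcon n).imp fun ν hν => hν) (hQc 0).isCompact hQc
      rw [Set.mem_iInter] at hνQ
      refine absurd (hν ν (hνQ 0).1) (not_lt.2 ?_)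
      have h2 : (⋃ i, R i)ᶜ = ⋂ n : ℕ, (⋃ i ∈ Finset.range n, R i)ᶜ := by
        rw [← Set.compl_iUnion]
        congr 1
        ext y
        simp only [Set.mem_iUnion, Finset.mem_range, exists_prop]
        exact ⟨fun ⟨i, hi⟩ => ⟨i + 1, i, by omega, hi⟩, fun ⟨_, i, _, hi⟩ => ⟨i, hi⟩⟩
      rw [h2]
      refine ge_of_tendsto (tendsto_measure_iInter_atTop (fun n =>
        (isOpen_biUnion fun i (_ : i ∈ Finset.range n) =>
          hRo i).measurableSet.compl.nullMeasurableSet) ?_ ⟨0, measure_ne_top _ _⟩)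
        (Eventually.of_forall fun n => (hνQ n).2)
      exact fun i j hij => Set.compl_subset_compl.2
          (Set.biUnion_subset_biUnion_left fun k hk => by
            simp only [Finset.coe_range, Set.mem_Iio] at hk ⊢; omega)
    obtain ⟨N₁, hN₁⟩ := eventually_badCount_le hf hYc hYm
      (isOpen_biUnion fun i (_ : i ∈ Finset.range n) => hRo i) hn
    have hsum : ∑ i ∈ Finset.range n, Real.exp (-(κ * ℓ i)) ≤ 1 / 2 := by
      have hg : ∀ n : ℕ, ∑ i ∈ Finset.range n, (1 / 2 / 2 ^ (i + 1) : ℝ) ≤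
          1 / 2 - 1 / 2 / 2 ^ n := by
        intro n
        induction n with
        | zero => simp
        | succ n ih =>
          rw [Finset.sum_range_succ]
          have : (1 / 2 / 2 ^ n : ℝ) = 1 / 2 / 2 ^ (n + 1) + 1 / 2 / 2 ^ (n + 1) := by
            rw [pow_succ]; field_simp; norm_num
          linarith
      have h1 : (0 : ℝ) ≤ 1 / 2 / 2 ^ n := by positivity
      exact (Finset.sum_le_sum fun i _ => hℓe i).trans ((hg n).trans (by linarith))
    obtain ⟨N₂, hN₂⟩ := bcov_badCount_le_freq (f := f) (Finset.range n) (R := R) (ℓ := ℓ)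
      (h := h + 4 * κ) (η := κ) (ρ := ρ) (κ := κ) (K := K) (fun i _ => hℓ1 i)
      (fun i _ => hRcov i) hsum subset_rfl hC hC1 (hK.trans (by gcongr; linarith)) hK1 hκ hρ.le hρκ
    refine ⟨max N₁ N₂, fun N hN => ?_⟩
    have h1 := (hN₂ N ((le_max_right _ _).trans hN)).mono_set (B := Y)
      fun y hy => hN₁ N ((le_max_left _ _).trans hN) y hy
    rwa [show h + 4 * κ + κ + 2 * κ = h + η by rw [hκη]; ring] at h1

/-- A closed invariant set with large covering growth carries an ergodic measure with large
Katok growth rate. -/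
theorem exists_ergodic_of_not_bcov (hf : Continuous f) {h ε η : ℝ} (hε : 0 < ε) (hη : 0 < η)
    {Y : Set X} (hYc : IsClosed Y) (hYm : Set.MapsTo f Y Y)
    (hN : ∀ N₀ : ℕ, ∃ N ≥ N₀, ¬ BCov f Y N ε (Real.exp ((h + η) * N))) :
    ∃ μ ∈ invMeas f Y, Ergodic f (μ : Measure X) ∧ h ≤ katokRate f (μ : Measure X) (ε / 2) := by
  obtain ⟨W, ρ, hWo, hρ, hW1, hW2⟩ := exists_open_detecting_entropy hf h hε hη
  obtain ⟨ν, hν, hνW⟩ : ∃ ν ∈ invMeas f Y, ENNReal.ofReal ρ ≤ (ν : Measure X) Wᶜ := by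
    by_contra hcon
    push Not at hcon
    obtain ⟨N₀, hN₀⟩ := hW2 Y hYc hYm hcon
    obtain ⟨N, hN1, hN2⟩ := hN N₀
    exact hN2 (hN₀ N hN1)
  obtain ⟨F, hF, hFW⟩ := exists_monotone_iSup_eq_indicator hWo
  obtain ⟨μ, hμ, hμe, hμle⟩ := exists_ergodic_lintegral_le hf hYc F hF hν
  refine ⟨μ, hμ, hμe, ?_⟩
  by_contra hlt
  rw [not_le] at hlt
  have h1 := hW1 μ inferInstance hμe (eventually_katokCount_lt (half_pos hε) hlt)
  have h2 : ∀ ν : ProbabilityMeasure X, ∫⁻ x, ⨆ k, (F k x : ENNReal) ∂(ν : Measure X) =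
      (ν : Measure X) W := by
    intro ν
    simp_rw [hFW]
    exact lintegral_indicator_one hWo.measurableSet
  rw [h2, h2, (prob_compl_eq_zero_iff hWo.measurableSet).1 h1] at hμle
  have h3 : (ν : Measure X) Wᶜ = 0 :=
    (prob_compl_eq_zero_iff hWo.measurableSet).2 (le_antisymm prob_le_one hμle)
  rw [h3] at hνW
  simp only [nonpos_iff_eq_zero, ENNReal.ofReal_eq_zero] at hνW
  linarith

end Variational

section Extract

set_option linter.unusedSectionVars false

variable {X : Type*} [MetricSpace X] {f : X → X}

theorem birk_add (f : X → X) (φ : X → ℝ) (x : X) (n m : ℕ) :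
    birk f φ x (n + m) = birk f φ x n + birk f φ (f^[n] x) m := by
  simp only [birk, Finset.sum_range_add, ← Function.iterate_add_apply, add_comm]

theorem birk_sub_le_of_mem_bowenBall {φ : X → ℝ} {δ η : ℝ}
    (hφ : ∀ x y, dist x y ≤ δ → |φ x - φ y| ≤ η) {n : ℕ} {x y : X} (hy : y ∈ bowenBall f n δ x) :
    |birk f φ x n - birk f φ y n| ≤ η * n := by
  rw [birk, birk, ← Finset.sum_sub_distrib]
  refine (Finset.abs_sum_le_sum_abs _ _).trans ?_
  refine (Finset.sum_le_card_nsmul _ _ η fun k hk =>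
    hφ _ _ (hy k (Finset.mem_range.1 hk))).trans ?_
  simp [mul_comm]

theorem abs_birk_le {φ : X → ℝ} {b : ℝ} (hb : ∀ x, |φ x| ≤ b) (x : X) (n : ℕ) :
    |birk f φ x n| ≤ b * n := by
  refine (Finset.abs_sum_le_sum_abs _ _).trans ?_
  refine (Finset.sum_le_card_nsmul _ _ b fun k _ => hb _).trans ?_
  simp [mul_comm]

open Classical in
/-- Words sharing their prefix and suffix up to `δ / 2` are separated along their cores. -/
theorem sum_exp_birk_le_of_decomposition {φ : X → ℝ} {δ η A q B θ : ℝ} {D Pc Gc Sc : Set (X × ℕ)}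
    {p g s : X × ℕ → ℕ}
    (hdecomp : ∀ c ∈ D, p c + g c + s c = c.2 ∧ (c.1, p c) ∈ Pc ∧
      (f^[p c] c.1, g c) ∈ Gc ∧ (f^[p c + g c] c.1, s c) ∈ Sc)
    {Y : Set X} (hY : Set.MapsTo f Y Y) (hδ : 0 ≤ δ)
    (hφ : ∀ x y, dist x y ≤ δ / 2 → |φ x - φ y| ≤ η)
    (hP : ∀ n, ∃ E : Finset X, (∀ y, (y, n) ∈ Pc → ∃ x ∈ E, y ∈ bowenBall f n (δ / 2) x) ∧
      ∑ x ∈ E, Real.exp (birk f φ x n) ≤ A * Real.exp (q * n))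
    (hS : ∀ n, ∃ E : Finset X, (∀ y, (y, n) ∈ Sc → ∃ x ∈ E, y ∈ bowenBall f n (δ / 2) x) ∧
      ∑ x ∈ E, Real.exp (birk f φ x n) ≤ A * Real.exp (q * n))
    (hA : 0 ≤ A) (hB : 0 ≤ B)
    (hG : ∀ n, ∀ E : Finset X, (∀ x ∈ E, x ∈ Y ∧ (x, n) ∈ Gc) → IsSep f n δ E →
      ∑ x ∈ E, Real.exp (birk f φ x n) ≤ B * Real.exp (θ * n))
    {N : ℕ} {T : Finset X} (hT : ∀ x ∈ T, x ∈ Y ∧ (x, N) ∈ D) (hsep : IsSep f N δ T) :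
    ∑ x ∈ T, Real.exp (birk f φ x N) ≤
      (N + 1) ^ 2 * (A * A * B * Real.exp (max (q + η) θ * N)) := by
  choose EP hEP hEPs using hP
  choose ES hES hESs using hS
  have hD : ∀ x ∈ T, ∃ u v, u ∈ EP (p (x, N)) ∧ x ∈ bowenBall f (p (x, N)) (δ / 2) u ∧
      v ∈ ES (s (x, N)) ∧
      f^[p (x, N) + g (x, N)] x ∈ bowenBall f (s (x, N)) (δ / 2) v := by
    intro x hx
    obtain ⟨-, h2, -, h4⟩ := hdecomp _ (hT x hx).2
    obtain ⟨u, hu, hu'⟩ := hEP _ _ h2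
    obtain ⟨v, hv, hv'⟩ := hES _ _ h4
    exact ⟨u, v, hu, hu', hv, hv'⟩
  choose! u v hu hu' hv hv' using hD
  have hmaps : ∀ x ∈ T, (p (x, N), s (x, N)) ∈ Finset.range (N + 1) ×ˢ Finset.range (N + 1) := by
    intro x hx
    obtain ⟨h1, -⟩ := hdecomp _ (hT x hx).2
    simp only [Finset.mem_product, Finset.mem_range] at h1 ⊢
    omega
  rw [← Finset.sum_fiberwise_of_maps_to hmaps]
  have hcell : ∀ c ∈ Finset.range (N + 1) ×ˢ Finset.range (N + 1),
      ∑ x ∈ T with (p (x, N), s (x, N)) = c, Real.exp (birk f φ x N) ≤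
        A * A * B * Real.exp (max (q + η) θ * N) := by
    rintro ⟨a, c⟩ -
    set T' := T.filter fun x => (p (x, N), s (x, N)) = (a, c) with hT'
    have hmem : ∀ x ∈ T', x ∈ T ∧ p (x, N) = a ∧ s (x, N) = c := by
      intro x hx
      simpa [hT'] using hx
    by_cases hac : ∃ b, a + b + c = N
    swap
    · have : T' = ∅ := by
        refine Finset.eq_empty_of_forall_notMem fun x hx => hac ⟨g (x, N), ?_⟩
        obtain ⟨h1, h2, h3⟩ := hmem x hx
        obtain ⟨h4, -⟩ := hdecomp _ (hT x h1).2
        simp only at h4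
        omega
      rw [this, Finset.sum_empty]
      positivity
    obtain ⟨b, hb⟩ := hac
    have hgb : ∀ x ∈ T', g (x, N) = b := by
      intro x hx
      obtain ⟨h1, h2, h3⟩ := hmem x hx
      obtain ⟨h4, -⟩ := hdecomp _ (hT x h1).2
      simp only at h4
      omega
    have hmaps' : ∀ x ∈ T', (u x, v x) ∈ EP a ×ˢ ES c := by
      intro x hx
      obtain ⟨h1, h2, h3⟩ := hmem x hx
      refine Finset.mem_product.2 ⟨?_, ?_⟩
      · simpa [h2] using hu x h1
      · simpa [h3] using hv x h1
    have hsplit : ∀ x ∈ T', Real.exp (birk f φ x N) ≤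
        Real.exp (birk f φ (u x) a) * Real.exp (birk f φ (v x) c) * Real.exp (η * (a + c)) *
          Real.exp (birk f φ (f^[a] x) b) := by
      intro x hx
      obtain ⟨h1, h2, h3⟩ := hmem x hx
      have h4 := hu' x h1
      have h5 := hv' x h1
      rw [h2] at h4
      rw [h2, h3, hgb x hx] at h5
      have h6 := abs_le.1 (birk_sub_le_of_mem_bowenBall hφ h4)
      have h7 := abs_le.1 (birk_sub_le_of_mem_bowenBall hφ h5)
      rw [← Real.exp_add, ← Real.exp_add, ← Real.exp_add, Real.exp_le_exp]
      have h8 : birk f φ x N = birk f φ x a + birk f φ (f^[a] x) b + birk f φ (f^[a + b] x) c := by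
        rw [← hb, birk_add, birk_add]
      rw [h8]
      nlinarith [h6.1, h7.1]
    rw [← Finset.sum_fiberwise_of_maps_to hmaps']
    have hin : ∀ d ∈ EP a ×ˢ ES c, ∑ x ∈ T' with (u x, v x) = d, Real.exp (birk f φ x N) ≤
        Real.exp (birk f φ d.1 a) * Real.exp (birk f φ d.2 c) *
          (Real.exp (η * (a + c)) * (B * Real.exp (θ * b))) := by
      rintro ⟨d₁, d₂⟩ -
      set T'' := T'.filter fun x => (u x, v x) = (d₁, d₂) with hT''
      have hmem' : ∀ x ∈ T'', x ∈ T' ∧ u x = d₁ ∧ v x = d₂ := by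
        intro x hx
        simpa [hT''] using hx
      have hclose : ∀ x ∈ T'', ∀ y ∈ T'', x ≠ y →
          ∃ k < b, δ < dist (f^[k] (f^[a] x)) (f^[k] (f^[a] y)) := by
        intro x hx y hy hne
        obtain ⟨hx1, hx2, hx3⟩ := hmem' x hx
        obtain ⟨hy1, hy2, hy3⟩ := hmem' y hy
        obtain ⟨hx4, hx5, hx6⟩ := hmem x hx1
        obtain ⟨hy4, hy5, hy6⟩ := hmem y hy1
        obtain ⟨k, hk, hkd⟩ := hsep x hx4 y hy4 hne
        have hux := hu' x hx4
        have huy := hu' y hy4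
        have hvx := hv' x hx4
        have hvy := hv' y hy4
        rw [hx2, hx5] at hux
        rw [hy2, hy5] at huy
        rw [hx3, hx5, hx6, hgb x hx1] at hvx
        rw [hy3, hy5, hy6, hgb y hy1] at hvy
        rcases lt_or_ge k a with h1 | h1
        · have h2 := hux k h1
          have h3 := huy k h1
          have h4 := dist_triangle_left (f^[k] x) (f^[k] y) (f^[k] d₁)
          linarith
        rcases lt_or_ge k (a + b) with h2 | h2
        · refine ⟨k - a, by omega, ?_⟩
          rwa [← Function.iterate_add_apply, ← Function.iterate_add_apply, Nat.sub_add_cancel h1]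
        · have h3 := hvx (k - (a + b)) (by omega)
          have h4 := hvy (k - (a + b)) (by omega)
          rw [← Function.iterate_add_apply, Nat.sub_add_cancel h2] at h3 h4
          have h5 := dist_triangle_left (f^[k] x) (f^[k] y) (f^[k - (a + b)] d₂)
          linarith
      have hinj : Set.InjOn (fun x => f^[a] x) (T'' : Set X) := by
        intro x hx y hy hxy
        by_contra hne
        obtain ⟨k, -, hk⟩ := hclose x hx y hy hne
        simp only at hxy
        rw [hxy, dist_self] at hk
        exact hk.not_ge hδ
      have himg := hG b (T''.image fun x => f^[a] x) (by
        intro y hy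
        obtain ⟨x, hx, rfl⟩ := Finset.mem_image.1 hy
        obtain ⟨hx1, -⟩ := hmem' x hx
        obtain ⟨hx4, hx5, -⟩ := hmem x hx1
        obtain ⟨-, -, h3, -⟩ := hdecomp _ (hT x hx4).2
        rw [hx5, hgb x hx1] at h3
        exact ⟨(hY.iterate a) (hT x hx4).1, h3⟩) (by
        intro y hy z hz hne
        obtain ⟨x, hx, rfl⟩ := Finset.mem_image.1 hy
        obtain ⟨x', hx', rfl⟩ := Finset.mem_image.1 hz
        exact hclose x hx x' hx' fun h => hne (by rw [h]))
      rw [Finset.sum_image hinj] at himg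
      calc ∑ x ∈ T'', Real.exp (birk f φ x N)
          ≤ ∑ x ∈ T'', Real.exp (birk f φ d₁ a) * Real.exp (birk f φ d₂ c) *
              Real.exp (η * (a + c)) * Real.exp (birk f φ (f^[a] x) b) := by
            refine Finset.sum_le_sum fun x hx => ?_
            obtain ⟨hx1, hx2, hx3⟩ := hmem' x hx
            simpa only [hx2, hx3] using hsplit x hx1
        _ ≤ _ := by
            rw [← Finset.mul_sum, ← mul_assoc]
            gcongr
    refine (Finset.sum_le_sum hin).trans ?_
    rw [← Finset.sum_mul, Finset.sum_product]
    simp only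
    rw [← Finset.sum_mul_sum]
    calc (∑ i ∈ EP a, Real.exp (birk f φ i a)) * (∑ j ∈ ES c, Real.exp (birk f φ j c)) *
          (Real.exp (η * (a + c)) * (B * Real.exp (θ * b)))
        ≤ (A * Real.exp (q * a)) * (A * Real.exp (q * c)) *
          (Real.exp (η * (a + c)) * (B * Real.exp (θ * b))) := by
          gcongr
          · exact hEPs a
          · exact hESs c
      _ = A * A * B * Real.exp ((q + η) * (a + c) + θ * b) := by
          rw [show (q + η) * ((a : ℝ) + c) + θ * b = q * a + q * c + η * (a + c) + θ * b by ring,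
            Real.exp_add, Real.exp_add, Real.exp_add]
          ring
      _ ≤ A * A * B * Real.exp (max (q + η) θ * N) := by
          gcongr
          have h1 := le_max_left (q + η) θ
          have h2 := le_max_right (q + η) θ
          have h3 : (N : ℝ) = a + b + c := by rw [← hb]; push_cast; ring
          rw [h3]
          nlinarith [mul_le_mul_of_nonneg_right h1 (by positivity : (0 : ℝ) ≤ (a : ℝ) + c),
            mul_le_mul_of_nonneg_right h2 (by positivity : (0 : ℝ) ≤ (b : ℝ))]
  refine (Finset.sum_le_card_nsmul _ _ _ hcell).trans (le_of_eq ?_)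
  simp only [Finset.card_product, Finset.card_range, nsmul_eq_mul]
  push_cast
  ring

/-- A collection of orbit segments decomposed with small prefixes and suffixes inherits its
exponential growth from the cores. -/
theorem exists_sep_core [CompactSpace X] {φ : X → ℝ} {b δ η A q θ θ' : ℝ}
    {D Pc Gc Sc : Set (X × ℕ)} {p g s : X × ℕ → ℕ}
    (hdecomp : ∀ c ∈ D, p c + g c + s c = c.2 ∧ (c.1, p c) ∈ Pc ∧
      (f^[p c] c.1, g c) ∈ Gc ∧ (f^[p c + g c] c.1, s c) ∈ Sc)
    {Y : Set X} (hY : Set.MapsTo f Y Y) (hδ : 0 < δ) (hη : 0 ≤ η) (hb : ∀ x, |φ x| ≤ b)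
    (hφ : ∀ x y, dist x y ≤ δ / 2 → |φ x - φ y| ≤ η)
    (hA : ∀ n, ∀ E : Finset X, (∀ x ∈ E, (x, n) ∈ Dᶜ ∪ Pc ∪ Sc) → IsSep f n (δ / 2) E →
      ∑ x ∈ E, Real.exp (birk f φ x n) ≤ A * Real.exp (q * n))
    (hbig : ∀ N₀ : ℕ, ∃ N ≥ N₀, ∃ S : Finset X, (∀ x ∈ S, x ∈ Y) ∧ IsSep f N δ S ∧
      Real.exp (θ * N) ≤ ∑ x ∈ S, Real.exp (birk f φ x N))
    (hqθ : q + η < θ) (hθ : θ' < θ) (g₀ : ℕ) :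
    ∃ n ≥ g₀, ∃ E : Finset X, (∀ x ∈ E, x ∈ Y ∧ (x, n) ∈ Gc) ∧ IsSep f n δ E ∧
      Real.exp (θ' * n) ≤ ∑ x ∈ E, Real.exp (birk f φ x n) := by
  classical
  by_contra! hcon
  have hA0 : 0 ≤ A := by
    have := hA 0 ∅ (by simp) (by intro x hx; simp at hx)
    simpa using this
  obtain ⟨C, hC1, hC⟩ := exists_bcov_one (f := f) hδ
  obtain ⟨C', hC1', hC'⟩ := exists_bcov_one (f := f) (half_pos hδ)
  set B : ℝ := 1 + ∑ k ∈ Finset.range g₀, C ^ k * Real.exp (b * k) * Real.exp (-(θ' * k)) with hB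
  have hB1 : 1 ≤ B := by
    rw [hB]
    have : 0 ≤ ∑ k ∈ Finset.range g₀, C ^ k * Real.exp (b * k) * Real.exp (-(θ' * k)) :=
      Finset.sum_nonneg fun _ _ => by positivity
    linarith
  have hG : ∀ n, ∀ E : Finset X, (∀ x ∈ E, x ∈ Y ∧ (x, n) ∈ Gc) → IsSep f n δ E →
      ∑ x ∈ E, Real.exp (birk f φ x n) ≤ B * Real.exp (θ' * n) := by
    intro n E hE hs
    rcases le_or_gt g₀ n with h | h
    · refine (hcon n h E hE hs).le.trans (le_mul_of_one_le_left (Real.exp_pos _).le hB1)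
    · have h1 : (E.card : ℝ) ≤ C ^ n := (hC.pow n).card_le (fun _ _ => Set.mem_univ _) hs
      have h2 : ∑ x ∈ E, Real.exp (birk f φ x n) ≤ C ^ n * Real.exp (b * n) := by
        refine (Finset.sum_le_card_nsmul _ _ (Real.exp (b * n)) fun x _ =>
          Real.exp_le_exp.2 (le_of_abs_le (abs_birk_le hb x n))).trans ?_
        rw [nsmul_eq_mul]
        gcongr
      have h3 : C ^ n * Real.exp (b * n) * Real.exp (-(θ' * n)) ≤ B := by
        rw [hB]
        have := Finset.single_le_sum (f := fun k : ℕ =>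
          C ^ k * Real.exp (b * k) * Real.exp (-(θ' * k))) (fun _ _ => by positivity)
          (Finset.mem_range.2 h)
        linarith
      calc _ ≤ _ := h2
        _ = C ^ n * Real.exp (b * n) * Real.exp (-(θ' * n)) * Real.exp (θ' * n) := by
            rw [mul_assoc (C ^ n * _), ← Real.exp_add]
            simp
        _ ≤ _ := by gcongr
  have hcover : ∀ Q : Set (X × ℕ), Q ⊆ Dᶜ ∪ Pc ∪ Sc → ∀ n, ∃ E : Finset X,
      (∀ y, (y, n) ∈ Q → ∃ x ∈ E, y ∈ bowenBall f n (δ / 2) x) ∧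
      ∑ x ∈ E, Real.exp (birk f φ x n) ≤ A * Real.exp (q * n) := by
    intro Q hQ n
    obtain ⟨E, h1, h2, h3⟩ := exists_maximal_sep (f := f) (A := {y | (y, n) ∈ Q}) (n := n)
      (δ := δ / 2) (c := C' ^ n) (by positivity)
      (fun E _ hs => (hC'.pow n).card_le (fun _ _ => Set.mem_univ _) hs)
    exact ⟨E, h3, hA n E (fun x hx => hQ (h1 x hx)) h2⟩
  set m := max (q + η) θ' with hm
  have hmθ : m < θ := max_lt hqθ hθ
  have hall : ∀ N : ℕ, ∀ S : Finset X, (∀ x ∈ S, x ∈ Y) → IsSep f N δ S →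
      ∑ x ∈ S, Real.exp (birk f φ x N) ≤
        (A + (N + 1) ^ 2 * (A * A * B)) * Real.exp (m * N) := by
    intro N S hS hs
    rw [← Finset.sum_filter_add_sum_filter_not S (fun x => (x, N) ∈ D)]
    have h1 := sum_exp_birk_le_of_decomposition (f := f) (T := S.filter fun x => (x, N) ∈ D)
      hdecomp hY hδ.le hφ (hcover Pc fun c hc => Or.inl (Or.inr hc))
      (hcover Sc fun c hc => Or.inr hc) hA0 (by linarith) hG
      (by intro x hx; rw [Finset.mem_filter] at hx; exact ⟨hS x hx.1, hx.2⟩)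
      (hs.subset (Finset.filter_subset _ _))
    have h2 := hA N (S.filter fun x => (x, N) ∉ D)
      (by intro x hx; rw [Finset.mem_filter] at hx; exact Or.inl (Or.inl hx.2))
      ((hs.subset (Finset.filter_subset _ _)).mono_scale (by linarith))
    have h3 : A * Real.exp (q * N) ≤ A * Real.exp (m * N) := by
      gcongr
      linarith [le_max_left (q + η) θ']
    linarith
  have hlim : Tendsto (fun N : ℕ => (A + ((N : ℝ) + 1) ^ 2 * (A * A * B)) *
      Real.exp (-((θ - m) * N))) atTop (𝓝 0) := by
    have h1 : Tendsto (fun x : ℝ => (x + 1) ^ 2 * Real.exp (-((θ - m) * x))) atTop (𝓝 0) := by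
      have h2 := fun n => Real.tendsto_pow_mul_exp_neg_atTop_nhds_zero n
      have h3 : ∀ n : ℕ, Tendsto (fun x : ℝ => x ^ n * Real.exp (-((θ - m) * x))) atTop (𝓝 0) := by
        intro n
        have h4 := (h2 n).comp (tendsto_id.const_mul_atTop (sub_pos.2 hmθ) )
        have h5 := h4.const_mul (((θ - m) ^ n)⁻¹)
        rw [mul_zero] at h5
        refine h5.congr fun x => ?_
        have : (θ - m) ^ n ≠ 0 := pow_ne_zero _ (sub_pos.2 hmθ).ne'
        simp only [Function.comp, id, mul_pow]
        field_simp
      have h4 := ((h3 2).add ((h3 1).const_mul 2)).add (h3 0)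
      simp only [mul_zero, add_zero] at h4
      refine h4.congr fun x => by ring
    have h0 : Tendsto (fun x : ℝ => Real.exp (-((θ - m) * x))) atTop (𝓝 0) :=
      Real.tendsto_exp_neg_atTop_nhds_zero.comp (tendsto_id.const_mul_atTop (sub_pos.2 hmθ))
    have h2 := ((h0.const_mul A).add (h1.mul_const (A * A * B))).comp
      (tendsto_natCast_atTop_atTop (R := ℝ))
    simp only [mul_zero, zero_mul, add_zero] at h2
    refine h2.congr fun N => ?_
    simp only [Function.comp]
    ring
  obtain ⟨N₀, hN₀⟩ := eventually_atTop.1 (hlim.eventually_lt_const one_pos)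
  obtain ⟨N, hN, S, hSY, hSs, hSb⟩ := hbig N₀
  have h1 := hSb.trans (hall N S hSY hSs)
  have h2 := hN₀ N hN
  have h3 : Real.exp (θ * N) = Real.exp (m * N) * Real.exp ((θ - m) * N) := by
    rw [← Real.exp_add]; ring_nf
  rw [Real.exp_neg, ← div_eq_mul_inv, div_lt_one (Real.exp_pos _)] at h2
  rw [h3, mul_comm] at h1
  exact h2.not_ge (le_of_mul_le_mul_right h1 (Real.exp_pos _))

end Extract

section Glue

variable {X : Type*} [MetricSpace X] {f : X → X}

/-- The points whose orbits `δ`-shadow concatenations of length-`n` words based at points of `E`,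
with gaps shorter than `τ`. -/
def shadowSet (f : X → X) (E : Finset X) (n τ : ℕ) (δ : ℝ) : Set X :=
  {z | ∃ (e : ℕ → X) (r : ℕ → ℕ), (∀ k, e k ∈ E) ∧ (∀ k, r k < τ) ∧ ∀ k, ∀ j < n,
    dist (f^[(∑ i ∈ Finset.range k, (n + r i)) + j] z) (f^[j] (e k)) ≤ δ}

/-- The closed forward-invariant hull of the set of shadowing points. -/
def shadowHull (f : X → X) (E : Finset X) (n τ : ℕ) (δ : ℝ) : Set X :=
  closure (⋃ t : ℕ, f^[t] '' shadowSet f E n τ δ)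

variable {E : Finset X} {n τ : ℕ} {δ : ℝ}

theorem isClosed_shadowHull : IsClosed (shadowHull f E n τ δ) := isClosed_closure

theorem mapsTo_shadowHull (hf : Continuous f) :
    Set.MapsTo f (shadowHull f E n τ δ) (shadowHull f E n τ δ) := by
  refine Set.MapsTo.closure ?_ hf
  intro y hy
  obtain ⟨t, z, hz, rfl⟩ := Set.mem_iUnion.1 hy
  exact Set.mem_iUnion.2 ⟨t + 1, z, hz, Function.iterate_succ_apply' f t z⟩

theorem shadowSet_subset_shadowHull : shadowSet f E n τ δ ⊆ shadowHull f E n τ δ :=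
  fun z hz => subset_closure (Set.mem_iUnion.2 ⟨0, z, hz, rfl⟩)

/-- A shadowing point shadows a first word and returns to the set of shadowing points. -/
theorem exists_return_shadowSet {z : X} (hz : z ∈ shadowSet f E n τ δ) :
    ∃ e ∈ E, ∃ r < τ, (∀ j < n, dist (f^[j] z) (f^[j] e) ≤ δ) ∧
      f^[n + r] z ∈ shadowSet f E n τ δ := by
  obtain ⟨e, r, he, hr, hd⟩ := hz
  refine ⟨e 0, he 0, r 0, hr 0, fun j hj => by simpa using hd 0 j hj,
    fun k => e (k + 1), fun k => r (k + 1), fun k => he _, fun k => hr _, fun k j hj => ?_⟩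
  have h1 := hd (k + 1) j hj
  rw [Finset.sum_range_succ'] at h1
  rw [← Function.iterate_add_apply]
  convert h1 using 3
  ring

theorem mem_iUnion_iterate_shadowSet (hn : 1 ≤ n) (t : ℕ) :
    f^[t] '' shadowSet f E n τ δ ⊆ ⋃ i ∈ Finset.range (n + τ), f^[i] '' shadowSet f E n τ δ := by
  induction t using Nat.strong_induction_on with
  | _ t ih =>
    rintro y ⟨z, hz, rfl⟩
    rcases lt_or_ge t (n + τ) with h | h
    · exact Set.mem_biUnion (Finset.mem_coe.2 (Finset.mem_range.2 h)) ⟨z, hz, rfl⟩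
    · obtain ⟨e, -, r, hr, -, hz'⟩ := exists_return_shadowSet hz
      refine ih (t - (n + r)) (by omega) ⟨_, hz', ?_⟩
      rw [← Function.iterate_add_apply, Nat.sub_add_cancel (by omega)]

open Classical in
theorem bcov_shadowSet_mul {ε C : ℝ} (hε : 2 * δ < ε) (hC : BCov f (Set.univ : Set X) 1 ε C)
    (hC1 : 1 ≤ C) (m : ℕ) :
    BCov f (shadowSet f E n τ δ) (m * n) ε ((E.card * τ * C ^ τ) ^ m) := by
  induction m with
  | zero =>
    refine ⟨{Set.univ}, fun y _ => ⟨_, Finset.mem_singleton_self _, Set.mem_univ _⟩, ?_, by simp⟩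
    intro s _ y _ z _ k hk
    simp at hk
  | succ m ih =>
    set Z := shadowSet f E n τ δ with hZ
    have hcell : ∀ c ∈ E ×ˢ Finset.range τ, BCov f
        {z ∈ Z | (∀ j < n, dist (f^[j] z) (f^[j] c.1) ≤ δ) ∧ f^[n + c.2] z ∈ Z} ((m + 1) * n) ε
        (C ^ τ * (E.card * τ * C ^ τ) ^ m) := by
      rintro ⟨e, r⟩ hc
      have h1 : BCov f {z ∈ Z | (∀ j < n, dist (f^[j] z) (f^[j] e) ≤ δ) ∧ f^[n + r] z ∈ Z} n ε 1 :=
        by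
        have := bcov_of_spanning (f := f) (n := n) (E := {e}) hε
          (A := {z ∈ Z | (∀ j < n, dist (f^[j] z) (f^[j] e) ≤ δ) ∧ f^[n + r] z ∈ Z})
          (fun y hy => ⟨e, by simp, fun k hk => by rw [dist_comm]; exact hy.2.1 k hk⟩)
        simpa using this
      have h2 := (h1.mul (hC.pow r) fun _ _ => Set.mem_univ _).mul ih fun y hy => hy.2.2
      have hr : r < τ := Finset.mem_range.1 (Finset.mem_product.1 hc).2
      refine h2.mono subset_rfl (by rw [add_mul]; omega) le_rfl ?_
      rw [one_mul]
      gcongr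
    refine ((bcov_biUnion _ hcell).mono_set ?_).mono_bound (le_of_eq ?_)
    · intro z hz
      obtain ⟨e, he, r, hr, h1, h2⟩ := exists_return_shadowSet hz
      exact Set.mem_biUnion (x := (e, r)) (Finset.mem_coe.2
        (Finset.mem_product.2 ⟨he, Finset.mem_range.2 hr⟩)) ⟨hz, h1, h2⟩
    · simp only [Finset.sum_const, Finset.card_product, Finset.card_range, nsmul_eq_mul]
      push_cast
      ring

theorem exists_bcov_shadowHull (hf : Continuous f) {ε ε' C : ℝ} (hε : 2 * δ < ε) (hε' : ε < ε')
    (hC : BCov f (Set.univ : Set X) 1 ε C) (hC1 : 1 ≤ C) (hn : 1 ≤ n) (hτ : 1 ≤ τ)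
    (hE : E.Nonempty) :
    ∃ A : ℝ, 0 < A ∧ ∀ N : ℕ, BCov f (shadowHull f E n τ δ) N ε'
      (A * Real.exp (Real.log (E.card * τ * C ^ τ) / n * N)) := by
  set K : ℝ := E.card * τ * C ^ τ with hK
  have hK1 : 1 ≤ K := by
    have h1 : (1 : ℝ) ≤ E.card := by exact_mod_cast hE.card_pos
    have h2 : (1 : ℝ) ≤ τ := by exact_mod_cast hτ
    exact one_le_mul_of_one_le_of_one_le (one_le_mul_of_one_le_of_one_le h1 h2)
      (one_le_pow₀ hC1)
  have hn0 : (0 : ℝ) < n := by exact_mod_cast hn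
  refine ⟨(n + τ : ℕ) * Real.exp (Real.log K / n * (n + τ) + Real.log K), by positivity,
    fun N => ?_⟩
  refine BCov.closure hf ?_ hε'
  set m := (N + (n + τ)) / n + 1 with hm
  have hmn : N + (n + τ) ≤ m * n := by
    have := Nat.lt_div_mul_add (a := N + (n + τ)) (b := n) (by omega)
    rw [hm, add_mul]
    omega
  have hm' : (m : ℝ) ≤ (N + (n + τ)) / n + 1 := by
    have := Nat.cast_div_le (α := ℝ) (m := N + (n + τ)) (n := n)
    rw [hm]
    push_cast at this ⊢
    linarith
  have h1 : ∀ i ∈ Finset.range (n + τ), BCov f (f^[i] '' shadowSet f E n τ δ) N ε (K ^ m) := by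
    intro i hi
    refine BCov.image ((bcov_shadowSet_mul hε hC hC1 m).mono subset_rfl ?_ le_rfl le_rfl)
    have := Finset.mem_range.1 hi
    omega
  refine ((bcov_biUnion _ h1).mono_set (Set.iUnion_subset fun t =>
    mem_iUnion_iterate_shadowSet hn t)).mono_bound ?_
  rw [Finset.sum_const, Finset.card_range, nsmul_eq_mul, mul_assoc, ← Real.exp_add]
  have h2 : K ^ m ≤ Real.exp (Real.log K / n * (n + τ) + Real.log K + Real.log K / n * N) := by
    rw [← Real.rpow_natCast, Real.rpow_def_of_pos (by linarith), Real.exp_le_exp]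
    have := mul_le_mul_of_nonneg_left hm' (Real.log_nonneg hK1)
    refine this.trans (le_of_eq ?_)
    field_simp
    ring
  gcongr

open Classical in
theorem exists_sep_shadowHull {G : Set (X × ℕ)} {N₀ : ℕ} {σ : ℝ} (hG : GOat f G δ N₀ τ)
    (hn : N₀ ≤ n) (hτ : 1 ≤ τ) (hE : ∀ x ∈ E, (x, n) ∈ G) (hEs : IsSep f n σ E)
    (hEne : E.Nonempty) (hσ : 2 * δ ≤ σ) (m : ℕ) :
    ∃ S : Finset X, (∀ x ∈ S, x ∈ shadowHull f E n τ δ) ∧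
      IsSep f (m * (n + τ)) (σ - 2 * δ) S ∧ (E.card : ℝ) ^ m / (τ : ℝ) ^ m ≤ S.card := by
  obtain ⟨e₀, he₀⟩ := hEne
  have hw : ∀ w : Fin m → E, ∃ (r : ℕ → ℕ) (z : X), (∀ k, r k < τ) ∧
      z ∈ shadowSet f E n τ δ ∧ ∀ k : Fin m, ∀ j < n,
        dist (f^[(∑ i ∈ Finset.range k, (n + r i)) + j] z) (f^[j] (w k)) ≤ δ := by
    intro w
    have hmem : ∀ k : ℕ, (if h : k < m then (w ⟨k, h⟩ : X) else e₀) ∈ E := by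
      intro k
      split_ifs with h
      · exact (w ⟨k, h⟩).2
      · exact he₀
    obtain ⟨r, z, hr, hz⟩ := hG (fun k => if h : k < m then (w ⟨k, h⟩ : X) else e₀) (fun _ => n)
      (fun k => hE _ (hmem k)) (fun _ => hn)
    refine ⟨r, z, hr, ⟨_, r, hmem, hr, hz⟩, fun k j hj => ?_⟩
    simpa using hz k j hj
  choose r z hr hz hd using hw
  have : NeZero τ := ⟨by omega⟩
  obtain ⟨ρ, -, hρ⟩ := Finset.exists_le_card_fiber_of_nsmul_le_card_of_maps_to
    (s := (Finset.univ : Finset (Fin m → E))) (t := (Finset.univ : Finset (Fin m → Fin τ)))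
    (f := fun w i => (⟨r w i, hr w i⟩ : Fin τ)) (b := (E.card : ℝ) ^ m / (τ : ℝ) ^ m)
    (fun _ _ => Finset.mem_univ _) ⟨fun _ => 0, Finset.mem_univ _⟩ (by
      have h0 : (τ : ℝ) ≠ 0 := by exact_mod_cast (show τ ≠ 0 by omega)
      simp only [Finset.card_univ, Fintype.card_fun, Fintype.card_fin, Fintype.card_coe,
        nsmul_eq_mul]
      push_cast
      rw [mul_div_cancel₀ _ (pow_ne_zero _ h0)])
  set T : Finset (Fin m → E) := Finset.univ.filter fun w =>
    (fun i : Fin m => (⟨r w i, hr w i⟩ : Fin τ)) = ρ with hT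
  have hTr : ∀ w ∈ T, ∀ i : Fin m, r w i = ρ i := by
    intro w hw i
    have := congrFun (Finset.mem_filter.1 hw).2 i
    rw [← this]
  have hsum : ∀ w ∈ T, ∀ k : Fin m, ∑ i ∈ Finset.range k, (n + r w i) =
      ∑ i ∈ Finset.range k, (n + if h : i < m then (ρ ⟨i, h⟩ : ℕ) else 0) := by
    intro w hw k
    refine Finset.sum_congr rfl fun i hi => ?_
    have hi' : i < m := (Finset.mem_range.1 hi).trans k.2
    rw [dif_pos hi', ← hTr w hw ⟨i, hi'⟩]
  have hsep : ∀ w ∈ T, ∀ w' ∈ T, w ≠ w' →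
      ∃ k < m * (n + τ), σ - 2 * δ < dist (f^[k] (z w)) (f^[k] (z w')) := by
    intro w hw w' hw' hne
    obtain ⟨i, hi⟩ := Function.ne_iff.1 hne
    obtain ⟨j, hj, hjd⟩ := hEs (w i) (w i).2 (w' i) (w' i).2 fun h => hi (Subtype.ext h)
    have h1 := hd w i j hj
    have h2 := hd w' i j hj
    rw [hsum w hw] at h1
    rw [hsum w' hw'] at h2
    refine ⟨(∑ l ∈ Finset.range i, (n + if h : l < m then (ρ ⟨l, h⟩ : ℕ) else 0)) + j, ?_, ?_⟩
    · have h3 : ∑ l ∈ Finset.range i, (n + if h : l < m then (ρ ⟨l, h⟩ : ℕ) else 0) ≤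
          i * (n + τ) := by
        refine (Finset.sum_le_card_nsmul _ _ (n + τ) fun l hl => ?_).trans (by simp)
        split_ifs with h
        · have := (ρ ⟨l, h⟩).2
          omega
        · omega
      have h4 : ((i : ℕ) + 1) * (n + τ) ≤ m * (n + τ) := Nat.mul_le_mul_right _ i.2
      rw [add_mul] at h4
      omega
    · have h3 := dist_triangle4_left
        (f^[(∑ l ∈ Finset.range i, (n + if h : l < m then (ρ ⟨l, h⟩ : ℕ) else 0)) + j] (z w))
        (f^[(∑ l ∈ Finset.range i, (n + if h : l < m then (ρ ⟨l, h⟩ : ℕ) else 0)) + j] (z w'))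
        (f^[j] (w i : X)) (f^[j] (w' i : X))
      linarith
  have hinj : Set.InjOn z (T : Set (Fin m → E)) := by
    intro w hw w' hw' h
    by_contra hne
    obtain ⟨k, -, hk⟩ := hsep w hw w' hw' hne
    rw [h, dist_self] at hk
    linarith
  refine ⟨T.image z, ?_, ?_, ?_⟩
  · intro x hx
    obtain ⟨w, -, rfl⟩ := Finset.mem_image.1 hx
    exact shadowSet_subset_shadowHull (hz w)
  · intro x hx y hy hne
    obtain ⟨w, hw, rfl⟩ := Finset.mem_image.1 hx
    obtain ⟨w', hw', rfl⟩ := Finset.mem_image.1 hy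
    exact hsep w hw w' hw' fun h => hne (by rw [h])
  · rwa [Finset.card_image_of_injOn hinj]

/-- Birkhoff averages along the hull are controlled by those along the glued words. -/
theorem exists_birk_shadowHull_le (hf : Continuous f) {ψ : X → ℝ} (hψ : Continuous ψ) {a b η : ℝ}
    (hb : ∀ x, |ψ x| ≤ b) (hη : ∀ x y, dist x y ≤ δ → |ψ x - ψ y| ≤ η) (hn : 1 ≤ n)
    (ha : ∀ x ∈ E, birk f ψ x n ≤ a * n) :
    ∃ B : ℝ, ∀ (N : ℕ), ∀ y ∈ shadowHull f E n τ δ,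
      birk f ψ y N ≤ (a + η + (b + |a + η|) * τ / n) * N + B := by
  set a' := a + η + (b + |a + η|) * τ / n with ha'
  have hn0 : (0 : ℝ) < n := by exact_mod_cast hn
  set c := b + |a'| with hc
  have hlin : ∀ (y : X) (N : ℕ), birk f ψ y N - a' * N ≤ c * N := by
    intro y N
    have h1 := le_of_abs_le (abs_birk_le (f := f) hb y N)
    have h2 := mul_le_mul_of_nonneg_right (neg_le_abs a') (Nat.cast_nonneg (α := ℝ) N)
    rw [hc, add_mul]
    linarith
  have hlin' : ∀ (y : X) (N : ℕ), -(c * N) ≤ birk f ψ y N - a' * N := by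
    intro y N
    have h1 := neg_le_of_abs_le (abs_birk_le (f := f) hb y N)
    have h2 := mul_le_mul_of_nonneg_right (le_abs_self a') (Nat.cast_nonneg (α := ℝ) N)
    rw [hc, add_mul]
    linarith
  have hZ : ∀ N : ℕ, ∀ z ∈ shadowSet f E n τ δ, birk f ψ z N - a' * N ≤ c * (n + τ) := by
    intro N
    induction N using Nat.strong_induction_on with
    | _ N ih =>
      intro z hz
      have hc0 : 0 ≤ c := add_nonneg ((abs_nonneg _).trans (hb z)) (abs_nonneg _)
      rcases le_or_gt N (n + τ) with h | h
      · refine (hlin z N).trans ?_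
        gcongr
        exact_mod_cast h
      obtain ⟨e, he, r, hr, h1, h2⟩ := exists_return_shadowSet hz
      have h3 := ih (N - (n + r)) (by omega) _ h2
      have h4 : birk f ψ z N = birk f ψ z n + birk f ψ (f^[n] z) r +
          birk f ψ (f^[n + r] z) (N - (n + r)) := by
        rw [← birk_add, ← birk_add, Nat.add_sub_cancel' (by omega)]
      have h5 := abs_le.1 (birk_sub_le_of_mem_bowenBall (f := f) hη (n := n) (x := z) (y := e) h1)
      have h6 := le_of_abs_le (abs_birk_le (f := f) hb (f^[n] z) r)
      have h7 := ha e he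
      have h8 : ((N - (n + r) : ℕ) : ℝ) = N - (n + r) := by
        rw [Nat.cast_sub (by omega)]; push_cast; ring
      have h9 : (a + η) * n + b * r ≤ a' * (n + r) := by
        have hb0 : 0 ≤ b := (abs_nonneg _).trans (hb z)
        have hrτ : (r : ℝ) ≤ τ := by exact_mod_cast hr.le
        have e1 : a' * (n + r) = (a + η) * n + (a + η) * r + (b + |a + η|) * τ +
            (b + |a + η|) * τ / n * r := by
          rw [ha']; field_simp; ring
        have e2 : 0 ≤ (b + |a + η|) * τ / n * r := by positivity
        have e3 : (b + |a + η|) * r ≤ (b + |a + η|) * τ := by gcongr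
        have e4 : -|a + η| * r ≤ (a + η) * r := by
          gcongr
          exact neg_abs_le _
        nlinarith
      rw [h8] at h3
      nlinarith [h5.1, h5.2]
  refine ⟨2 * (c * (n + τ)), fun N => ?_⟩
  have hcl : IsClosed {y | birk f ψ y N ≤ a' * N + 2 * (c * (n + τ))} :=
    isClosed_le (continuous_finsetSum _ fun k _ => hψ.comp (hf.iterate k)) continuous_const
  refine fun y hy => closure_minimal ?_ hcl hy
  refine Set.iUnion_subset fun t => (mem_iUnion_iterate_shadowSet hn t).trans ?_
  refine Set.iUnion₂_subset fun i hi => ?_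
  rintro y ⟨z, hz, rfl⟩
  have hc0 : 0 ≤ c := add_nonneg ((abs_nonneg _).trans (hb z)) (abs_nonneg _)
  have h1 := hZ (i + N) z hz
  have h2 := hlin' z i
  rw [birk_add] at h1
  have h3 : (i : ℝ) ≤ n + τ := by exact_mod_cast (Finset.mem_range.1 hi).le
  have h4 : c * i ≤ c * (n + τ) := by gcongr
  push_cast at h1
  simp only [Set.mem_ofPred_eq]
  linarith

end Glue

section Pressure

variable {X : Type*} [MetricSpace X] {f : X → X}

theorem phiSup_zero (f : X → X) (φ : X → ℝ) (x : X) (n : ℕ) :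
    phiSup f φ x n 0 = birk f φ x n := by
  have : {s | ∃ y : X, (∀ k < n, dist (f^[k] x) (f^[k] y) ≤ 0) ∧ s = birk f φ y n} =
      {birk f φ x n} := by
    ext s
    constructor
    · rintro ⟨y, hy, rfl⟩
      refine Finset.sum_congr rfl fun k hk => ?_
      rw [dist_le_zero.1 (hy k (Finset.mem_range.1 hk))]
    · rintro rfl
      exact ⟨x, fun k _ => (dist_self _).le, rfl⟩
  rw [phiSup, this, csSup_singleton]

theorem exists_abs_le [CompactSpace X] {φ : X → ℝ} (hφ : Continuous φ) :
    ∃ b : ℝ, 0 ≤ b ∧ ∀ x, |φ x| ≤ b := by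
  obtain ⟨b, hb⟩ := (isCompact_range hφ.abs).bddAbove
  exact ⟨max b 0, le_max_right _ _, fun x => (hb ⟨x, rfl⟩).trans (le_max_left _ _)⟩

theorem exists_abs_sub_le [CompactSpace X] {φ : X → ℝ} (hφ : Continuous φ) {κ : ℝ} (hκ : 0 < κ) :
    ∃ δ : ℝ, 0 < δ ∧ ∀ x y, dist x y ≤ δ → |φ x - φ y| ≤ κ := by
  obtain ⟨δ, hδ, h⟩ := Metric.uniformContinuous_iff.1
    (CompactSpace.uniformContinuous_of_continuous hφ) κ hκ
  refine ⟨δ / 2, by positivity, fun x y hxy => ?_⟩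
  have := h (a := x) (b := y) (by linarith)
  rw [Real.dist_eq] at this
  exact this.le

theorem sum_exp_birk_le {φ : X → ℝ} {b C δ : ℝ} (hb : ∀ x, |φ x| ≤ b)
    (hC : BCov f (Set.univ : Set X) 1 δ C) (hC1 : 1 ≤ C) {n : ℕ} {E : Finset X}
    (hE : IsSep f n δ E) :
    ∑ x ∈ E, Real.exp (birk f φ x n) ≤ Real.exp ((Real.log C + b) * n) := by
  have h1 : (E.card : ℝ) ≤ C ^ n := (hC.pow n).card_le (fun _ _ => Set.mem_univ _) hE
  refine (Finset.sum_le_card_nsmul _ _ (Real.exp (b * n)) fun x _ =>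
    Real.exp_le_exp.2 (le_of_abs_le (abs_birk_le hb x n))).trans ?_
  rw [nsmul_eq_mul, add_mul, Real.exp_add, mul_comm (Real.log C), Real.exp_nat_mul,
    Real.exp_log (by linarith)]
  gcongr

variable {φ : X → ℝ} {Q : Set (X × ℕ)} {b C δ : ℝ}

theorem bddAbove_theta (hb : ∀ x, |φ x| ≤ b) (hC : BCov f (Set.univ : Set X) 1 δ C)
    (hC1 : 1 ≤ C) (n : ℕ) :
    Real.exp ((Real.log C + b) * n) ∈ upperBounds {s | ∃ E : Finset X, (∀ x ∈ E, (x, n) ∈ Q) ∧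
      IsSep f n δ E ∧ s = ∑ x ∈ E, Real.exp (phiSup f φ x n 0)} := by
  rintro s ⟨E, -, hE, rfl⟩
  simp only [phiSup_zero]
  exact sum_exp_birk_le hb hC hC1 hE

theorem sum_le_theta (hb : ∀ x, |φ x| ≤ b) (hC : BCov f (Set.univ : Set X) 1 δ C)
    (hC1 : 1 ≤ C) {n : ℕ} {E : Finset X} (hEQ : ∀ x ∈ E, (x, n) ∈ Q) (hE : IsSep f n δ E) :
    ∑ x ∈ E, Real.exp (birk f φ x n) ≤ Theta f φ Q n δ 0 := by
  refine le_csSup ⟨_, bddAbove_theta hb hC hC1 n⟩ ⟨E, hEQ, hE, ?_⟩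
  simp only [phiSup_zero]

theorem theta_nonneg (hb : ∀ x, |φ x| ≤ b) (hC : BCov f (Set.univ : Set X) 1 δ C)
    (hC1 : 1 ≤ C) (n : ℕ) : 0 ≤ Theta f φ Q n δ 0 := by
  simpa using sum_le_theta (f := f) (φ := φ) (Q := Q) (n := n) (E := ∅) hb hC hC1 (by simp)
    (by intro x hx; simp at hx)

theorem theta_le (hb : ∀ x, |φ x| ≤ b) (hC : BCov f (Set.univ : Set X) 1 δ C)
    (hC1 : 1 ≤ C) (n : ℕ) : Theta f φ Q n δ 0 ≤ Real.exp ((Real.log C + b) * n) :=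
  csSup_le ⟨_, ∅, by simp, by intro x hx; simp at hx, rfl⟩ (bddAbove_theta hb hC hC1 n)

theorem exp_le_theta_or_eq_zero (hb : ∀ x, |φ x| ≤ b) (hC : BCov f (Set.univ : Set X) 1 δ C)
    (hC1 : 1 ≤ C) (n : ℕ) :
    Real.exp (-(b * n)) ≤ Theta f φ Q n δ 0 ∨ Theta f φ Q n δ 0 = 0 := by
  by_cases h : ∃ x, (x, n) ∈ Q
  · left
    obtain ⟨x, hx⟩ := h
    have h1 := sum_le_theta (f := f) (φ := φ) (Q := Q) (n := n) (E := {x}) hb hC hC1 (by simpa)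
      (by intro y hy z hz hne; simp at hy hz; exact absurd (hy.trans hz.symm) hne)
    rw [Finset.sum_singleton] at h1
    exact (Real.exp_le_exp.2 (neg_le_of_abs_le (abs_birk_le hb x n))).trans h1
  · right
    refine le_antisymm (csSup_le ⟨_, ∅, by simp, by intro x hx; simp at hx, rfl⟩ ?_)
      (theta_nonneg hb hC hC1 n)
    rintro s ⟨E, hE, -, rfl⟩
    have : E = ∅ := Finset.eq_empty_of_forall_notMem fun x hx => h ⟨x, hE x hx⟩
    simp [this]

theorem log_theta_div_le (hb : ∀ x, |φ x| ≤ b) (hb0 : 0 ≤ b)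
    (hC : BCov f (Set.univ : Set X) 1 δ C) (hC1 : 1 ≤ C) (n : ℕ) :
    Real.log (Theta f φ Q n δ 0) / n ≤ Real.log C + b := by
  have h0 : 0 ≤ Real.log C + b := add_nonneg (Real.log_nonneg hC1) hb0
  refine div_le_of_le_mul₀ (Nat.cast_nonneg _) h0 ?_
  rcases (theta_nonneg (Q := Q) hb hC hC1 n).eq_or_lt with h | h
  · rw [← h, Real.log_zero]
    positivity
  · rw [Real.log_le_iff_le_exp h]
    exact theta_le hb hC hC1 n

theorem neg_le_log_theta_div (hb : ∀ x, |φ x| ≤ b) (hb0 : 0 ≤ b)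
    (hC : BCov f (Set.univ : Set X) 1 δ C) (hC1 : 1 ≤ C) (n : ℕ) :
    -b ≤ Real.log (Theta f φ Q n δ 0) / n := by
  rcases n.eq_zero_or_pos with rfl | hn
  · simpa using hb0
  rw [le_div_iff₀ (by exact_mod_cast hn)]
  rcases exp_le_theta_or_eq_zero (f := f) (φ := φ) (Q := Q) hb hC hC1 n with h | h
  · rw [Real.le_log_iff_exp_le ((Real.exp_pos _).trans_le h)]
    convert h using 2
    ring
  · rw [h, Real.log_zero]
    nlinarith [Nat.cast_nonneg (α := ℝ) n]

variable [CompactSpace X]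

theorem isBoundedUnder_log_theta (hφ : Continuous φ) (hδ : 0 < δ) :
    IsBoundedUnder (· ≤ ·) atTop (fun n : ℕ => Real.log (Theta f φ Q n δ 0) / n) ∧
      IsCoboundedUnder (· ≤ ·) atTop (fun n : ℕ => Real.log (Theta f φ Q n δ 0) / n) := by
  obtain ⟨b, hb0, hb⟩ := exists_abs_le hφ
  obtain ⟨C, hC1, hC⟩ := exists_bcov_one (f := f) hδ
  refine ⟨isBoundedUnder_of ⟨_, log_theta_div_le hb hb0 hC hC1⟩,
    IsBoundedUnder.isCoboundedUnder_le (isBoundedUnder_of ⟨-b, neg_le_log_theta_div hb hb0 hC hC1⟩)⟩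

/-- A pressure bound yields a uniform exponential bound for partition sums. -/
theorem exists_sum_le_of_pres_lt (hφ : Continuous φ) (hδ : 0 < δ) {q : ℝ}
    (hq : Pres f φ Q δ 0 < q) :
    ∃ A : ℝ, ∀ n, ∀ E : Finset X, (∀ x ∈ E, (x, n) ∈ Q) → IsSep f n δ E →
      ∑ x ∈ E, Real.exp (birk f φ x n) ≤ A * Real.exp (q * n) := by
  obtain ⟨b, hb0, hb⟩ := exists_abs_le hφ
  obtain ⟨C, hC1, hC⟩ := exists_bcov_one (f := f) hδ
  obtain ⟨n₀, hn₀⟩ := eventually_atTop.1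
    (eventually_lt_of_limsup_lt hq (isBoundedUnder_log_theta hφ hδ).1)
  set A : ℝ := 1 + ∑ k ∈ Finset.range (n₀ + 1), Theta f φ Q k δ 0 * Real.exp (-(q * k)) with hA
  have hterm : ∀ k, 0 ≤ Theta f φ Q k δ 0 * Real.exp (-(q * k)) := fun k =>
    mul_nonneg (theta_nonneg hb hC hC1 k) (Real.exp_pos _).le
  have hA1 : 1 ≤ A := by
    have := Finset.sum_nonneg fun k (_ : k ∈ Finset.range (n₀ + 1)) => hterm k
    linarith
  refine ⟨A, fun n E hEQ hE => (sum_le_theta hb hC hC1 hEQ hE).trans ?_⟩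
  rcases le_or_gt n n₀ with h | h
  · have h1 := Finset.single_le_sum (fun k _ => hterm k)
      (Finset.mem_range.2 (Nat.lt_succ_of_le h))
    have h2 : Theta f φ Q n δ 0 * Real.exp (-(q * n)) ≤ A := by linarith
    rwa [Real.exp_neg, ← div_eq_mul_inv, div_le_iff₀ (Real.exp_pos _)] at h2
  · have h1 := hn₀ n h.le
    refine le_trans ?_ (le_mul_of_one_le_left (Real.exp_pos _).le hA1)
    rcases (theta_nonneg (Q := Q) hb hC hC1 n).eq_or_lt with h2 | h2
    · rw [← h2]
      positivity
    · rw [div_lt_iff₀ (by exact_mod_cast (by omega : 0 < n)), Real.log_lt_iff_lt_exp h2] at h1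
      exact h1.le

theorem exists_sep_of_lt_pres [Nonempty X] (hφ : Continuous φ) (hδ : 0 < δ) {θ : ℝ}
    (hθ : θ < Pres f φ Set.univ δ 0) (N₀ : ℕ) :
    ∃ N ≥ N₀, ∃ S : Finset X, IsSep f N δ S ∧
      Real.exp (θ * N) ≤ ∑ x ∈ S, Real.exp (birk f φ x N) := by
  obtain ⟨b, hb0, hb⟩ := exists_abs_le hφ
  obtain ⟨C, hC1, hC⟩ := exists_bcov_one (f := f) hδ
  obtain ⟨N, hN, h⟩ := frequently_atTop.1
    (frequently_lt_of_lt_limsup (isBoundedUnder_log_theta hφ hδ).2 hθ) (N₀ + 1)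
  refine ⟨N, by omega, ?_⟩
  have hpos : 0 < Theta f φ Set.univ N δ 0 := by
    have x : X := Classical.arbitrary X
    have h1 := sum_le_theta (f := f) (φ := φ) (Q := Set.univ) (n := N) (E := {x}) hb hC hC1
      (by simp) (by intro y hy z hz hne; simp at hy hz; exact absurd (hy.trans hz.symm) hne)
    rw [Finset.sum_singleton] at h1
    exact (Real.exp_pos _).trans_le h1
  rw [lt_div_iff₀ (by exact_mod_cast (by omega : 0 < N)), Real.lt_log_iff_exp_lt hpos] at h
  rw [Theta] at h
  obtain ⟨s, ⟨E, -, hE, rfl⟩, hs⟩ := exists_lt_of_lt_csSup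
    (by exact ⟨_, ∅, by simp, by intro x hx; simp at hx, rfl⟩) h
  simp only [phiSup_zero] at hs
  exact ⟨E, hE, hs.le⟩

theorem pres_le_max_univ (hφ : Continuous φ) (hδ : 0 < δ) :
    Pres f φ Q δ 0 ≤ max (Pres f φ Set.univ δ 0) 0 := by
  obtain ⟨b, hb0, hb⟩ := exists_abs_le hφ
  obtain ⟨C, hC1, hC⟩ := exists_bcov_one (f := f) hδ
  refine le_of_forall_gt_imp_ge_of_dense fun a ha => ?_
  refine limsup_le_of_le (isBoundedUnder_log_theta hφ hδ).2 ?_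
  filter_upwards [eventually_lt_of_limsup_lt ((le_max_left _ _).trans_lt ha)
    (isBoundedUnder_log_theta hφ hδ).1] with n hn
  rcases (theta_nonneg (f := f) (φ := φ) (Q := Q) hb hC hC1 n).eq_or_lt with h | h
  · rw [← h]
    simpa using ((le_max_right _ _).trans_lt ha).le
  · refine le_trans ?_ hn.le
    gcongr
    refine csSup_le_csSup ⟨_, bddAbove_theta hb hC hC1 n⟩
      ⟨_, ∅, by simp, by intro x hx; simp at hx, rfl⟩ ?_
    rintro s ⟨E, -, hE⟩
    exact ⟨E, fun _ _ => Set.mem_univ _, hE⟩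

end Pressure

section TailEntropy

variable {X : Type*} [MetricSpace X] {f : X → X}

theorem birk_le_of_block {φ : X → ℝ} {a b : ℝ} (hb : ∀ x, |φ x| ≤ b) {m : ℕ} (hm : 1 ≤ m)
    (h : ∀ x, birk f φ x m ≤ a * m) (n : ℕ) (x : X) :
    birk f φ x n ≤ a * n + (b + |a|) * m := by
  induction n using Nat.strong_induction_on generalizing x with
  | _ n ih =>
    have hb0 : 0 ≤ b := (abs_nonneg _).trans (hb x)
    rcases lt_or_ge n m with hn | hn
    · have h1 := le_of_abs_le (abs_birk_le (f := f) hb x n)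
      have h2 := mul_le_mul_of_nonneg_right (neg_abs_le a) (Nat.cast_nonneg (α := ℝ) n)
      have h3 : (b + |a|) * n ≤ (b + |a|) * m := by
        gcongr
      linarith
    · have h1 := ih (n - m) (by omega) (f^[m] x)
      have h2 : birk f φ x n = birk f φ x m + birk f φ (f^[m] x) (n - m) := by
        rw [← birk_add, Nat.add_sub_cancel' hn]
      rw [Nat.cast_sub hn] at h1
      linarith [h x]

theorem exists_birk_le_pstar [CompactSpace X] {φ : X → ℝ} (hφ : Continuous φ) {κ : ℝ}
    (hκ : 0 < κ) : ∃ n₀ : ℕ, ∀ n ≥ n₀, ∀ x, birk f φ x n ≤ (Pstar f φ + κ) * n := by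
  obtain ⟨b, hb0, hb⟩ := exists_abs_le hφ
  have hle : ∀ (n : ℕ) (x : X), birk f φ x n / n ≤ b := fun n x =>
    div_le_of_le_mul₀ (Nat.cast_nonneg _) hb0 (le_of_abs_le (abs_birk_le hb x n))
  have hbdd : ∀ n : ℕ, b ∈ upperBounds {v | ∃ x : X, v = birk f φ x n / n} := by
    rintro n v ⟨x, rfl⟩
    exact hle n x
  have hub : ∀ n : ℕ, sSup {v | ∃ x : X, v = birk f φ x n / n} ≤ b := by
    intro n
    rcases Set.eq_empty_or_nonempty {v | ∃ x : X, v = birk f φ x n / n} with h | h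
    · rw [h, Real.sSup_empty]
      exact hb0
    · exact csSup_le h (hbdd n)
  have hcob : IsCoboundedUnder (· ≥ ·) atTop
      (fun n : ℕ => sSup {v | ∃ x : X, v = birk f φ x n / n}) :=
    IsBoundedUnder.isCoboundedUnder_ge (isBoundedUnder_of ⟨b, hub⟩)
  have hlt : Pstar f φ < Pstar f φ + κ / 2 := by linarith
  obtain ⟨m, hm, h⟩ := frequently_atTop.1 (frequently_lt_of_liminf_lt hcob hlt) 1
  have hm0 : (0 : ℝ) < m := by exact_mod_cast hm
  have h1 : ∀ x, birk f φ x m ≤ (Pstar f φ + κ / 2) * m := by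
    intro x
    rw [← div_le_iff₀ hm0]
    exact (le_csSup ⟨b, hbdd m⟩ ⟨x, rfl⟩).trans h.le
  obtain ⟨n₀, hn₀⟩ := exists_nat_ge ((b + |Pstar f φ + κ / 2|) * m / (κ / 2))
  refine ⟨n₀, fun n hn x => (birk_le_of_block hb hm h1 n x).trans ?_⟩
  rw [div_le_iff₀ (by positivity)] at hn₀
  have h2 : (n₀ : ℝ) ≤ n := by exact_mod_cast hn
  nlinarith

/-- Finite covers of infinite Bowen balls extend to nearby long Bowen balls. -/
theorem exists_bowenBall_subset [CompactSpace X] (hf : Continuous f) {δ : ℝ} {y : X} {U : Set X}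
    (hU : IsOpen U) (hyU : {z | ∀ k, dist (f^[k] y) (f^[k] z) ≤ δ} ⊆ U) :
    ∃ M₀ : ℕ, ∀ M ≥ M₀, ∀ u, dist u y ≤ 1 / (M₀ + 1 : ℝ) → bowenBall f M δ u ⊆ U := by
  by_contra! hcon
  set K : ℕ → Set (X × X) := fun M => {w | dist w.1 y ≤ 1 / (M + 1 : ℝ) ∧
    (∀ k < M, dist (f^[k] w.1) (f^[k] w.2) ≤ δ) ∧ w.2 ∈ Uᶜ} with hK
  have hclosed : ∀ M, IsClosed (K M) := by
    intro M
    refine (isClosed_le (continuous_fst.dist continuous_const) continuous_const).inter (IsClosed.inter ?_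
      (hU.isClosed_compl.preimage continuous_snd))
    have hset : {w : X × X | ∀ k < M, dist (f^[k] w.1) (f^[k] w.2) ≤ δ} =
        ⋂ k, ⋂ (_ : k < M), {w : X × X | dist (f^[k] w.1) (f^[k] w.2) ≤ δ} := by
      ext w
      simp
    have hcl : IsClosed {w : X × X | ∀ k < M, dist (f^[k] w.1) (f^[k] w.2) ≤ δ} := by
      rw [hset]
      exact isClosed_iInter fun k => isClosed_iInter fun _ =>
        isClosed_le (((hf.iterate k).comp continuous_fst).dist
          ((hf.iterate k).comp continuous_snd)) continuous_const
    exact hcl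
  have hne : (⋂ M, K M).Nonempty := by
    refine IsCompact.nonempty_iInter_of_sequence_nonempty_isCompact_isClosed K ?_ ?_
      (hclosed 0).isCompact hclosed
    · rintro M w ⟨h1, h2, h3⟩
      refine ⟨h1.trans ?_, fun k hk => h2 k (by omega), h3⟩
      gcongr
      simp
    · intro M
      obtain ⟨M', hM', u, hu, hsub⟩ := hcon M
      obtain ⟨z, hz, hzU⟩ := Set.not_subset.1 hsub
      exact ⟨(u, z), hu, fun k hk => hz k (by omega), hzU⟩
  obtain ⟨⟨u, z⟩, hw⟩ := hne
  rw [Set.mem_iInter] at hw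
  have huy : u = y := by
    refine dist_le_zero.1 (ge_of_tendsto' (tendsto_one_div_add_atTop_nhds_zero_nat (𝕜 := ℝ)) fun M =>
      (hw M).1)
  subst huy
  exact (hw 0).2.2 (hyU fun k => (hw (k + 1)).2.1 k (Nat.lt_succ_self k))

theorem exists_bcov_bowenBall [CompactSpace X] (hf : Continuous f) {δ ε β : ℝ} (hβ : 0 ≤ β)
    (hε : 0 < ε) (h : ∀ y, ∃ m : ℕ, 1 ≤ m ∧ ∃ E : Finset X, (E.card : ℝ) ≤ Real.exp (β * m) ∧
      ∀ z, (∀ k, dist (f^[k] y) (f^[k] z) ≤ δ) → ∃ x ∈ E, z ∈ bowenBall f m (ε / 8) x) :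
    ∃ A : ℝ, 0 < A ∧ ∀ n x, BCov f (bowenBall f n δ x) n ε (A * Real.exp (β * n)) := by
  choose m hm E hEc hE using h
  set U : X → Set X := fun y => ⋃ x ∈ E y, {z | ∀ k < m y, dist (f^[k] x) (f^[k] z) < ε / 4} with hU
  have hUo : ∀ y, IsOpen (U y) := fun y =>
    isOpen_biUnion fun x _ => isOpen_openBowen hf (m y) (ε / 4) x
  have hUB : ∀ y, BCov f (U y) (m y) ε (Real.exp (β * m y)) := by
    intro y
    refine (bcov_of_spanning (δ := ε / 4) (E := E y) (by linarith) fun z hz => ?_).mono_bound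
      (hEc y)
    obtain ⟨x, hx, hz'⟩ := Set.mem_iUnion₂.1 hz
    exact ⟨x, hx, fun k hk => (hz' k hk).le⟩
  have hM := fun y => exists_bowenBall_subset (δ := δ) (y := y) hf (hUo y) fun z hz => by
    obtain ⟨x, hx, hz'⟩ := hE y z hz
    exact Set.mem_biUnion hx fun k hk => (hz' k hk).trans_lt (by linarith)
  choose M hM using hM
  obtain ⟨t, ht⟩ := isCompact_univ.elim_nhds_subcover
    (fun y => Metric.closedBall y (1 / (M y + 1 : ℝ)))
    (fun y _ => Metric.closedBall_mem_nhds y (by positivity))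
  set L := t.sup fun y => max (M y) (m y) with hL
  obtain ⟨C, hC1, hC⟩ := exists_bcov_one (f := f) hε
  refine ⟨C ^ L, by positivity, fun n x => ?_⟩
  have := bcov_bowenBall_le (f := f) (V := Set.univ) (h := β) (δ := δ) (ε := ε) (M := L) hβ
    (fun u _ => ?_) hC hC1 n x
  · simpa [badCount_univ] using this
  · obtain ⟨y, hy, huy⟩ := Set.mem_iUnion₂.1 (ht.2 (Set.mem_univ u))
    have h1 : max (M y) (m y) ≤ L := Finset.le_sup (f := fun y => max (M y) (m y)) hy
    exact ⟨m y, hm y, (le_max_right _ _).trans h1, (hUB y).mono_set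
      (hM y L ((le_max_left _ _).trans h1) u huy)⟩

end TailEntropy

section TailCover

variable {X : Type*} [MetricSpace X] {f : X → X}

theorem bddAbove_sepCount_set {K : Set X} {n : ℕ} {ε c : ℝ}
    (hc : ∀ E : Finset X, IsSep f n ε E → (E.card : ℝ) ≤ c) :
    c ∈ upperBounds {v | ∃ E : Finset X, ↑E ⊆ K ∧ IsSep f n ε E ∧ v = (E.card : ℝ)} := by
  rintro v ⟨E, -, hE, rfl⟩
  exact hc E hE

theorem sepCount_le {K : Set X} {n : ℕ} {ε c : ℝ}
    (hc : ∀ E : Finset X, IsSep f n ε E → (E.card : ℝ) ≤ c) : sepCount f K n ε ≤ c :=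
  csSup_le ⟨_, ∅, by simp, by intro x hx; simp at hx, rfl⟩ (bddAbove_sepCount_set hc)

theorem card_le_sepCount {K : Set X} {n : ℕ} {ε c : ℝ}
    (hc : ∀ E : Finset X, IsSep f n ε E → (E.card : ℝ) ≤ c) {E : Finset X}
    (hEK : ∀ x ∈ E, x ∈ K) (hE : IsSep f n ε E) : (E.card : ℝ) ≤ sepCount f K n ε :=
  le_csSup ⟨c, bddAbove_sepCount_set hc⟩ ⟨E, hEK, hE, rfl⟩

theorem one_le_sepCount {K : Set X} {n : ℕ} {ε c : ℝ}
    (hc : ∀ E : Finset X, IsSep f n ε E → (E.card : ℝ) ≤ c) {y : X} (hy : y ∈ K) :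
    1 ≤ sepCount f K n ε := by
  have := card_le_sepCount (E := {y}) hc (K := K) (by simpa using hy) (by
    intro a ha b hb hab
    rw [Finset.mem_singleton] at ha hb
    exact absurd (ha.trans hb.symm) hab)
  simpa using this

/-- When separated sets grow at a rate bounded independently of the scale, small tail entropy
yields efficient finite covers of infinite Bowen balls. -/
theorem exists_cover_of_tailEnt_lt {c : ℝ}
    (hc : ∀ ε > 0, ∃ n₀, ∀ n ≥ n₀, ∀ E : Finset X, IsSep f n ε E →
      (E.card : ℝ) ≤ Real.exp (c * n))
    {ε₀ β δ ε : ℝ} (hε₀ : 0 < ε₀) (hβ : tailEnt f ε₀ < β) (hδ : δ < ε₀) (hε : 0 < ε) (y : X) :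
    ∃ m : ℕ, 1 ≤ m ∧ ∃ E : Finset X, (E.card : ℝ) ≤ Real.exp (β * m) ∧
      ∀ z, (∀ k, dist (f^[k] y) (f^[k] z) ≤ δ) → ∃ x ∈ E, z ∈ bowenBall f m ε x := by
  have hmem : ∀ y, y ∈ infBall f ε₀ y := fun y n => by simpa using hε₀
  have hev : ∀ y, ∀ ε > 0, ∀ᶠ n : ℕ in atTop,
      Real.log (sepCount f (infBall f ε₀ y) n ε) / n ≤ c ∧
        0 ≤ Real.log (sepCount f (infBall f ε₀ y) n ε) / n := by
    intro y ε hε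
    obtain ⟨n₀, hn₀⟩ := hc ε hε
    filter_upwards [eventually_ge_atTop n₀, eventually_gt_atTop 0] with n hn hn0
    have h1 := one_le_sepCount (hn₀ n hn) (hmem y)
    refine ⟨?_, div_nonneg (Real.log_nonneg h1) (Nat.cast_nonneg _)⟩
    rw [div_le_iff₀ (by exact_mod_cast hn0), Real.log_le_iff_le_exp (by linarith)]
    exact sepCount_le (hn₀ n hn)
  have hbdd : ∀ y, ∀ ε > 0, IsBoundedUnder (· ≤ ·) atTop
      (fun n : ℕ => Real.log (sepCount f (infBall f ε₀ y) n ε) / n) := fun y ε hε =>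
    ⟨c, eventually_map.2 ((hev y ε hε).mono fun _ h => h.1)⟩
  have hlim : ∀ y, ∀ ε : {e : ℝ // 0 < e}, limsup
      (fun n : ℕ => Real.log (sepCount f (infBall f ε₀ y) n ε) / n) atTop ≤ c := fun y ε =>
    limsup_le_of_le (IsBoundedUnder.isCoboundedUnder_le
      ⟨0, eventually_map.2 ((hev y ε ε.2).mono fun _ h => h.2)⟩) ((hev y ε ε.2).mono fun _ h => h.1)
  have hent : ∀ y, entSet f (infBall f ε₀ y) ≤ c := fun y => by
    have : Nonempty {e : ℝ // 0 < e} := ⟨⟨1, one_pos⟩⟩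
    exact ciSup_le (hlim y)
  have h1 : limsup (fun n : ℕ => Real.log (sepCount f (infBall f ε₀ y) n ε) / n) atTop < β := by
    refine lt_of_le_of_lt ?_ hβ
    refine le_trans ?_ (le_ciSup (f := fun y => entSet f (infBall f ε₀ y))
      ⟨c, by rintro _ ⟨y, rfl⟩; exact hent y⟩ y)
    exact le_ciSup (f := fun ε : {e : ℝ // 0 < e} => limsup
      (fun n : ℕ => Real.log (sepCount f (infBall f ε₀ y) n ε) / n) atTop)
      ⟨c, by rintro _ ⟨ε, rfl⟩; exact hlim y ε⟩ ⟨ε, hε⟩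
  obtain ⟨n₀, hn₀⟩ := hc ε hε
  obtain ⟨m, hm1, hm2, hm3⟩ := ((eventually_lt_of_limsup_lt h1 (hbdd y ε hε)).and
    ((eventually_ge_atTop 1).and (eventually_ge_atTop n₀))).exists
  obtain ⟨E, hEK, hEs, hE⟩ := exists_maximal_sep (f := f) (A := infBall f ε₀ y) (n := m) hε.le
    fun E _ hE => hn₀ m hm3 E hE
  refine ⟨m, hm2, E, ?_, fun z hz => hE z fun k => (hz k).trans_lt hδ⟩
  refine (card_le_sepCount (hn₀ m hm3) hEK hEs).trans ?_
  rw [div_lt_iff₀ (by exact_mod_cast hm2), Real.log_lt_iff_lt_exp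
    (by linarith [one_le_sepCount (hn₀ m hm3) (hmem y)])] at hm1
  exact hm1.le

end TailCover

theorem exists_subset_card_between {α : Type*} {E : Finset α} {h κ : ℝ} {g : ℕ} (hh : 0 ≤ h)
    (hE : Real.exp (h * g) ≤ E.card) (hg : Real.log 2 ≤ κ * g) :
    ∃ E' ⊆ E, Real.exp (h * g) ≤ E'.card ∧ (E'.card : ℝ) ≤ Real.exp ((h + κ) * g) := by
  obtain ⟨E', hE', hcard⟩ := Finset.exists_subset_card_eq (Nat.ceil_le.2 hE)
  refine ⟨E', hE', hcard ▸ Nat.le_ceil _, ?_⟩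
  rw [hcard]
  have h1 : (1 : ℝ) ≤ Real.exp (h * g) := Real.one_le_exp (by positivity)
  have h2 : (2 : ℝ) ≤ Real.exp (κ * g) := by
    rwa [← Real.log_le_iff_le_exp two_pos]
  calc ((⌈Real.exp (h * g)⌉₊ : ℕ) : ℝ) ≤ Real.exp (h * g) + 1 :=
        (Nat.ceil_lt_add_one (Real.exp_pos _).le).le
    _ ≤ Real.exp (h * g) * 2 := by linarith
    _ ≤ Real.exp (h * g) * Real.exp (κ * g) := by gcongr
    _ = Real.exp ((h + κ) * g) := by rw [← Real.exp_add]; ring_nf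

/-- Gluing a separated family of words of equal, large length yields a closed forward-invariant
set with controlled complexity and controlled Birkhoff averages. -/
theorem exists_glued_set {X : Type*} [MetricSpace X] [CompactSpace X] {f : X → X}
    (hf : Continuous f) {G : Set (X × ℕ)} (hG : GluingOrbit f G) {δ κ H b : ℝ} (hδ : 0 < δ)
    (hκ : 0 < κ) :
    ∃ g₀ : ℕ, ∀ g ≥ g₀, ∀ (E : Finset X) (σ h : ℝ), h ≤ H → (∀ x ∈ E, (x, g) ∈ G) → IsSep f g σ E →
      2 * δ ≤ σ → Real.exp (h * g) ≤ E.card → (E.card : ℝ) ≤ Real.exp ((h + κ) * g) →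
      ∃ Y : Set X, IsClosed Y ∧ Set.MapsTo f Y Y ∧
        (∃ A : ℝ, 0 < A ∧ ∀ N : ℕ, BCov f Y N (4 * δ) (A * Real.exp ((h + 2 * κ) * N))) ∧
        (∀ N₀ : ℕ, ∃ N ≥ N₀, ∃ S : Finset X, (∀ x ∈ S, x ∈ Y) ∧ IsSep f N (σ - 2 * δ) S ∧
          Real.exp ((h - κ) * N) ≤ S.card) ∧
        ∀ ψ : X → ℝ, Continuous ψ → (∀ x, |ψ x| ≤ b) →
          (∀ x y, dist x y ≤ δ → |ψ x - ψ y| ≤ κ) → ∀ a : ℝ, |a| ≤ b →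
          (∀ x ∈ E, birk f ψ x g ≤ a * g) →
          ∃ B : ℝ, ∀ N : ℕ, ∀ y ∈ Y, birk f ψ y N ≤ (a + 2 * κ) * N + B := by
  obtain ⟨N₀, τ, hτ, hgo⟩ := hG δ hδ
  obtain ⟨C, hC1, hC⟩ := exists_bcov_one (f := f) (by positivity : 0 < 3 * δ)
  have hτ1 : (1 : ℝ) ≤ τ := by exact_mod_cast hτ
  have hC0 : 0 < C := by linarith
  obtain ⟨g₁, hg₁⟩ := exists_nat_ge ((2 * b + κ) * τ / κ)
  obtain ⟨g₂, hg₂⟩ := exists_nat_ge (Real.log (τ * C ^ τ) / κ)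
  obtain ⟨g₃, hg₃⟩ := exists_nat_ge ((H * τ + Real.log τ) / κ)
  refine ⟨max (max N₀ 1) (max g₁ (max g₂ g₃)), fun g hg E σ h hhH hEG hEs hσ hE1 hE2 => ?_⟩
  simp only [ge_iff_le, max_le_iff] at hg
  obtain ⟨⟨hgN, hg1⟩, hga, hgb, hgc⟩ := hg
  have hg0 : (0 : ℝ) < g := by exact_mod_cast hg1
  have hga' : (2 * b + κ) * τ ≤ κ * g := by
    rw [div_le_iff₀ hκ] at hg₁
    have : (g₁ : ℝ) ≤ g := by exact_mod_cast hga
    nlinarith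
  have hgb' : Real.log (τ * C ^ τ) ≤ κ * g := by
    rw [div_le_iff₀ hκ] at hg₂
    have : (g₂ : ℝ) ≤ g := by exact_mod_cast hgb
    nlinarith
  have hgc' : h * τ + Real.log τ ≤ κ * g := by
    rw [div_le_iff₀ hκ] at hg₃
    have : (g₃ : ℝ) ≤ g := by exact_mod_cast hgc
    nlinarith
  have hcard : (0 : ℝ) < E.card := (Real.exp_pos _).trans_le hE1
  have hEne : E.Nonempty := Finset.card_pos.1 (by exact_mod_cast hcard)
  refine ⟨shadowHull f E g τ δ, isClosed_shadowHull, mapsTo_shadowHull hf, ?_, ?_, ?_⟩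
  · obtain ⟨A, hA, h1⟩ := exists_bcov_shadowHull (E := E) (n := g) (τ := τ) (δ := δ) hf
      (ε := 3 * δ) (ε' := 4 * δ) (by linarith) (by linarith) hC hC1 hg1 hτ hEne
    refine ⟨A, hA, fun N => (h1 N).mono_bound ?_⟩
    gcongr
    rw [div_le_iff₀ hg0, mul_assoc, Real.log_mul hcard.ne' (by positivity)]
    have : Real.log E.card ≤ (h + κ) * g := (Real.log_le_iff_le_exp hcard).2 hE2
    nlinarith
  · intro M
    obtain ⟨S, hS1, hS2, hS3⟩ := exists_sep_shadowHull hgo hgN hτ hEG hEs hEne hσ M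
    refine ⟨M * (g + τ), by nlinarith, S, hS1, hS2, le_trans ?_ hS3⟩
    rw [← div_pow]
    have h1 : Real.exp ((h - κ) * (g + τ)) ≤ E.card / τ := by
      rw [le_div_iff₀ (by linarith)]
      refine le_trans ?_ hE1
      calc Real.exp ((h - κ) * (g + τ)) * τ = Real.exp ((h - κ) * (g + τ) + Real.log τ) := by
            rw [Real.exp_add, Real.exp_log (by linarith)]
        _ ≤ _ := Real.exp_le_exp.2 (by nlinarith)
    calc Real.exp ((h - κ) * (M * (g + τ) : ℕ)) = Real.exp ((h - κ) * (g + τ)) ^ M := by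
          rw [← Real.exp_nat_mul]
          push_cast
          ring_nf
      _ ≤ _ := pow_le_pow_left₀ (Real.exp_pos _).le h1 _
  · intro ψ hψ hψb hψm a ha haE
    obtain ⟨B, hB⟩ := exists_birk_shadowHull_le (τ := τ) hf hψ hψb hψm hg1 haE
    have h1 : (b + |a + κ|) * τ / g ≤ κ := by
      rw [div_le_iff₀ hg0]
      refine le_trans (mul_le_mul_of_nonneg_right ?_ (by linarith)) hga'
      have := abs_add_le a κ
      rw [abs_of_pos hκ] at this
      linarith
    refine ⟨B, fun N y hy => (hB N y hy).trans ?_⟩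
    have h2 := mul_le_mul_of_nonneg_right h1 (Nat.cast_nonneg (α := ℝ) N)
    linarith

theorem eventually_le_exp_mul (A : ℝ) {κ : ℝ} (hκ : 0 < κ) :
    ∀ᶠ n : ℕ in atTop, A ≤ Real.exp (κ * n) :=
  (Real.tendsto_exp_atTop.comp
    (tendsto_natCast_atTop_atTop.const_mul_atTop hκ)).eventually_ge_atTop A

/-- Pigeonhole over the values of a weight: some sublevel slice carries almost all the mass. -/
theorem exists_subset_of_le_sum_exp {α : Type*} {E : Finset α} {Φ : α → ℝ} {b κ θ : ℝ} {g : ℕ}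
    (hκ : 0 < κ) (hg : 1 ≤ g) (hΦ : ∀ x ∈ E, |Φ x| ≤ b * g)
    (hK : 2 * b / κ + 2 ≤ Real.exp (κ * g)) (hE : Real.exp (θ * g) ≤ ∑ x ∈ E, Real.exp (Φ x)) :
    ∃ a : ℝ, |a| ≤ b ∧ ∃ E' ⊆ E, (∀ x ∈ E', a * g ≤ Φ x ∧ Φ x ≤ (a + κ) * g) ∧
      Real.exp ((θ - a - 2 * κ) * g) ≤ E'.card := by
  classical
  have hg0 : (0 : ℝ) < g := by exact_mod_cast hg
  have hEne : E.Nonempty := by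
    by_contra h
    rw [Finset.not_nonempty_iff_eq_empty] at h
    rw [h, Finset.sum_empty] at hE
    exact absurd hE (not_le.2 (Real.exp_pos _))
  obtain ⟨x₀, hx₀⟩ := hEne
  have hb0 : 0 ≤ b := nonneg_of_mul_nonneg_left ((abs_nonneg _).trans (hΦ x₀ hx₀)) hg0
  have hdiv : ∀ x ∈ E, -b ≤ Φ x / g ∧ Φ x / g ≤ b := fun x hx => by
    have := abs_le.1 (hΦ x hx)
    exact ⟨by rw [le_div_iff₀ hg0]; linarith, by rw [div_le_iff₀ hg0]; linarith⟩
  set bin : α → ℕ := fun x => ⌊(Φ x / g + b) / κ⌋₊ with hbin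
  set K : ℕ := ⌊2 * b / κ⌋₊ + 1 with hKdef
  have hmaps : ∀ x ∈ E, bin x ∈ Finset.range K := fun x hx => by
    rw [Finset.mem_range, hKdef, Nat.lt_succ_iff]
    refine Nat.floor_le_floor ?_
    gcongr
    linarith [(hdiv x hx).2]
  have hKle : (K : ℝ) ≤ 2 * b / κ + 1 := by
    rw [hKdef]
    push_cast
    linarith [Nat.floor_le (by positivity : 0 ≤ 2 * b / κ)]
  obtain ⟨i, hi, hsum⟩ : ∃ i ∈ Finset.range K, Real.exp ((θ - κ) * g) ≤
      ∑ x ∈ E with bin x = i, Real.exp (Φ x) := by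
    by_contra! hcon
    rw [← Finset.sum_fiberwise_of_maps_to hmaps] at hE
    have h1 := Finset.sum_le_sum fun i hi => (hcon i hi).le
    rw [Finset.sum_const, Finset.card_range, nsmul_eq_mul] at h1
    have h2 : Real.exp (θ * g) = Real.exp (κ * g) * Real.exp ((θ - κ) * g) := by
      rw [← Real.exp_add]
      ring_nf
    have h3 := hE.trans h1
    rw [h2, mul_le_mul_iff_left₀ (Real.exp_pos _)] at h3
    linarith
  have hmem : ∀ x ∈ E, bin x = i → (κ * i - b) * g ≤ Φ x ∧ Φ x ≤ (κ * i - b + κ) * g := by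
    intro x hx hxi
    have h0 : 0 ≤ (Φ x / g + b) / κ := div_nonneg (by linarith [(hdiv x hx).1]) hκ.le
    have h1 := Nat.floor_le h0
    have h2 := Nat.lt_floor_add_one ((Φ x / g + b) / κ)
    change (bin x : ℝ) ≤ _ at h1
    change _ < (bin x : ℝ) + 1 at h2
    rw [hxi, le_div_iff₀ hκ] at h1
    rw [hxi, div_lt_iff₀ hκ] at h2
    rw [← le_div_iff₀ hg0, ← div_le_iff₀ hg0]
    constructor <;> linarith
  have hne : (E.filter fun x => bin x = i).Nonempty := by
    by_contra h
    rw [Finset.not_nonempty_iff_eq_empty] at h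
    rw [h, Finset.sum_empty] at hsum
    exact absurd hsum (not_le.2 (Real.exp_pos _))
  refine ⟨κ * i - b, ?_, E.filter fun x => bin x = i, Finset.filter_subset _ _, ?_, ?_⟩
  · obtain ⟨x, hx⟩ := hne
    rw [Finset.mem_filter] at hx
    have h1 := (hmem x hx.1 hx.2).1
    rw [← le_div_iff₀ hg0] at h1
    rw [abs_le]
    have : 0 ≤ κ * i := by positivity
    constructor <;> linarith [(hdiv x hx.1).2]
  · intro x hx
    rw [Finset.mem_filter] at hx
    exact hmem x hx.1 hx.2
  · have h1 : ∑ x ∈ E with bin x = i, Real.exp (Φ x) ≤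
        (E.filter fun x => bin x = i).card * Real.exp ((κ * i - b + κ) * g) := by
      rw [← nsmul_eq_mul]
      refine Finset.sum_le_card_nsmul _ _ _ fun x hx => ?_
      rw [Finset.mem_filter] at hx
      exact Real.exp_le_exp.2 (hmem x hx.1 hx.2).2
    have h2 := hsum.trans h1
    rw [← div_le_iff₀ (Real.exp_pos _), ← Real.exp_sub] at h2
    refine le_trans (le_of_eq ?_) h2
    ring_nf

section Finite

variable {X : Type*} [MetricSpace X] [CompactSpace X] {f : X → X} {φ : X → ℝ}

theorem exists_card_le_of_pres_le (hφ : Continuous φ) {b H : ℝ} (hb : ∀ x, |φ x| ≤ b)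
    (hH : ∀ δ > 0, Pres f φ Set.univ δ 0 ≤ H) {ε : ℝ} (hε : 0 < ε) :
    ∃ n₀, ∀ n ≥ n₀, ∀ E : Finset X, IsSep f n ε E →
      (E.card : ℝ) ≤ Real.exp ((H + 2 + b) * n) := by
  obtain ⟨A, hA⟩ := exists_sum_le_of_pres_lt (q := H + 1) hφ hε ((hH ε hε).trans_lt (by linarith))
  obtain ⟨n₀, hn₀⟩ := eventually_atTop.1 (eventually_le_exp_mul A one_pos)
  refine ⟨n₀, fun n hn E hE => ?_⟩
  have h1 : (E.card : ℝ) * Real.exp (-(b * n)) ≤ ∑ x ∈ E, Real.exp (birk f φ x n) := by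
    rw [← nsmul_eq_mul]
    refine Finset.card_nsmul_le_sum _ _ _ fun x _ => Real.exp_le_exp.2 ?_
    exact neg_le_of_abs_le (abs_birk_le hb x n)
  have h2 := h1.trans (hA n E (fun _ _ => Set.mem_univ _) hE)
  rw [Real.exp_neg, ← div_eq_mul_inv, div_le_iff₀ (Real.exp_pos _)] at h2
  refine h2.trans ?_
  calc A * Real.exp ((H + 1) * n) * Real.exp (b * n)
      ≤ Real.exp (1 * n) * Real.exp ((H + 1) * n) * Real.exp (b * n) := by
        gcongr
        exact hn₀ n hn
    _ = Real.exp ((H + 2 + b) * n) := by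
        rw [← Real.exp_add, ← Real.exp_add]
        ring_nf

open MeasureTheory

variable [MeasurableSpace X] [BorelSpace X]

theorem integral_le_of_birk_le_add (hf : Continuous f) {Y : Set X} {μ : ProbabilityMeasure X}
    (hμ : μ ∈ invMeas f Y) {ψ : X → ℝ} (hψ : Continuous ψ) {a B : ℝ}
    (h : ∀ N : ℕ, ∀ y ∈ Y, birk f ψ y N ≤ a * N + B) : ∫ y, ψ y ∂(μ : Measure X) ≤ a := by
  refine le_of_forall_pos_le_add fun κ hκ => ?_
  obtain ⟨n, hn⟩ := exists_nat_ge (B / κ)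
  refine integral_le_of_birk_le (n := n + 1) hf hμ hψ (by omega) fun y hy =>
    (h (n + 1) y hy).trans ?_
  rw [div_le_iff₀ hκ] at hn
  push_cast
  nlinarith

theorem katokRate_le_of_bcov {Y : Set X} {μ : ProbabilityMeasure X} (hμ : (μ : Measure X) Yᶜ = 0)
    {ε A a : ℝ} (hε : 0 < ε) (h : ∀ N : ℕ, BCov f Y N ε (A * Real.exp (a * N))) :
    katokRate f (μ : Measure X) ε ≤ a := by
  refine le_of_forall_pos_le_add fun κ hκ => katokRate_le_of_eventually hε ?_
  filter_upwards [eventually_le_exp_mul A hκ] with n hn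
  refine (katokCount_le_of_bcov (h n) ?_).trans ?_
  · have h1 := measure_union_le (μ := (μ : Measure X)) Y Yᶜ
    rw [Set.union_compl_self, measure_univ, hμ, add_zero] at h1
    refine lt_of_lt_of_le ?_ h1
    exact ENNReal.half_lt_self one_ne_zero ENNReal.one_ne_top
  · calc A * Real.exp (a * n) ≤ Real.exp (κ * n) * Real.exp (a * n) := by gcongr
      _ = _ := by rw [← Real.exp_add]; ring_nf

end Finite

open MeasureTheory in
theorem exists_ergodic_pmu_near {X : Type*} [MetricSpace X] [CompactSpace X] [MeasurableSpace X]
    [BorelSpace X] [Nonempty X] {f : X → X} (hf : Continuous f) {φ : X → ℝ} (hφ : Continuous φ)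
    (haee : Tendsto (fun ε => tailEnt f ε) (𝓝[>] 0) (𝓝 0))
    {D Pc Gc Sc : Set (X × ℕ)} {p g s : X × ℕ → ℕ}
    (hdecomp : ∀ c ∈ D, p c + g c + s c = c.2 ∧ (c.1, p c) ∈ Pc ∧
      (f^[p c] c.1, g c) ∈ Gc ∧ (f^[p c + g c] c.1, s c) ∈ Sc)
    (hGO : GluingOrbit f Gc)
    (hbdd : BddAbove (Set.range fun δ : {d : ℝ // 0 < d} => Pres f φ Set.univ (δ : ℝ) 0))
    {α κ : ℝ} (hα : α ∈ Set.Icc (Pstar f φ) (PresTop f φ)) (hκ : 0 < κ)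
    (hgap : PresFull f φ (Dᶜ ∪ Pc ∪ Sc) + 4 * κ < PresTop f φ) :
    ∃ μ : Measure X, IsProbabilityMeasure μ ∧ Ergodic f μ ∧ |Pmu f φ μ - α| ≤ 12 * κ := by
  set P := PresTop f φ with hP
  obtain ⟨b, hb0, hb⟩ := exists_abs_le hφ
  have hH : ∀ δ > 0, Pres f φ Set.univ δ 0 ≤ P := fun δ hδ => le_ciSup hbdd ⟨δ, hδ⟩
  have hCle : ∀ δ > 0, Pres f φ (Dᶜ ∪ Pc ∪ Sc) δ 0 ≤ PresFull f φ (Dᶜ ∪ Pc ∪ Sc) := fun δ hδ =>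
    le_ciSup (f := fun δ : {d : ℝ // 0 < d} => Pres f φ (Dᶜ ∪ Pc ∪ Sc) (δ : ℝ) 0)
      ⟨max P 0, by
        rintro _ ⟨δ, rfl⟩
        exact (pres_le_max_univ hφ δ.2).trans (max_le_max (hH δ δ.2) le_rfl)⟩ ⟨δ, hδ⟩
  obtain ⟨ε₀, hε₀, hε₀pos⟩ : ∃ ε₀, tailEnt f ε₀ < κ ∧ 0 < ε₀ :=
    ((haee.eventually_lt_const hκ).and eventually_mem_nhdsWithin).exists
  obtain ⟨⟨σ₀, hσ₀⟩, hσP⟩ : ∃ σ₀ : {d : ℝ // 0 < d}, P - κ < Pres f φ Set.univ (σ₀ : ℝ) 0 := by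
    have : Nonempty {d : ℝ // 0 < d} := ⟨⟨1, one_pos⟩⟩
    exact exists_lt_of_lt_ciSup (by linarith : P - κ < PresTop f φ)
  obtain ⟨δφ, hδφ, hmod⟩ := exists_abs_sub_le hφ hκ
  set σ := min σ₀ δφ with hσ
  have hσpos : 0 < σ := lt_min hσ₀ hδφ
  set δ := min σ ε₀ / 8 with hδ
  have hδpos : 0 < δ := by positivity
  have hδσ : 8 * δ ≤ σ := by rw [hδ]; linarith [min_le_left σ ε₀]
  have hδε : 8 * δ ≤ ε₀ := by rw [hδ]; linarith [min_le_right σ ε₀]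
  have hσφ : σ ≤ δφ := min_le_right _ _
  obtain ⟨A, hA⟩ := exists_sum_le_of_pres_lt (q := PresFull f φ (Dᶜ ∪ Pc ∪ Sc) + κ) hφ
    (half_pos hσpos) ((hCle _ (half_pos hσpos)).trans_lt (by linarith))
  obtain ⟨g₁, hg₁⟩ := exists_glued_set (H := |α| + b) (b := b + κ) hf hGO hδpos hκ
  obtain ⟨g₂, hg₂⟩ := exists_birk_le_pstar (f := f) hφ hκ
  obtain ⟨g₃, hg₃⟩ := eventually_atTop.1 (eventually_le_exp_mul (2 * b / κ + 2) hκ)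
  obtain ⟨g₄, hg₄⟩ := eventually_atTop.1 (eventually_le_exp_mul 2 hκ)
  obtain ⟨n, hn, E, hEG, hEs, hEsum⟩ := exists_sep_core (Y := Set.univ) (θ := P - κ)
    (θ' := P - 2 * κ) hdecomp (Set.mapsTo_univ _ _) hσpos hκ.le hb
    (fun x y hxy => hmod x y (by linarith)) hA
    (fun N₀ => by
      obtain ⟨N, hN, S, hS, hsum⟩ := exists_sep_of_lt_pres hφ hσ₀ hσP N₀
      exact ⟨N, hN, S, fun _ _ => Set.mem_univ _, hS.mono_scale (min_le_left _ _), hsum⟩)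
    (by linarith) (by linarith) (max (max g₁ g₂) (max (max g₃ g₄) 1))
  simp only [ge_iff_le, max_le_iff] at hn
  obtain ⟨⟨hn1, hn2⟩, ⟨hn3, hn4⟩, hn5⟩ := hn
  have hn0 : (0 : ℝ) < n := by exact_mod_cast hn5
  obtain ⟨a, hab, E', hE'E, hE'Φ, hE'c⟩ := exists_subset_of_le_sum_exp hκ hn5
    (fun x _ => abs_birk_le hb x n) (hg₃ n hn3) hEsum
  have hE'ne : E'.Nonempty :=
    Finset.card_pos.1 (by exact_mod_cast (Real.exp_pos _).trans_le hE'c)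
  have haα : a ≤ α + κ := by
    obtain ⟨x, hx⟩ := hE'ne
    have h1 := (hE'Φ x hx).1.trans (hg₂ n hn2 x)
    have h2 := le_of_mul_le_mul_right h1 hn0
    linarith [hα.1]
  set h := max 0 (α - a - 4 * κ) with hh
  have hh0 : 0 ≤ h := le_max_left _ _
  have hh1 : α - a - 4 * κ ≤ h := le_max_right _ _
  have hh2 : h ≤ α - a + κ := max_le (by linarith) (by linarith)
  have hh3 : h ≤ |α| + b := by
    refine max_le (by positivity) ?_
    linarith [le_abs_self α, neg_le_of_abs_le hab]
  have hcard : Real.exp (h * n) ≤ E'.card := by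
    rcases max_choice 0 (α - a - 4 * κ) with h1 | h1
    · rw [hh, h1, zero_mul, Real.exp_zero]
      exact_mod_cast hE'ne.card_pos
    · refine le_trans (Real.exp_le_exp.2 ?_) hE'c
      rw [hh, h1]
      refine mul_le_mul_of_nonneg_right ?_ hn0.le
      linarith [hα.2]
  obtain ⟨F, hFE, hF1, hF2⟩ := exists_subset_card_between (κ := κ) hh0 hcard
    ((Real.log_le_iff_le_exp two_pos).2 (hg₄ n hn4))
  obtain ⟨Y, hYc, hYm, ⟨A₁, hA₁, hcov⟩, hsep, havg⟩ := hg₁ n hn1 F σ h hh3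
    (fun x hx => (hEG x (hE'E (hFE hx))).2) (hEs.subset (hFE.trans hE'E)) (by linarith) hF1 hF2
  have hmodδ : ∀ x y, dist x y ≤ δ → |φ x - φ y| ≤ κ := fun x y hxy => hmod x y (by linarith)
  obtain ⟨B₁, hB₁⟩ := havg φ hφ (fun x => (hb x).trans (by linarith)) hmodδ (a + κ)
    ((abs_add_le _ _).trans (by rw [abs_of_pos hκ]; linarith)) fun x hx => (hE'Φ x (hFE hx)).2
  obtain ⟨B₂, hB₂⟩ := havg (fun x => -φ x) hφ.neg
    (fun x => by rw [abs_neg]; exact (hb x).trans (by linarith))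
    (fun x y hxy => by rw [neg_sub_neg, abs_sub_comm]; exact hmodδ x y hxy) (-a)
    (by rw [abs_neg]; linarith) fun x hx => by
      have := (hE'Φ x (hFE hx)).1
      simp only [birk, Finset.sum_neg_distrib] at this ⊢
      linarith
  obtain ⟨μ, hμ, hμe, hμh⟩ := exists_ergodic_of_not_bcov (h := h - 3 * κ) (ε := σ / 2) (η := κ) hf
    (half_pos hσpos) hκ hYc hYm fun N₀ => by
      obtain ⟨N, hN, S, hSY, hSs, hSc⟩ := hsep (max N₀ 1)
      refine ⟨N, (le_max_left _ _).trans hN, fun hcon => ?_⟩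
      have h1 := hcon.card_le hSY (hSs.mono_scale (by linarith))
      have h2 := Real.exp_le_exp.1 (hSc.trans h1)
      have h3 : (1 : ℝ) ≤ N := by exact_mod_cast (le_max_right _ _).trans hN
      nlinarith
  have hup : ∀ e : ℝ, 0 < e → katokRate f (μ : Measure X) e ≤ h + 3 * κ := by
    intro e he
    obtain ⟨A₂, hA₂, hcov₂⟩ := exists_bcov_bowenBall (δ := 4 * δ) (β := κ) hf hκ.le he fun y =>
      exists_cover_of_tailEnt_lt (fun ε hε => exists_card_le_of_pres_le hφ hb hH hε) hε₀pos hε₀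
        (by linarith) (by positivity) y
    refine katokRate_le_of_bcov (A := A₁ * A₂) hμ.2 he fun N => ?_
    refine ((hcov N).refine subset_rfl (by positivity) fun x _ => hcov₂ N x).mono_bound (le_of_eq ?_)
    rw [mul_mul_mul_comm, ← Real.exp_add]
    ring_nf
  have h1 := metEnt_le hup
  have h2 := hμh.trans (le_metEnt (by positivity : 0 < σ / 2 / 2) hup)
  have h3 := integral_le_of_birk_le_add hf hμ hφ hB₁
  have h4 := integral_le_of_birk_le_add (ψ := fun x => -φ x) hf hμ hφ.neg hB₂
  rw [integral_neg] at h4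
  refine ⟨μ, inferInstance, hμe, ?_⟩
  rw [Pmu, abs_le]
  constructor <;> linarith

theorem BCov.exists_isOpen {X : Type*} [MetricSpace X] {f : X → X} (hf : Continuous f) {Y : Set X}
    {n : ℕ} {δ c : ℝ} (h : BCov f Y n δ c) :
    ∃ V : Set X, IsOpen V ∧ Y ⊆ V ∧ BCov f V n (2 * δ) c := by
  classical
  obtain ⟨P, h1, h2, h3⟩ := h
  set U : Set X → Set X := fun s =>
    if hs : s.Nonempty then {y | ∀ k < n, dist (f^[k] hs.some) (f^[k] y) < δ} else ∅ with hU
  refine ⟨⋃ s ∈ P, U s, isOpen_biUnion fun s _ => ?_, fun y hy => ?_, P.image U, ?_, ?_, ?_⟩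
  · rw [hU]
    dsimp only
    split_ifs with hs
    · exact isOpen_openBowen hf n δ _
    · exact isOpen_empty
  · obtain ⟨s, hs, hys⟩ := h1 y hy
    have hne : s.Nonempty := ⟨y, hys⟩
    refine Set.mem_biUnion hs ?_
    rw [hU]
    dsimp only
    rw [dif_pos hne]
    exact fun k hk => h2 s hs _ hne.some_mem y hys k hk
  · intro y hy
    obtain ⟨s, hs, hys⟩ := Set.mem_iUnion₂.1 hy
    exact ⟨_, Finset.mem_image_of_mem _ hs, hys⟩
  · intro s hs y hy z hz k hk
    obtain ⟨s, -, rfl⟩ := Finset.mem_image.1 hs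
    rw [hU] at hy hz
    dsimp only at hy hz
    split_ifs at hy hz with hne
    · have := dist_triangle_left (f^[k] y) (f^[k] z) (f^[k] hne.some)
      linarith [hy k hk, hz k hk]
    · exact absurd hy (Set.notMem_empty _)
  · exact le_trans (by exact_mod_cast Finset.card_image_le) h3

section Penalty

open MeasureTheory

variable {X : Type*} [MetricSpace X] [CompactSpace X] [MeasurableSpace X] [BorelSpace X]
  {f : X → X}

/-- A nonnegative continuous function vanishing on a set of small covering growth, such that
invariant measures with small integral have controlled entropy at the given scale. -/
theorem exists_penalty (hf : Continuous f) {Y : Set X} (hYc : IsClosed Y) {δ ε h A : ℝ}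
    (hδ : 0 < δ) (hδε : 2 * δ ≤ ε) (hh : 0 ≤ h)
    (hcov : ∀ N : ℕ, BCov f Y N δ (A * Real.exp (h * N))) :
    ∃ g : C(X, NNReal), (∀ y ∈ Y, g y = 0) ∧ ∀ μ : ProbabilityMeasure X,
      MeasurePreserving f (μ : Measure X) μ → ∫⁻ x, g x ∂(μ : Measure X) ≤ 1 →
      ∀ e ≥ ε, katokRate f (μ : Measure X) e ≤ h + 4 := by
  have hε : 0 < ε := by linarith
  obtain ⟨C, hC1, hC⟩ := exists_bcov_one (f := f) hε
  obtain ⟨L, hL, hL1⟩ := ((eventually_le_exp_mul A one_pos).and (eventually_ge_atTop 1)).exists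
  have hL1' : (1 : ℝ) ≤ L := by exact_mod_cast hL1
  obtain ⟨V, hVo, hYV, hVcov⟩ := (hcov L).exists_isOpen hf
  have hK0 : 0 ≤ Real.log (2 * C) := Real.log_nonneg (by linarith)
  set ρ : ℝ := 1 / (Real.log (2 * C) + 1) with hρ
  have hρ0 : 0 < ρ := by positivity
  obtain ⟨L₀, hL₀⟩ := bcov_badCount_le_freq (f := f) (J := {()}) (R := fun _ => V) (ℓ := fun _ => L)
    (V := V) (h := h + 1) (η := 1) (ε := ε) (C := C) (K := 2 * C) (ρ := ρ) (κ := 1)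
    (fun _ _ => hL1)
    (fun _ _ => (hVcov.mono le_rfl le_rfl hδε le_rfl).mono_bound (by
      calc A * Real.exp (h * L) ≤ Real.exp (1 * L) * Real.exp (h * L) := by gcongr
        _ = _ := by rw [← Real.exp_add]; ring_nf))
    (by
      rw [Finset.sum_singleton]
      have h1 : Real.exp (-(1 * L)) ≤ Real.exp (-1) := Real.exp_le_exp.2 (by linarith)
      linarith [Real.exp_neg_one_lt_half])
    (fun x hx => Set.mem_biUnion (Finset.mem_coe.2 (Finset.mem_singleton_self ())) hx) hC hC1
    (le_mul_of_one_le_right (by linarith) (Real.one_le_exp (by linarith))) (by linarith) one_pos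
    hρ0.le (by rw [hρ, div_mul_eq_mul_div, one_mul, div_le_one (by linarith)]; linarith)
  obtain ⟨u, hu0, hu1, hu⟩ := exists_continuous_zero_one_of_isClosed hYc hVo.isClosed_compl
    (Set.disjoint_compl_right_iff_subset.2 hYV)
  refine ⟨⟨fun x => Real.toNNReal (3 / ρ * u x), by fun_prop⟩, fun y hy => ?_, ?_⟩
  · have := hu0 hy
    simp only [Pi.zero_apply] at this
    simp [this]
  intro μ hμ hintegral e he
  have hVc : (μ : Measure X) Vᶜ ≤ ENNReal.ofReal (ρ / 3) := by
    have h1 : ENNReal.ofReal (3 / ρ) * (μ : Measure X) Vᶜ ≤ 1 := by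
      refine le_trans ?_ hintegral
      rw [← setLIntegral_const]
      refine (setLIntegral_mono' hVo.isClosed_compl.measurableSet fun x hx => ?_).trans
        (setLIntegral_le_lintegral _ _)
      have := hu1 hx
      simp only [Pi.one_apply] at this
      simp only [ContinuousMap.coe_mk, this, mul_one]
      exact le_rfl
    rw [mul_comm] at h1
    have h2 := ENNReal.le_div_iff_mul_le (Or.inl (by simpa using hρ0)) (Or.inl ENNReal.ofReal_ne_top)
      |>.2 h1
    refine h2.trans (le_of_eq ?_)
    rw [one_div, ← ENNReal.ofReal_inv_of_pos (by positivity), inv_div]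
  have hbad : ∀ n : ℕ, n ≠ 0 → (1 / 2 : ENNReal) <
      (μ : Measure X) {y | (badCount f V y n : ℝ) ≤ ρ * n} := by
    intro n hn
    have h1 := measure_badCount_gt_le hf hμ hVo.measurableSet hn hρ0
    have h2 : (μ : Measure X) Vᶜ / ENNReal.ofReal ρ ≤ ENNReal.ofReal (1 / 3) := by
      refine (ENNReal.div_le_div_right hVc _).trans (le_of_eq ?_)
      rw [← ENNReal.ofReal_div_of_pos hρ0]
      congr 1
      field_simp
    have h3 := measure_union_le (μ := (μ : Measure X)) {y | (badCount f V y n : ℝ) ≤ ρ * n}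
      {y | ¬ (badCount f V y n : ℝ) ≤ ρ * n}
    have h4 : {y | (badCount f V y n : ℝ) ≤ ρ * n} ∪ {y | ¬ (badCount f V y n : ℝ) ≤ ρ * n} =
        Set.univ := Set.union_compl_self _
    rw [h4, measure_univ] at h3
    by_contra hcon
    rw [not_lt] at hcon
    have h5 := h3.trans (add_le_add hcon (h1.trans h2))
    have h6 : (1 / 2 : ENNReal) = ENNReal.ofReal (1 / 2) := by
      rw [ENNReal.ofReal_div_of_pos two_pos]
      simp
    rw [h6, ← ENNReal.ofReal_add (by norm_num) (by norm_num), ENNReal.one_le_ofReal] at h5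
    norm_num at h5
  refine katokRate_le_of_eventually (hε.trans_le he) ?_
  filter_upwards [eventually_ge_atTop L₀, eventually_ne_atTop 0] with n hn hn0
  refine (katokCount_le_of_bcov ((hL₀ n hn).mono le_rfl le_rfl he le_rfl) (hbad n hn0)).trans
    (le_of_eq ?_)
  ring_nf

end Penalty

/-- A closed forward-invariant set with separated sets growing at rate `h` at scale `σ`, along
which a nonnegative continuous function has averages at most `s`. -/
structure IsStage {X : Type*} [MetricSpace X] (f : X → X) (Y : Set X) (Ψ : C(X, NNReal))
    (h σ s : ℝ) : Prop where
  isClosed : IsClosed Y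
  mapsTo : Set.MapsTo f Y Y
  sep : ∀ N₀ : ℕ, ∃ N ≥ N₀, ∃ S : Finset X, (∀ x ∈ S, x ∈ Y) ∧ IsSep f N σ S ∧
    Real.exp (h * N) ≤ S.card
  avg : ∃ B : ℝ, ∀ N : ℕ, ∀ y ∈ Y, birk f (fun x => (Ψ x : ℝ)) y N ≤ s * N + B

section Stage

open MeasureTheory

variable {X : Type*} [MetricSpace X] [CompactSpace X] [MeasurableSpace X] [BorelSpace X]
  {f : X → X}

theorem IsStage.exists_step (hf : Continuous f) {D Pc Gc Sc : Set (X × ℕ)} {p g s : X × ℕ → ℕ}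
    (hdecomp : ∀ c ∈ D, p c + g c + s c = c.2 ∧ (c.1, p c) ∈ Pc ∧
      (f^[p c] c.1, g c) ∈ Gc ∧ (f^[p c + g c] c.1, s c) ∈ Sc)
    (hGO : GluingOrbit f Gc) {q : ℝ}
    (hq : ∀ σ > 0, ∃ A : ℝ, ∀ n, ∀ E : Finset X, (∀ x ∈ E, (x, n) ∈ Dᶜ ∪ Pc ∪ Sc) →
      IsSep f n σ E → (E.card : ℝ) ≤ A * Real.exp (q * n))
    {Y : Set X} {Ψ : C(X, NNReal)} {h σ t ω ε : ℝ} (hst : IsStage f Y Ψ h σ t) (hqh : q < h)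
    (hh : 1 ≤ h) (hω : 0 < ω) (hωσ : ω < σ) (hε : 0 < ε) :
    ∃ (Y' : Set X) (Ψ' : C(X, NNReal)), IsStage f Y' Ψ' (h - ω) (σ - ω) (t + ω) ∧ Ψ ≤ Ψ' ∧
      ∀ μ : ProbabilityMeasure X, MeasurePreserving f (μ : Measure X) μ →
        ∫⁻ x, Ψ' x ∂(μ : Measure X) ≤ 1 → ∀ e ≥ ε, katokRate f (μ : Measure X) e ≤ h + 5 := by
  have hΨ : Continuous fun x => (Ψ x : ℝ) := NNReal.continuous_coe.comp Ψ.continuous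
  obtain ⟨b, hb0, hb⟩ := exists_abs_le hΨ
  set κ := min ω 1 / 4 with hκdef
  have hκ : 0 < κ := by positivity
  have hκω : 4 * κ ≤ ω := by rw [hκdef]; linarith [min_le_left ω 1]
  have hκ1 : 4 * κ ≤ 1 := by rw [hκdef]; linarith [min_le_right ω 1]
  obtain ⟨δΨ, hδΨ, hmod⟩ := exists_abs_sub_le hΨ hκ
  set δ := min (min (ω / 2) (ε / 8)) δΨ with hδdef
  have hδ : 0 < δ := by positivity
  have hδω : δ ≤ ω / 2 := (min_le_left _ _).trans (min_le_left _ _)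
  have hδε : δ ≤ ε / 8 := (min_le_left _ _).trans (min_le_right _ _)
  have hδm : δ ≤ δΨ := min_le_right _ _
  obtain ⟨B, hB⟩ := hst.avg
  obtain ⟨A, hA⟩ := hq (σ / 2) (by linarith)
  obtain ⟨g₁, hg₁⟩ := exists_glued_set (H := h) (b := b + |t| + 1) hf hGO hδ hκ
  obtain ⟨g₂, hg₂⟩ := exists_nat_ge (B / κ)
  obtain ⟨g₃, hg₃⟩ := eventually_atTop.1 (eventually_le_exp_mul 2 hκ)
  have hz : ∀ (n : ℕ) (E : Finset X),
      ∑ x ∈ E, Real.exp (birk f (fun _ => (0 : ℝ)) x n) = E.card := fun n E => by simp [birk]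
  obtain ⟨n, hn, E, hEG, hEs, hEc⟩ := exists_sep_core (φ := fun _ => (0 : ℝ)) (b := 0) (η := 0)
    (θ := h) (θ' := h - κ) hdecomp hst.mapsTo (by linarith : 0 < σ) le_rfl (by simp) (by simp)
    (fun n E hE hEs => by rw [hz]; exact hA n E hE hEs)
    (fun N₀ => by
      obtain ⟨N, hN, S, hSY, hSs, hSc⟩ := hst.sep N₀
      exact ⟨N, hN, S, hSY, hSs, by rw [hz]; exact hSc⟩)
    (by linarith) (by linarith) (max g₁ (max g₂ g₃))
  simp only [ge_iff_le, max_le_iff] at hn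
  obtain ⟨hn1, hn2, hn3⟩ := hn
  rw [hz] at hEc
  obtain ⟨F, hFE, hF1, hF2⟩ := exists_subset_card_between (κ := κ) (by linarith : 0 ≤ h - κ) hEc
    ((Real.log_le_iff_le_exp two_pos).2 (hg₃ n hn3))
  obtain ⟨Y', hYc, hYm, ⟨A₁, hA₁, hcov⟩, hsep, havg⟩ := hg₁ n hn1 F σ (h - κ) (by linarith)
    (fun x hx => (hEG x (hFE hx)).2) (hEs.subset hFE) (by linarith) hF1 hF2
  obtain ⟨B', hB'⟩ := havg (fun x => (Ψ x : ℝ)) hΨ (fun x => (hb x).trans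
    (by linarith [abs_nonneg t])) (fun x y hxy => hmod x y (hxy.trans hδm)) (t + κ)
    ((abs_add_le _ _).trans (by rw [abs_of_pos hκ]; linarith)) (fun x hx => by
      refine (hB n x (hEG x (hFE hx)).1).trans ?_
      rw [div_le_iff₀ hκ] at hg₂
      have : (g₂ : ℝ) ≤ n := by exact_mod_cast hn2
      nlinarith)
  obtain ⟨G, hG0, hG⟩ := exists_penalty (ε := ε) hf hYc (by positivity : 0 < 4 * δ) (by linarith)
    (by linarith) hcov
  refine ⟨Y', Ψ + G, ⟨hYc, hYm, fun N₀ => ?_, B', fun N y hy => ?_⟩, ?_, ?_⟩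
  · obtain ⟨N, hN, S, hSY, hSs, hSc⟩ := hsep N₀
    refine ⟨N, hN, S, hSY, hSs.mono_scale (by linarith), le_trans ?_ hSc⟩
    exact Real.exp_le_exp.2 (mul_le_mul_of_nonneg_right (by linarith) (Nat.cast_nonneg _))
  · have h1 : birk f (fun x => ((Ψ + G) x : ℝ)) y N = birk f (fun x => (Ψ x : ℝ)) y N := by
      refine Finset.sum_congr rfl fun k _ => ?_
      simp [hG0 _ ((hYm.iterate k) hy)]
    rw [h1]
    refine (hB' N y hy).trans ?_
    exact add_le_add (mul_le_mul_of_nonneg_right (by linarith) (Nat.cast_nonneg _)) le_rfl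
  · intro x
    simp
  · intro μ hμ hintegral e he
    refine (hG μ hμ (le_trans (lintegral_mono fun x => ?_) hintegral) e he).trans (by linarith)
    simp

end Stage

section InfiniteEntropy

open MeasureTheory

variable {X : Type*} [MetricSpace X] [CompactSpace X] [MeasurableSpace X] [BorelSpace X]
  {f : X → X}

theorem IsStage.exists_seq (hf : Continuous f) {D Pc Gc Sc : Set (X × ℕ)} {p g s : X × ℕ → ℕ}
    (hdecomp : ∀ c ∈ D, p c + g c + s c = c.2 ∧ (c.1, p c) ∈ Pc ∧
      (f^[p c] c.1, g c) ∈ Gc ∧ (f^[p c + g c] c.1, s c) ∈ Sc)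
    (hGO : GluingOrbit f Gc) {q : ℝ}
    (hq : ∀ σ > 0, ∃ A : ℝ, ∀ n, ∀ E : Finset X, (∀ x ∈ E, (x, n) ∈ Dᶜ ∪ Pc ∪ Sc) →
      IsSep f n σ E → (E.card : ℝ) ≤ A * Real.exp (q * n))
    {Y₀ : Set X} {Ψ₀ : C(X, NNReal)} {h σ t c : ℝ} (hst : IsStage f Y₀ Ψ₀ h σ t) (hc : 0 < c)
    (hqh : q + c ≤ h) (hh : 1 + c ≤ h) (hcσ : c ≤ σ) :
    ∃ (Y : ℕ → Set X) (Ψ : ℕ → C(X, NNReal)), Monotone Ψ ∧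
      (∀ k, ∃ u ≤ c, IsStage f (Y k) (Ψ k) (h - u) (σ - u) (t + u)) ∧
      ∀ k, ∀ μ : ProbabilityMeasure X, MeasurePreserving f (μ : Measure X) μ →
        ∫⁻ x, Ψ (k + 1) x ∂(μ : Measure X) ≤ 1 →
          ∀ e : ℝ, 1 / ((k : ℝ) + 1) ≤ e → katokRate f (μ : Measure X) e ≤ h + 5 := by
  set u : ℕ → ℝ := fun k => c * (1 - (1 / 2 : ℝ) ^ k) with hu
  have hu0 : ∀ k, 0 ≤ u k := fun k =>
    mul_nonneg hc.le (sub_nonneg.2 (pow_le_one₀ (by norm_num) (by norm_num)))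
  have huc : ∀ k, u k < c := fun k => by
    have : 0 < c * (1 / 2 : ℝ) ^ k := by positivity
    simp only [hu]; linarith
  have hus : ∀ k, u (k + 1) = u k + c * (1 / 2) ^ (k + 1) := fun k => by
    simp only [hu, pow_succ]; ring
  have hstep : ∀ (k : ℕ) (y : Set X × C(X, NNReal)),
      IsStage f y.1 y.2 (h - u k) (σ - u k) (t + u k) → ∃ y' : Set X × C(X, NNReal),
        IsStage f y'.1 y'.2 (h - u (k + 1)) (σ - u (k + 1)) (t + u (k + 1)) ∧ y.2 ≤ y'.2 ∧
        ∀ μ : ProbabilityMeasure X, MeasurePreserving f (μ : Measure X) μ →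
          ∫⁻ x, y'.2 x ∂(μ : Measure X) ≤ 1 →
            ∀ e : ℝ, 1 / ((k : ℝ) + 1) ≤ e → katokRate f (μ : Measure X) e ≤ h + 5 := by
    intro k y hy
    have h1 := huc k
    have h2 := huc (k + 1)
    have h3 := hus k
    obtain ⟨Y', Ψ', h4, h5, h6⟩ := hy.exists_step (ω := c * (1 / 2) ^ (k + 1))
      (ε := 1 / ((k : ℝ) + 1)) hf hdecomp hGO hq (by linarith) (by linarith) (by positivity)
      (by linarith) (by positivity)
    refine ⟨(Y', Ψ'), ?_, h5, fun μ hμ hle e he => (h6 μ hμ hle e he).trans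
      (by linarith [hu0 k])⟩
    rw [h3, ← sub_sub, ← sub_sub, ← add_assoc]
    exact h4
  choose! F hF1 hF2 hF3 using hstep
  let y : ℕ → Set X × C(X, NNReal) := fun k => Nat.rec (Y₀, Ψ₀) F k
  have hy : ∀ k, IsStage f (y k).1 (y k).2 (h - u k) (σ - u k) (t + u k) := by
    intro k
    induction k with
    | zero => simpa [hu, y] using hst
    | succ k ih => exact hF1 k (y k) ih
  exact ⟨fun k => (y k).1, fun k => (y k).2, monotone_nat_of_le_succ fun k => hF2 k (y k) (hy k),
    fun k => ⟨u k, (huc k).le, hy k⟩, fun k => hF3 k (y k) (hy k)⟩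

theorem lintegral_le_of_birk_le_add (hf : Continuous f) {Y : Set X} {μ : ProbabilityMeasure X}
    (hμ : μ ∈ invMeas f Y) {Ψ : C(X, NNReal)} {a B : ℝ}
    (h : ∀ N : ℕ, ∀ y ∈ Y, birk f (fun x => (Ψ x : ℝ)) y N ≤ a * N + B) :
    ∫⁻ x, Ψ x ∂(μ : Measure X) ≤ ENNReal.ofReal a := by
  have hΨ : Continuous fun x => (Ψ x : ℝ) := NNReal.continuous_coe.comp Ψ.continuous
  rw [lintegral_coe_eq_integral _ (hΨ.integrable_of_hasCompactSupport
    (HasCompactSupport.of_compactSpace _))]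
  exact ENNReal.ofReal_le_ofReal (integral_le_of_birk_le_add hf hμ hΨ h)

/-- If obstructions grow at a rate below `h`, then a stage of rate `h` yields an ergodic measure of
finite entropy at least `h - 3`. -/
theorem IsStage.exists_ergodic_le_metEnt (hf : Continuous f) {D Pc Gc Sc : Set (X × ℕ)}
    {p g s : X × ℕ → ℕ}
    (hdecomp : ∀ c ∈ D, p c + g c + s c = c.2 ∧ (c.1, p c) ∈ Pc ∧
      (f^[p c] c.1, g c) ∈ Gc ∧ (f^[p c + g c] c.1, s c) ∈ Sc)
    (hGO : GluingOrbit f Gc) {q : ℝ}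
    (hq : ∀ σ > 0, ∃ A : ℝ, ∀ n, ∀ E : Finset X, (∀ x ∈ E, (x, n) ∈ Dᶜ ∪ Pc ∪ Sc) →
      IsSep f n σ E → (E.card : ℝ) ≤ A * Real.exp (q * n))
    {Y₀ : Set X} {Ψ₀ : C(X, NNReal)} {h σ : ℝ} (hst : IsStage f Y₀ Ψ₀ h σ 0) (hσ : 0 < σ)
    (hqh : q + 1 ≤ h) (hh : 2 ≤ h) :
    ∃ μ : ProbabilityMeasure X, Ergodic f (μ : Measure X) ∧ h - 3 ≤ metEnt f (μ : Measure X) := by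
  obtain ⟨W, ρ, hWo, hρ, hW1, hW2⟩ := exists_open_detecting_entropy hf (h - 3) (half_pos hσ) one_pos
  set c := min (min 1 (σ / 2)) (ρ / 2) with hcdef
  have hc : 0 < c := by positivity
  have hc1 : c ≤ 1 := (min_le_left _ _).trans (min_le_left _ _)
  have hcσ : c ≤ σ / 2 := (min_le_left _ _).trans (min_le_right _ _)
  have hcρ : c ≤ ρ / 2 := min_le_right _ _
  obtain ⟨Y, Ψ, hΨm, hY, hK⟩ := hst.exists_seq hf hdecomp hGO hq hc (by linarith) (by linarith)
    (by linarith)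
  obtain ⟨F, hF, hFW⟩ := exists_monotone_iSup_eq_indicator hWo
  set T : ENNReal := (1 - ENNReal.ofReal ρ) + ENNReal.ofReal c with hT
  have hν : ∀ k, ∃ ν ∈ invMeas f (Y k), ENNReal.ofReal ρ ≤ (ν : Measure X) Wᶜ := by
    intro k
    obtain ⟨u, huc, hst⟩ := hY k
    by_contra hcon
    push Not at hcon
    obtain ⟨N₀, hN₀⟩ := hW2 (Y k) hst.isClosed hst.mapsTo hcon
    obtain ⟨N, hN, S, hSY, hSs, hSc⟩ := hst.sep (N₀ + 1)
    have h1 := (hN₀ N (by omega)).card_le hSY (hSs.mono_scale (by linarith))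
    have h2 := Real.exp_le_exp.1 (hSc.trans h1)
    have h3 : (1 : ℝ) ≤ N := by exact_mod_cast (by omega : 1 ≤ N)
    nlinarith
  have hFle : ∀ k (ν : ProbabilityMeasure X), ∫⁻ x, F k x ∂(ν : Measure X) ≤ (ν : Measure X) W := by
    intro k ν
    rw [← lintegral_indicator_one hWo.measurableSet]
    refine lintegral_mono fun x => ?_
    refine (le_iSup (fun k => (F k x : ENNReal)) k).trans ?_
    rw [hFW]; rfl
  have hadd : ∀ k (ν : ProbabilityMeasure X), ∫⁻ x, (F k + Ψ k) x ∂(ν : Measure X) =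
      ∫⁻ x, F k x ∂(ν : Measure X) + ∫⁻ x, Ψ k x ∂(ν : Measure X) := by
    intro k ν
    rw [← lintegral_add_left (F k).continuous.measurable.coe_nnreal_ennreal]
    simp
  set L : ℕ → Set (ProbabilityMeasure X) := fun k =>
    {ν | ν ∈ invMeas f Set.univ ∧ ∫⁻ x, (F k + Ψ k) x ∂(ν : Measure X) ≤ T} with hL
  have hLc : ∀ k, IsClosed (L k) := fun k =>
    (isClosed_invMeas hf isClosed_univ).inter (isClosed_Iic.preimage
      (ProbabilityMeasure.continuous_lintegral_continuousMap (F k + Ψ k)))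
  have hLne : ∀ k, (L k).Nonempty := by
    intro k
    obtain ⟨ν, hν1, hν2⟩ := hν k
    obtain ⟨u, huc, hst⟩ := hY k
    obtain ⟨B, hB⟩ := hst.avg
    refine ⟨ν, ⟨hν1.1, by simp⟩, ?_⟩
    rw [hadd]
    refine add_le_add ((hFle k ν).trans ?_) ((lintegral_le_of_birk_le_add hf hν1 hB).trans
      (ENNReal.ofReal_le_ofReal (by linarith)))
    have := prob_add_prob_compl (μ := (ν : Measure X)) hWo.measurableSet
    exact ENNReal.le_sub_of_add_le_right ENNReal.ofReal_ne_top
      ((add_le_add le_rfl hν2).trans this.le)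
  have hmono : Monotone fun k => F k + Ψ k := fun i j hij => add_le_add (hF hij) (hΨm hij)
  have hLa : ∀ k, L (k + 1) ⊆ L k := fun k ν hν => ⟨hν.1, le_trans (lintegral_mono fun x =>
    ENNReal.coe_le_coe.2 (hmono (Nat.le_succ k) x)) hν.2⟩
  obtain ⟨ν, hν'⟩ := IsCompact.nonempty_iInter_of_sequence_nonempty_isCompact_isClosed L hLa hLne
    (hLc 0).isCompact hLc
  simp only [Set.mem_iInter] at hν'
  have hT1 : T < 1 := by
    obtain ⟨ν, -, hν⟩ := hν 0
    have h1 : ENNReal.ofReal ρ ≤ 1 := hν.trans prob_le_one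
    calc T < (1 - ENNReal.ofReal ρ) + ENNReal.ofReal ρ :=
          ENNReal.add_lt_add_left (by simp) ((ENNReal.ofReal_lt_ofReal_iff hρ).2 (by linarith))
      _ = 1 := tsub_add_cancel_of_le h1
  obtain ⟨μ, hμ, hμe, hμle⟩ := exists_ergodic_lintegral_le hf isClosed_univ _ hmono (hν' 0).1
  have hμT : ∫⁻ x, ⨆ k, ((F k + Ψ k) x : ENNReal) ∂(μ : Measure X) < 1 := by
    refine hμle.trans_lt (lt_of_le_of_lt ?_ hT1)
    rw [lintegral_iSup (fun k => ((F k + Ψ k).continuous.measurable).coe_nnreal_ennreal)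
      fun i j hij x => ENNReal.coe_le_coe.2 (hmono hij x)]
    exact iSup_le fun k => (hν' k).2
  have hfin : ∀ e : ℝ, 0 < e → katokRate f (μ : Measure X) e ≤ h + 5 := by
    intro e he
    obtain ⟨k, hk⟩ := exists_nat_one_div_lt he
    refine hK k μ hμ.1 (le_trans (lintegral_mono fun x => ?_) hμT.le) e hk.le
    refine le_trans ?_ (le_iSup (fun k => ((F k + Ψ k) x : ENNReal)) (k + 1))
    simp
  refine ⟨μ, hμe, le_trans ?_ (le_metEnt (half_pos (half_pos hσ)) hfin)⟩
  by_contra hlt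
  rw [not_le] at hlt
  have h1 := hW1 μ inferInstance hμe (eventually_katokCount_lt (half_pos (half_pos hσ)) hlt)
  have h2 : (μ : Measure X) W = 1 := (prob_compl_eq_zero_iff hWo.measurableSet).1 h1
  refine absurd hμT (not_lt.2 ?_)
  rw [← h2, ← lintegral_indicator_one hWo.measurableSet]
  refine lintegral_mono fun x => ?_
  change W.indicator (fun _ => (1 : ENNReal)) x ≤ _
  rw [← hFW]
  refine iSup_mono fun k => ?_
  simp

end InfiniteEntropy

section Expansive

open MeasureTheory

variable {X : Type*} [MetricSpace X] [CompactSpace X] [MeasurableSpace X] [BorelSpace X]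
  {f : X → X}

/-- The entropy of an almost expansive measure is bounded by the growth at the expansivity scale. -/
theorem metEnt_le_of_NEset_null (hf : Continuous f) {δ ε₁ C₀ : ℝ} (hδ : δ < ε₁) (hC₁ : 1 ≤ C₀)
    (hC₀ : BCov f (Set.univ : Set X) 1 δ C₀) {μ : Measure X} [IsProbabilityMeasure μ]
    (hμ : MeasurePreserving f μ μ) (hNE : μ (NEset f ε₁) = 0) : metEnt f μ ≤ Real.log C₀ := by
  refine metEnt_le fun e he => le_of_forall_pos_le_add fun κ hκ => ?_
  obtain ⟨C, hC1, hC⟩ := exists_bcov_one (X := X) (f := f) he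
  have hlog : 0 ≤ Real.log C := Real.log_nonneg hC1
  set ρ := κ / 2 / (Real.log C + 1) with hρdef
  have hρ : 0 < ρ := by positivity
  have hρκ : ρ * (Real.log C + 1) = κ / 2 := by rw [hρdef]; field_simp
  set V : ℕ → Set X := fun M => interior {u | ∃ y, bowenBall f M δ u ⊆ Metric.ball y (e / 2)}
    with hV
  have hVm : Monotone V := fun i j hij => interior_mono fun u ⟨y, hy⟩ =>
    ⟨y, fun _ hz => hy fun k hk => hz k (hk.trans_le hij)⟩
  have hVNE : (⋂ M, (V M)ᶜ) ⊆ NEset f ε₁ := by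
    intro y hy
    by_contra hyN
    obtain ⟨M, hM⟩ := exists_bowenBall_subset (δ := δ) (y := y) hf
      (Metric.isOpen_ball (x := y) (ε := e / 2)) (fun z hz => by
        have : z = y := by
          by_contra hzy
          exact hyN ⟨z, hzy, fun n => (hz n).trans_lt hδ⟩
        rw [this]
        exact Metric.mem_ball_self (half_pos he))
    refine Set.mem_iInter.1 hy M (mem_interior_iff_mem_nhds.2 ?_)
    exact mem_of_superset (Metric.closedBall_mem_nhds y (by positivity : 0 < 1 / (M + 1 : ℝ)))
      fun u hu => ⟨y, hM M le_rfl u hu⟩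
  have hlim : Tendsto (fun M => μ (V M)ᶜ) atTop (𝓝 0) := by
    have := tendsto_measure_iInter_atTop (μ := μ) (s := fun M => (V M)ᶜ)
      (fun M => isOpen_interior.measurableSet.compl.nullMeasurableSet)
      (fun i j hij => Set.compl_subset_compl.2 (hVm hij)) ⟨0, measure_ne_top _ _⟩
    rwa [measure_mono_null hVNE hNE] at this
  have hρ0 : 0 < ENNReal.ofReal ρ * (1 / 2) := by
    simp [hρ]
  obtain ⟨M, hM, hM1⟩ := ((hlim.eventually_lt_const hρ0).and (eventually_ge_atTop 1)).exists
  have hgood : ∀ n : ℕ, n ≠ 0 → 1 / 2 < μ {y | (badCount f (V M) y n : ℝ) ≤ ρ * n} := by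
    intro n hn
    have h1 := measure_badCount_gt_le hf hμ (V := V M) isOpen_interior.measurableSet hn hρ
    have h2 : μ {y | (badCount f (V M) y n : ℝ) ≤ ρ * n}ᶜ < 1 / 2 :=
      lt_of_le_of_lt h1 (ENNReal.div_lt_of_lt_mul' hM)
    have h3 := prob_add_prob_compl (μ := μ)
      (isOpen_badCount_le hf (V := V M) isOpen_interior n (ρ * n)).measurableSet
    by_contra hle
    rw [not_lt] at hle
    have h4 := ENNReal.add_lt_add_of_le_of_lt (measure_ne_top _ _) hle h2
    rw [h3, ENNReal.add_halves] at h4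
    exact lt_irrefl _ h4
  have hball : ∀ u ∈ V M, ∃ m, 1 ≤ m ∧ m ≤ M ∧
      BCov f (bowenBall f M δ u) m e (Real.exp (0 * m)) := by
    intro u hu
    obtain ⟨y, hy⟩ := interior_subset hu
    refine ⟨1, le_rfl, hM1, {Metric.ball y (e / 2)}, fun z hz => ⟨_, by simp, hy hz⟩, ?_, by simp⟩
    simp only [Finset.mem_singleton, forall_eq, Metric.mem_ball]
    intro z hz w hw k hk
    obtain rfl : k = 0 := by omega
    simp only [Function.iterate_zero, id_eq]
    linarith [dist_triangle_right z w y]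
  refine katokRate_le_of_eventually he ?_
  filter_upwards [eventually_le_exp_mul (C ^ M) (half_pos hκ), eventually_gt_atTop 0] with n hn hn0
  have hcov := ((hC₀.pow n).refine (ε := e) (c' := C ^ M * Real.exp (κ / 2 * n))
    (Set.subset_univ {y | (badCount f (V M) y n : ℝ) ≤ ρ * n}) (by positivity) fun x hx => by
      refine (bcov_bowenBall_le le_rfl hball hC hC1 n x).mono_bound ?_
      simp only [zero_mul, Real.exp_zero, mul_one]
      refine mul_le_mul_of_nonneg_left ?_ (by positivity)
      rw [← Real.exp_log (by linarith : 0 < C), ← Real.exp_nat_mul]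
      refine Real.exp_le_exp.2 ?_
      have hx' : (badCount f (V M) x n : ℝ) ≤ ρ * n := hx
      have h0 : (0 : ℝ) ≤ ρ * n := by positivity
      calc (badCount f (V M) x n : ℝ) * Real.log C ≤ ρ * n * (Real.log C + 1) :=
            mul_le_mul hx' (by linarith) hlog h0
        _ = κ / 2 * n := by rw [← hρκ]; ring)
  refine (katokCount_le_of_bcov hcov (hgood n hn0.ne')).trans ?_
  have h1 : C₀ ^ n = Real.exp (Real.log C₀ * n) := by
    rw [mul_comm, Real.exp_nat_mul, Real.exp_log (by linarith)]
  calc C₀ ^ n * (C ^ M * Real.exp (κ / 2 * n))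
      ≤ C₀ ^ n * (Real.exp (κ / 2 * n) * Real.exp (κ / 2 * n)) := by gcongr
    _ = Real.exp ((Real.log C₀ + κ) * n) := by
      rw [h1, ← Real.exp_add, ← Real.exp_add]; congr 1; ring

end Expansive

section InfinitePressure

open MeasureTheory

variable {X : Type*} [MetricSpace X] {f : X → X} {φ : X → ℝ}

theorem sum_exp_birk_le_card_mul {b : ℝ} (hb : ∀ x, |φ x| ≤ b) (n : ℕ) (E : Finset X) :
    ∑ x ∈ E, Real.exp (birk f φ x n) ≤ E.card * Real.exp (b * n) := by
  rw [← nsmul_eq_mul]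
  refine Finset.sum_le_card_nsmul _ _ _ fun x _ => Real.exp_le_exp.2 ?_
  exact (le_abs_self _).trans (abs_birk_le hb x n)

theorem card_le_sum_exp_birk {b : ℝ} (hb : ∀ x, |φ x| ≤ b) (n : ℕ) (E : Finset X) :
    (E.card : ℝ) ≤ (∑ x ∈ E, Real.exp (birk f φ x n)) * Real.exp (b * n) := by
  rw [Finset.sum_mul, ← nsmul_one]
  refine Finset.card_nsmul_le_sum _ _ _ fun x _ => ?_
  rw [← Real.exp_add]
  refine Real.one_le_exp ?_
  linarith [neg_abs_le (birk f φ x n), abs_birk_le (f := f) hb x n]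

variable [CompactSpace X] [MeasurableSpace X] [BorelSpace X]

/-- The partition functions grow at most exponentially uniformly in the scale, when obstructions to
gluing and to expansivity have negative pressure. -/
theorem bddAbove_pres_of_neg [Nonempty X] (hf : Continuous f) (hφ : Continuous φ)
    {D Pc Gc Sc : Set (X × ℕ)} {p g s : X × ℕ → ℕ}
    (hdecomp : ∀ c ∈ D, p c + g c + s c = c.2 ∧ (c.1, p c) ∈ Pc ∧
      (f^[p c] c.1, g c) ∈ Gc ∧ (f^[p c + g c] c.1, s c) ∈ Sc)
    (hGO : GluingOrbit f Gc) (hlow : PresFull f φ (Dᶜ ∪ Pc ∪ Sc) < 0) (hexp : PexpFull f φ < 0) :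
    BddAbove (Set.range fun δ : {d : ℝ // 0 < d} => Pres f φ Set.univ δ 0) := by
  by_contra hbdd
  obtain ⟨b, hb0, hb⟩ := exists_abs_le hφ
  have hq : ∀ σ > 0, ∃ A : ℝ, ∀ n, ∀ E : Finset X, (∀ x ∈ E, (x, n) ∈ Dᶜ ∪ Pc ∪ Sc) →
      IsSep f n σ E → (E.card : ℝ) ≤ A * Real.exp (b * n) := by
    intro σ hσ
    have h1 : BddAbove (Set.range fun δ : {d : ℝ // 0 < d} =>
        Pres f φ (Dᶜ ∪ Pc ∪ Sc) (δ : ℝ) 0) := by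
      by_contra h
      rw [PresFull, Real.iSup_of_not_bddAbove h] at hlow
      exact lt_irrefl _ hlow
    have h2 : Pres f φ (Dᶜ ∪ Pc ∪ Sc) σ 0 < 0 := (le_ciSup h1 ⟨σ, hσ⟩).trans_lt hlow
    obtain ⟨A, hA⟩ := exists_sum_le_of_pres_lt hφ hσ h2
    refine ⟨A, fun n E hE hEs => (card_le_sum_exp_birk (f := f) hb n E).trans ?_⟩
    have := hA n E hE hEs
    rw [zero_mul, Real.exp_zero, mul_one] at this
    exact mul_le_mul_of_nonneg_right this (Real.exp_pos _).le
  have : Nonempty {e : ℝ // 0 < e} := ⟨⟨1, one_pos⟩⟩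
  obtain ⟨⟨ε₁, hε₁⟩, hε⟩ := exists_lt_of_ciInf_lt hexp
  change Pexp f φ ε₁ < 0 at hε
  obtain ⟨C₀, hC1, hC₀⟩ := exists_bcov_one (X := X) (f := f) (half_pos hε₁)
  set h := max b (Real.log C₀) + 4 with hh
  have hbh : b + 4 ≤ h := by linarith [le_max_left b (Real.log C₀)]
  have hCh : Real.log C₀ + 4 ≤ h := by linarith [le_max_right b (Real.log C₀)]
  obtain ⟨_, ⟨⟨σ, hσ⟩, rfl⟩, hθ⟩ := not_bddAbove_iff.1 hbdd (h + b)
  have hst : IsStage f Set.univ (0 : C(X, NNReal)) h σ 0 := by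
    refine ⟨isClosed_univ, Set.mapsTo_univ _ _, fun N₀ => ?_, 0, fun N y _ => by simp [birk]⟩
    obtain ⟨N, hN, S, hSs, hS⟩ := exists_sep_of_lt_pres hφ hσ hθ N₀
    refine ⟨N, hN, S, fun _ _ => Set.mem_univ _, hSs, ?_⟩
    have h1 := hS.trans (sum_exp_birk_le_card_mul hb N S)
    rw [add_mul, Real.exp_add] at h1
    exact le_of_mul_le_mul_right h1 (Real.exp_pos _)
  obtain ⟨μ, hμe, hμh⟩ := hst.exists_ergodic_le_metEnt hf hdecomp hGO hq hσ (by linarith)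
    (by linarith)
  have hintegral : -b ≤ ∫ x, φ x ∂(μ : Measure X) := by
    have h1 := norm_integral_le_of_norm_le_const (μ := (μ : Measure X)) (f := φ)
      (Eventually.of_forall hb)
    rw [probReal_univ, mul_one, Real.norm_eq_abs] at h1
    exact (abs_le.1 h1).1
  have hpos : 0 < Pmu f φ (μ : Measure X) := by
    unfold Pmu
    linarith
  have hNE : (μ : Measure X) (NEset f ε₁) = 0 := by
    by_contra hne
    unfold Pexp at hε
    refine absurd (hε.trans hpos) (not_lt.2 (le_csSup ?_
      ⟨(μ : Measure X), inferInstance, hμe, pos_iff_ne_zero.2 hne, rfl⟩))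
    by_contra hbd
    rw [Real.sSup_of_not_bddAbove hbd] at hε
    exact lt_irrefl _ hε
  linarith [metEnt_le_of_NEset_null hf (half_lt_self hε₁) hC1 hC₀ hμe.toMeasurePreserving hNE]

end InfinitePressure

open MeasureTheory in
/-- **Main theorem.** If `(X,f)` is asymptotically entropy expansive and `(X,f,φ)` has
the Climenhaga–Thompson structure, then `SP(φ) = {P_μ(φ) : μ ergodic}` is dense in
`[P*(φ), P(φ)]`, i.e. `[P*(φ), P(φ)] ⊆ closure SP(φ)`. -/
theorem ergodic_pressures_dense_of_CT_structure {X : Type*} [MetricSpace X]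
    [CompactSpace X] [MeasurableSpace X] [BorelSpace X]
    (f : X → X) (hf : Continuous f) (φ : X → ℝ) (hφ : Continuous φ)
    (haee : Filter.Tendsto (fun ε => tailEnt f ε) (nhdsWithin 0 (Set.Ioi (0 : ℝ)))
      (nhds 0))
    (D Pc Gc Sc : Set (X × ℕ)) (p g s : X × ℕ → ℕ)
    (hdecomp : ∀ c ∈ D, p c + g c + s c = c.2 ∧ (c.1, p c) ∈ Pc ∧
      (f^[p c] c.1, g c) ∈ Gc ∧ (f^[p c + g c] c.1, s c) ∈ Sc)
    (hGO : GluingOrbit f Gc)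
    (hlow : PresFull f φ (Dᶜ ∪ Pc ∪ Sc) < PresTop f φ)
    (hBowen : ∃ ε₀ : ℝ, 0 < ε₀ ∧ BddAbove {v | ∃ c ∈ Gc, ∃ y : X,
      (∀ k < c.2, dist (f^[k] c.1) (f^[k] y) ≤ ε₀) ∧
      v = |birk f φ c.1 c.2 - birk f φ y c.2|})
    (hexp : PexpFull f φ < PresTop f φ) :
    Set.Icc (Pstar f φ) (PresTop f φ) ⊆
      closure {v | ∃ μ : Measure X, IsProbabilityMeasure μ ∧ Ergodic f μ ∧
        v = Pmu f φ μ} := by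
  rcases isEmpty_or_nonempty X with hX | hX
  · rw [Subsingleton.elim (Dᶜ ∪ Pc ∪ Sc) Set.univ] at hlow
    exact absurd hlow (lt_irrefl (PresTop f φ))
  have hbdd : BddAbove (Set.range fun δ : {d : ℝ // 0 < d} => Pres f φ Set.univ δ 0) := by
    by_contra hcon
    have h0 : PresTop f φ = 0 := Real.iSup_of_not_bddAbove hcon
    rw [h0] at hlow hexp
    exact hcon (bddAbove_pres_of_neg hf hφ hdecomp hGO hlow hexp)
  intro α hα
  rw [Metric.mem_closure_iff]
  intro η hη
  set κ := min (η / 13) ((PresTop f φ - PresFull f φ (Dᶜ ∪ Pc ∪ Sc)) / 5) with hκdef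
  have hκ : 0 < κ := lt_min (by positivity) (by linarith)
  have hκη : κ ≤ η / 13 := min_le_left _ _
  have hκg : κ ≤ (PresTop f φ - PresFull f φ (Dᶜ ∪ Pc ∪ Sc)) / 5 := min_le_right _ _
  obtain ⟨μ, hμ, hμe, hle⟩ := exists_ergodic_pmu_near hf hφ haee hdecomp hGO hbdd hα hκ
    (by linarith)
  refine ⟨Pmu f φ μ, ⟨μ, hμ, hμe, rfl⟩, ?_⟩
  rw [dist_comm, Real.dist_eq]
  linarith
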